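/- Let p be an odd prime and let q be a prime power with q ≡ 1 (mod p) and p^2 ∤ (q − 1). Let D be a dihedral subgroup of order 2p of G = PSL_2(q) (containing a Sylow p-subgroup of G, which has order p). If q is sufficiently large, then there exists g ∈ PGL_2(q) such that every element of the coset gD has order divisible by p. -/

import Mathlib

open Matrix Pointwise
open scoped MatrixGroups

/-- The projective general linear group `PGL₂(F) = GL₂(F)/Z(GL₂(F))`. -/
abbrev PGL2 (F : Type*) [Field F] :=
  GL (Fin 2) F ⧸ Subgroup.center (GL (Fin 2) F)

/-- The natural homomorphism `SL₂(F) → PGL₂(F)`, whose image is `PSL₂(F) ≤ PGL₂(F)`. -/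
noncomputable def SLtoPGL2 (F : Type*) [Field F] :
    SpecialLinearGroup (Fin 2) F →* PGL2 F :=
  (QuotientGroup.mk' (Subgroup.center (GL (Fin 2) F))).comp
    Matrix.SpecialLinearGroup.toGL

set_option linter.unusedSectionVars false
set_option linter.unusedVariables false

section Prelim
open Polynomial


/-- Abstract data for the Chebotarev argument: a domain `B` over `k` with a finite group action,
an embedding in Laurent series, a parameter `x` and a primitive element `y`. -/
structure CD (k B G : Type) [Field k] [CommRing B] [Algebra k B] [Group G]
    [MulSemiringAction G B] where
  φ : B →+* HahnSeries ℤ k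
  x : B
  y : B
  e : ℕ
  φ_smul : ∀ (c : k) (f : B) (n : ℤ), (φ (c • f)).coeff n = c * (φ f).coeff n
  inj : Function.Injective φ
  epos : 0 < e
  hx : (φ x).order = -(e : ℤ)
  hgx : ∀ g : G, g • x = x
  inv : ∀ f : B, (∀ g : G, g • f = f) → ∃ P : k[X], f = aeval x P
  hy : ∀ (g : G) (n : ℤ), n < -(e : ℤ) → (φ (g • y)).coeff n = 0
  hsep : ∀ g : G, g ≠ 1 → g • y ≠ y

namespace CD

theorem coeff_mul_zero {k : Type} [Field k] {a b : HahnSeries ℤ k} {m n : ℤ}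
    (ha : ∀ i < m, a.coeff i = 0) (hb : ∀ i < n, b.coeff i = 0) :
    ∀ i < m + n, (a * b).coeff i = 0 := by
  intro i hi
  rw [HahnSeries.coeff_mul]
  apply Finset.sum_eq_zero
  rintro ⟨u, v⟩ h
  rw [Finset.mem_antidiagonal] at h
  obtain ⟨h1, h2, h3⟩ := h
  by_cases hu : u < m
  · rw [ha u hu, zero_mul]
  · rw [hb v (by simp at h3; omega), mul_zero]

variable {k B G : Type} [Field k] [CommRing B] [IsDomain B] [Algebra k B] [Group G]
    [MulSemiringAction G B] [SMulCommClass G k B] [Fintype G] (S : CD k B G)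

/-- Functions with poles of order at most `e * μ` at all the places over infinity. -/
def V (μ : ℕ) : Submodule k B where
  carrier := {f | ∀ (g : G) (n : ℤ), n < -((S.e * μ : ℕ) : ℤ) → (S.φ (g • f)).coeff n = 0}
  add_mem' := by
    intro a b ha hb g n hn
    rw [smul_add, map_add, HahnSeries.coeff_add, ha g n hn, hb g n hn, add_zero]
  zero_mem' := by
    intro g n hn
    simp
  smul_mem' := by
    intro c f hf g n hn
    rw [smul_comm, S.φ_smul, hf g n hn, mul_zero]

theorem mem_V {μ : ℕ} {f : B} : f ∈ S.V μ ↔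
    ∀ (g : G) (n : ℤ), n < -((S.e * μ : ℕ) : ℤ) → (S.φ (g • f)).coeff n = 0 := Iff.rfl

theorem V_mono {μ ν : ℕ} (h : μ ≤ ν) : S.V μ ≤ S.V ν := by
  intro f hf g n hn
  apply hf g n
  have : S.e * μ ≤ S.e * ν := Nat.mul_le_mul_left _ h
  omega

theorem V_mul {μ ν : ℕ} {f f' : B} (hf : f ∈ S.V μ) (hf' : f' ∈ S.V ν) : f * f' ∈ S.V (μ + ν) := by
  intro g n hn
  rw [smul_mul', map_mul]
  apply coeff_mul_zero (hf g) (hf' g)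
  rw [mul_add] at hn; push_cast at hn ⊢; linarith

theorem V_one : (1 : B) ∈ S.V 0 := by
  intro g n hn
  rw [smul_one, map_one, HahnSeries.coeff_one, if_neg]
  simp at hn; omega

theorem V_pow {μ : ℕ} {f : B} (hf : f ∈ S.V μ) (n : ℕ) : f ^ n ∈ S.V (μ * n) := by
  induction n with
  | zero => simpa using S.V_one
  | succ n ih => rw [pow_succ, mul_add, mul_one]; exact S.V_mul ih hf

theorem V_smul {μ : ℕ} {f : B} (hf : f ∈ S.V μ) (g : G) : g • f ∈ S.V μ := by
  intro g' n hn
  rw [smul_smul]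
  exact hf _ n hn

theorem V_x : S.x ∈ S.V 1 := by
  intro g n hn
  rw [S.hgx]
  apply HahnSeries.coeff_eq_zero_of_lt_order
  rw [S.hx]; simpa using hn

theorem V_y : S.y ∈ S.V 1 := by
  intro g n hn
  apply S.hy
  simpa using hn

theorem V_aeval (P : k[X]) {n : ℕ} (h : P.natDegree ≤ n) : aeval S.x P ∈ S.V n := by
  rw [aeval_eq_sum_range]
  apply Submodule.sum_mem
  intro i hi
  apply Submodule.smul_mem
  have := S.V_pow S.V_x i
  rw [one_mul] at this
  refine S.V_mono ?_ this
  simp at hi; omega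

theorem V_prod {ι : Type} (s : Finset ι) (f : ι → B) (m : ι → ℕ) (h : ∀ i ∈ s, f i ∈ S.V (m i)) :
    ∏ i ∈ s, f i ∈ S.V (∑ i ∈ s, m i) := by
  classical
  induction s using Finset.induction_on with
  | empty => simpa using S.V_one
  | insert a s ha ih =>
    rw [Finset.prod_insert ha, Finset.sum_insert ha]
    exact S.V_mul (h a (by simp)) (ih fun i hi => h i (by simp [hi]))

theorem exists_V (f : B) : ∃ μ, f ∈ S.V μ := by
  have h : ∀ g : G, ∃ μ : ℕ, ∀ n : ℤ, n < -((S.e * μ : ℕ) : ℤ) → (S.φ (g • f)).coeff n = 0 := by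
    intro g
    refine ⟨(-(S.φ (g • f)).order).toNat, fun n hn => ?_⟩
    apply HahnSeries.coeff_eq_zero_of_lt_order
    have h1 : (-(S.φ (g • f)).order).toNat ≤ S.e * (-(S.φ (g • f)).order).toNat :=
      Nat.le_mul_of_pos_left _ S.epos
    omega
  choose μ hμ using h
  refine ⟨∑ g, μ g, fun g n hn => hμ g n ?_⟩
  have h1 : μ g ≤ ∑ g, μ g := Finset.single_le_sum (fun _ _ => Nat.zero_le _) (Finset.mem_univ g)
  have := Nat.mul_le_mul_left S.e h1
  omega

theorem φ_ne {f : B} (h : f ≠ 0) : S.φ f ≠ 0 := fun h' => h (S.inj (by rw [h', map_zero]))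

theorem φx_ne : S.φ S.x ≠ 0 := by
  intro h
  have := S.hx
  rw [h, HahnSeries.order_zero] at this
  have := S.epos
  omega

theorem φ_sum (s : Finset ℕ) (c : ℕ → k) (f : ℕ → B) (n : ℤ) :
    (S.φ (∑ i ∈ s, c i • f i)).coeff n = ∑ i ∈ s, c i * (S.φ (f i)).coeff n := by
  rw [map_sum, HahnSeries.coeff_sum]
  exact Finset.sum_congr rfl fun i _ => S.φ_smul _ _ _

theorem coeff_aeval_ne {P : k[X]} (hP : P ≠ 0) :
    (S.φ (aeval S.x P)).coeff (-((S.e * P.natDegree : ℕ) : ℤ)) ≠ 0 := by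
  have ho : ∀ i : ℕ, (S.φ (S.x ^ i)).order = -((S.e * i : ℕ) : ℤ) := by
    intro i
    rw [map_pow, HahnSeries.order_pow, S.hx]
    push_cast
    rw [nsmul_eq_mul]; ring
  rw [aeval_eq_sum_range, φ_sum, Finset.sum_range_succ, Finset.sum_eq_zero, zero_add]
  · apply mul_ne_zero
    · rwa [coeff_natDegree, leadingCoeff_ne_zero]
    · rw [← ho, ← HahnSeries.leadingCoeff_eq]
      rw [HahnSeries.leadingCoeff_ne_zero, map_pow]
      exact pow_ne_zero _ S.φx_ne
  · intro i hi
    rw [HahnSeries.coeff_eq_zero_of_lt_order, mul_zero]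
    rw [ho]
    have := Nat.mul_lt_mul_of_pos_left (Finset.mem_range.1 hi) S.epos
    omega

theorem aeval_inj {P : k[X]} (h : aeval S.x P = 0) : P = 0 := by
  by_contra hP
  apply S.coeff_aeval_ne hP
  rw [h, map_zero, HahnSeries.coeff_zero]

theorem natDegree_le {P : k[X]} {μ : ℕ} (h : aeval S.x P ∈ S.V μ) : P.natDegree ≤ μ := by
  by_cases hP : P = 0
  · simp [hP]
  by_contra hlt
  apply S.coeff_aeval_ne hP
  have := h 1 (-((S.e * P.natDegree : ℕ) : ℤ)) ?_
  · rwa [one_smul] at this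
  · have := Nat.mul_lt_mul_of_pos_left (not_le.1 hlt) S.epos
    omega

theorem exists_norm (f : B) : ∃ P : k[X], ∏ g : G, g • f = aeval S.x P := by
  apply S.inv
  intro g
  rw [Finset.smul_prod']
  simp_rw [smul_smul]
  exact Fintype.prod_equiv (Equiv.mulLeft g) _ _ (fun _ => rfl)

theorem le_order {f : B} (hf : f ≠ 0) {m : ℕ} (h : f ∈ S.V m) :
    -((S.e * m : ℕ) : ℤ) ≤ (S.φ f).order := by
  by_contra hlt
  have := h 1 (S.φ f).order (not_le.1 hlt)
  rw [one_smul, ← HahnSeries.leadingCoeff_eq, HahnSeries.leadingCoeff_eq_zero] at this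
  exact S.φ_ne hf this

theorem order_le {f : B} (hf : f ≠ 0) {m : ℕ} (h : f ∈ S.V m) :
    (S.φ f).order ≤ ((Fintype.card G * (S.e * m) : ℕ) : ℤ) := by
  classical
  obtain ⟨P, hP⟩ := S.exists_norm f
  have hg : ∀ g : G, g • f ≠ 0 := fun g hg => hf ((smul_eq_zero_iff_eq g).1 hg)
  have h0 : P ≠ 0 := by
    rintro rfl
    rw [map_zero, Finset.prod_eq_zero_iff] at hP
    obtain ⟨g, -, h⟩ := hP
    exact hg g h
  have h1 : (S.φ (∏ g : G, g • f)).order ≤ 0 := by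
    rw [hP]
    refine (HahnSeries.order_le_of_coeff_ne_zero (S.coeff_aeval_ne h0)).trans ?_
    omega
  have h2 : ∀ s : Finset G, (S.φ (∏ g ∈ s, g • f)).order = ∑ g ∈ s, (S.φ (g • f)).order := by
    intro s
    induction s using Finset.induction_on with
    | empty => simp
    | insert a s ha ih =>
      rw [Finset.prod_insert ha, Finset.sum_insert ha, map_mul, HahnSeries.order_mul, ih]
      · exact S.φ_ne (hg a)
      · exact S.φ_ne (Finset.prod_ne_zero_iff.2 fun g _ => hg g)
  rw [h2, ← Finset.add_sum_erase _ _ (Finset.mem_univ (1 : G)), one_smul] at h1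
  have h3 : ∑ g ∈ Finset.univ.erase (1 : G), (-((S.e * m : ℕ) : ℤ)) ≤
      ∑ g ∈ Finset.univ.erase (1 : G), (S.φ (g • f)).order :=
    Finset.sum_le_sum fun g _ => S.le_order (hg g) (S.V_smul h g)
  rw [Finset.sum_const, Finset.card_erase_of_mem (Finset.mem_univ _), Finset.card_univ] at h3
  have h4 : 0 < Fintype.card G := Fintype.card_pos
  rw [nsmul_eq_mul] at h3
  have h5 : ((Fintype.card G - 1 : ℕ) : ℤ) ≤ (Fintype.card G : ℤ) := by omega
  have h6 : (0:ℤ) ≤ ((S.e * m : ℕ) : ℤ) := by omega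
  push_cast at *
  nlinarith

end CD


namespace CD
variable {k B G : Type} [Field k] [CommRing B] [IsDomain B] [Algebra k B] [Group G]
    [MulSemiringAction G B] [SMulCommClass G k B] [Fintype G] (S : CD k B G)

/-- Polynomials in `x` of degree `< n`. -/
noncomputable def W (n : ℕ) : Submodule k B := (degreeLT k n).map (aeval S.x).toLinearMap

instance (n : ℕ) : Module.Finite k (degreeLT k n) :=
  Module.Finite.equiv (degreeLTEquiv k n).symm

theorem finrank_degreeLT' (n : ℕ) : Module.finrank k (degreeLT k n) = n := by
  rw [(degreeLTEquiv k n).finrank_eq]; simp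

instance (n : ℕ) : Module.Finite k (S.W n) := by
  unfold W; infer_instance

theorem finrank_W_le (n : ℕ) : Module.finrank k (S.W n) ≤ n := by
  unfold W
  exact (Submodule.finrank_map_le _ _).trans (finrank_degreeLT' n).le

theorem mem_W {f : B} {μ : ℕ} (h : ∀ g : G, g • f = f) (hf : f ∈ S.V μ) : f ∈ S.W (μ + 1) := by
  obtain ⟨P, rfl⟩ := S.inv f h
  refine ⟨P, ?_, rfl⟩
  have := S.natDegree_le hf
  rw [SetLike.mem_coe, mem_degreeLT]
  refine (degree_le_natDegree).trans_lt ?_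
  exact_mod_cast Nat.lt_succ_of_le this

/-- enumeration of the group -/
noncomputable def en : Fin (Fintype.card G) ≃ G := (Fintype.equivFin G).symm

theorem y_inj : Function.Injective fun i : Fin (Fintype.card G) => (en i : G) • S.y := by
  intro i j h
  simp only at h
  by_contra hne
  have : (en j : G)⁻¹ * en i ≠ 1 := by
    intro h'
    apply hne
    apply en.injective (α := Fin (Fintype.card G)) (β := G)
    rw [inv_mul_eq_one] at h'
    exact h'.symm
  apply S.hsep _ this
  rw [mul_smul, h, inv_smul_smul]

theorem sum_smul_fixed (f : B) (g : G) : g • ∑ h : G, h • f = ∑ h : G, h • f := by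
  rw [Finset.smul_sum]
  simp_rw [smul_smul]
  exact Fintype.sum_equiv (Equiv.mulLeft g) _ _ (fun _ => rfl)

theorem trace_mem (j : Fin (Fintype.card G)) {μ : ℕ} {f : B} (hf : f ∈ S.V μ) :
    ∑ h : G, h • (f * S.y ^ (j : ℕ)) ∈ S.W (μ + Fintype.card G) := by
  have h1 : ∑ h : G, h • (f * S.y ^ (j : ℕ)) ∈ S.V (μ + j) := by
    apply Submodule.sum_mem
    intro g _
    apply S.V_smul
    apply S.V_mul hf
    have := S.V_pow S.V_y j
    rwa [one_mul] at this
  have h2 : (j : ℕ) + 1 ≤ Fintype.card G := j.2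
  have h3 := S.mem_W (μ := μ + Fintype.card G - 1) (sum_smul_fixed _) (S.V_mono (by omega) h1)
  rwa [Nat.sub_add_cancel (by omega)] at h3

/-- The trace map. -/
noncomputable def tr (μ : ℕ) : S.V μ →ₗ[k] (Fin (Fintype.card G) → S.W (μ + Fintype.card G)) where
  toFun f := fun j => ⟨∑ h : G, h • ((f : B) * S.y ^ (j : ℕ)), S.trace_mem j f.2⟩
  map_add' a b := by
    ext j
    simp [add_mul, Finset.sum_add_distrib]
  map_smul' c a := by
    ext j
    simp only [Submodule.coe_smul, smul_mul_assoc, RingHom.id_apply, Pi.smul_apply,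
      Finset.smul_sum, smul_comm _ c]

theorem tr_inj (μ : ℕ) : Function.Injective (S.tr μ) := by
  rw [← LinearMap.ker_eq_bot, LinearMap.ker_eq_bot']
  intro f hf
  have h1 : ∀ j : Fin (Fintype.card G), ∑ i : Fin (Fintype.card G),
      ((en i : G) • (f : B)) * ((en i : G) • S.y) ^ (j : ℕ) = 0 := by
    intro j
    have := congrArg Subtype.val (congrFun hf j)
    simp only [tr, LinearMap.coe_mk, AddHom.coe_mk, Pi.zero_apply, ZeroMemClass.coe_zero] at this
    rw [← this]
    refine Fintype.sum_equiv en _ _ (fun i => ?_)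
    rw [smul_mul', smul_pow']
  have h2 := Matrix.eq_zero_of_forall_pow_sum_mul_pow_eq_zero S.y_inj h1
  have h3 := congrFun h2 (en.symm (1 : G))
  simp only [Equiv.apply_symm_apply, one_smul, Pi.zero_apply] at h3
  exact Subtype.ext h3

instance (μ : ℕ) : Module.Finite k (S.V μ) :=
  Module.Finite.of_injective (S.tr μ) (S.tr_inj μ)

theorem finrank_V_le (μ : ℕ) :
    Module.finrank k (S.V μ) ≤ Fintype.card G * (μ + Fintype.card G) := by
  refine (LinearMap.finrank_le_finrank_of_injective (S.tr_inj μ)).trans ?_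
  rw [Module.finrank_pi_fintype]
  simp only [Finset.sum_const, Finset.card_univ, Fintype.card_fin, smul_eq_mul]
  exact Nat.mul_le_mul_left _ (S.finrank_W_le _)

/-- The combination map. -/
noncomputable def cb (ν : ℕ) :
    (Fin (Fintype.card G) → degreeLT k (ν + 1)) →ₗ[k] S.V (ν + Fintype.card G) where
  toFun u := ⟨∑ j : Fin (Fintype.card G), aeval S.x (u j : k[X]) * S.y ^ (j : ℕ), by
    apply Submodule.sum_mem
    intro j _
    apply S.V_mono (μ := ν + j) (by have := j.2; omega)
    apply S.V_mul
    · apply S.V_aeval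
      have := mem_degreeLT.1 (u j).2
      by_cases h0 : (u j : k[X]) = 0
      · simp [h0]
      rw [degree_eq_natDegree h0] at this
      have h2 : (u j : k[X]).natDegree < ν + 1 := by exact_mod_cast this
      omega
    · have := S.V_pow S.V_y j
      rwa [one_mul] at this⟩
  map_add' a b := by
    ext
    simp [add_mul, Finset.sum_add_distrib]
  map_smul' c a := by
    ext
    simp [Finset.smul_sum]

theorem smul_aeval (g : G) (P : k[X]) : g • aeval S.x P = aeval S.x P := by
  rw [aeval_eq_sum_range, Finset.smul_sum]
  refine Finset.sum_congr rfl fun i _ => ?_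
  rw [smul_comm, smul_pow', S.hgx]

theorem cb_inj (ν : ℕ) : Function.Injective (S.cb ν) := by
  rw [← LinearMap.ker_eq_bot, LinearMap.ker_eq_bot']
  intro u hu
  have h0 := congrArg Subtype.val hu
  simp only [cb, LinearMap.coe_mk, AddHom.coe_mk, ZeroMemClass.coe_zero] at h0
  have h1 : ∀ i : Fin (Fintype.card G), ∑ j : Fin (Fintype.card G),
      aeval S.x (u j : k[X]) * ((en i : G) • S.y) ^ (j : ℕ) = 0 := by
    intro i
    have := congrArg (fun f => (en i : G) • f) h0
    simp only [Finset.smul_sum, smul_zero, smul_mul', smul_pow', S.smul_aeval] at this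
    exact this
  have h2 := Matrix.eq_zero_of_forall_index_sum_mul_pow_eq_zero S.y_inj h1
  ext1 j
  exact Subtype.ext (S.aeval_inj (congrFun h2 j))

theorem le_finrank_V (ν : ℕ) :
    Fintype.card G * (ν + 1) ≤ Module.finrank k (S.V (ν + Fintype.card G)) := by
  have := LinearMap.finrank_le_finrank_of_injective (S.cb_inj ν)
  rw [Module.finrank_pi_fintype] at this
  simpa [finrank_degreeLT'] using this

/-- The zero count. -/
theorem zero_count {ι : Type} [Fintype ι] (T : B →ₗ[k] (ι → k)) (hT : Function.Surjective T)
    {m : ℕ} {g₀ : B} (h0 : g₀ ≠ 0) (hg : g₀ ∈ S.V m) (hz : ∀ f, T (g₀ * f) = 0) :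
    Fintype.card ι ≤ Fintype.card G * (m + 2 * Fintype.card G) := by
  classical
  set d := Fintype.card G with hd
  have h1 : ∀ i : ι, ∃ f : B, T f = Pi.single i 1 := fun i => hT _
  choose f hf using h1
  choose μ hμ using fun i => S.exists_V (f i)
  set n := ∑ i, μ i with hn
  set ν := n + d + m with hν
  let T' : S.V ν →ₗ[k] (ι → k) := T ∘ₗ (S.V ν).subtype
  have hT' : Function.Surjective T' := by
    rw [← LinearMap.range_eq_top, eq_top_iff, ← (Pi.basisFun k ι).span_eq, Submodule.span_le]
    rintro _ ⟨i, rfl⟩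
    refine ⟨⟨f i, S.V_mono ?_ (hμ i)⟩, ?_⟩
    · have : μ i ≤ n := Finset.single_le_sum (fun _ _ => Nat.zero_le _) (Finset.mem_univ i)
      omega
    · simp [T', hf]
  let K : S.V (n + d) →ₗ[k] LinearMap.ker T' :=
    LinearMap.codRestrict _ (LinearMap.codRestrict _
      ((LinearMap.mulLeft k g₀) ∘ₗ (S.V (n + d)).subtype) (by
        intro a
        have := S.V_mul hg a.2
        rw [add_comm] at this
        exact this)) (by
        intro a
        rw [LinearMap.mem_ker]
        exact hz a)
  have hK : Function.Injective K := by
    intro a b hab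
    have := congrArg (fun z : LinearMap.ker T' => ((z : S.V ν) : B)) hab
    exact Subtype.ext (mul_left_cancel₀ h0 this)
  have e1 := LinearMap.finrank_le_finrank_of_injective hK
  have e2 := LinearMap.finrank_range_add_finrank_ker T'
  rw [LinearMap.range_eq_top.2 hT', finrank_top, Module.finrank_pi] at e2
  have e3 := S.finrank_V_le ν
  have e4 := S.le_finrank_V n
  rw [← hd] at e3 e4
  have e6 : d * (ν + d) = d * (n + d + m + d) := by rw [hν]
  have e5 : Fintype.card ι + d * (n + 1) ≤ d * (n + d + m + d) := by omega
  nlinarith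

end CD


namespace CD
variable {k B G : Type} [Field k] [CommRing B] [IsDomain B] [Algebra k B] [Group G]
    [MulSemiringAction G B] [SMulCommClass G k B] [Fintype G] (S : CD k B G)

theorem exists_orders (j : ℕ) : ∃ (O : Finset ℤ) (s : ℤ → B), Module.finrank k (S.V j) ≤ O.card ∧
    ∀ o ∈ O, s o ∈ S.V j ∧ s o ≠ 0 ∧ (S.φ (s o)).order = o := by
  classical
  let O : Finset ℤ := (Finset.Icc (-((S.e * j : ℕ) : ℤ))
    ((Fintype.card G * (S.e * j) : ℕ) : ℤ)).filter
      (fun o => ∃ f ∈ S.V j, f ≠ 0 ∧ (S.φ f).order = o)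
  have hO : ∀ o : ℤ, ∃ f : B, o ∈ O → (f ∈ S.V j ∧ f ≠ 0 ∧ (S.φ f).order = o) := by
    intro o
    by_cases h : o ∈ O
    · obtain ⟨f, hf⟩ := (Finset.mem_filter.1 h).2
      exact ⟨f, fun _ => hf⟩
    · exact ⟨0, fun h' => absurd h' h⟩
  choose s hs using hO
  refine ⟨O, s, ?_, fun o ho => hs o ho⟩
  let A : S.V j →ₗ[k] (O → k) :=
    { toFun := fun f o => (S.φ (f : B)).coeff o
      map_add' := by intro a b; ext o; simp
      map_smul' := by intro c a; ext o; simp [S.φ_smul] }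
  have hA : Function.Injective A := by
    rw [← LinearMap.ker_eq_bot, LinearMap.ker_eq_bot']
    intro f hf
    by_contra hne
    have hne' : (f : B) ≠ 0 := fun h => hne (Subtype.ext h)
    have ho : (S.φ (f : B)).order ∈ O := by
      rw [Finset.mem_filter, Finset.mem_Icc]
      exact ⟨⟨S.le_order hne' f.2, S.order_le hne' f.2⟩, f, f.2, hne', rfl⟩
    have := congrFun hf ⟨_, ho⟩
    simp only [A, LinearMap.coe_mk, AddHom.coe_mk, Pi.zero_apply] at this
    rw [← HahnSeries.leadingCoeff_eq, HahnSeries.leadingCoeff_eq_zero] at this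
    exact S.φ_ne hne' this
  have := LinearMap.finrank_le_finrank_of_injective hA
  simpa using this

theorem sum_ne_zero_of_orders {ι : Type} (s : Finset ι) (f : ι → HahnSeries ℤ k)
    (h0 : ∃ i ∈ s, f i ≠ 0)
    (hinj : ∀ i ∈ s, ∀ j ∈ s, f i ≠ 0 → f j ≠ 0 → (f i).order = (f j).order → i = j) :
    ∑ i ∈ s, f i ≠ 0 := by
  classical
  obtain ⟨i₀, hi₀, hf₀⟩ := h0
  obtain ⟨i, hi, hmin⟩ := Finset.exists_min_image (s.filter fun i => f i ≠ 0)
    (fun i => (f i).order) ⟨i₀, by simp [hi₀, hf₀]⟩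
  rw [Finset.mem_filter] at hi
  intro hsum
  have h1 := congrArg (fun z => HahnSeries.coeff z (f i).order) hsum
  simp only [HahnSeries.coeff_sum, HahnSeries.coeff_zero] at h1
  rw [Finset.sum_eq_single_of_mem i hi.1] at h1
  · rw [← HahnSeries.leadingCoeff_eq, HahnSeries.leadingCoeff_eq_zero] at h1
    exact hi.2 h1
  · intro j hj hne
    by_cases hfj : f j = 0
    · simp [hfj]
    apply HahnSeries.coeff_eq_zero_of_lt_order
    refine lt_of_le_of_ne (hmin j (by simp [hj, hfj])) ?_
    intro h
    exact hne (hinj i hi.1 j hj hi.2 hfj h).symm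

theorem nonvanish {O : Finset ℤ} {s a : ℤ → B} {l Q : ℕ}
    (hs : ∀ o ∈ O, s o ≠ 0 ∧ (S.φ (s o)).order = o) (ha : ∀ o ∈ O, a o ∈ S.V l)
    (h0 : ∃ o ∈ O, a o ≠ 0) (hQ : (Fintype.card G + 1) * (S.e * l) < Q) :
    ∑ o ∈ O, a o * s o ^ Q ≠ 0 := by
  intro h
  have h1 := congrArg S.φ h
  rw [map_sum, map_zero] at h1
  have hne : ∀ o ∈ O, S.φ (a o * s o ^ Q) ≠ 0 → a o ≠ 0 := by
    intro o ho h h'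
    apply h; rw [h', zero_mul, map_zero]
  have hord : ∀ o ∈ O, a o ≠ 0 → (S.φ (a o * s o ^ Q)).order = (S.φ (a o)).order + Q * o := by
    intro o ho hao
    rw [map_mul, map_pow, HahnSeries.order_mul (S.φ_ne hao) (pow_ne_zero _ (S.φ_ne (hs o ho).1)),
      HahnSeries.order_pow, (hs o ho).2, nsmul_eq_mul]
  refine sum_ne_zero_of_orders O _ ?_ ?_ h1
  · obtain ⟨o, ho, hao⟩ := h0
    exact ⟨o, ho, S.φ_ne (mul_ne_zero hao (pow_ne_zero _ (hs o ho).1))⟩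
  · intro i hi j hj hfi hfj hij
    have hai := hne i hi hfi
    have haj := hne j hj hfj
    rw [hord i hi hai, hord j hj haj] at hij
    have b1 := S.le_order hai (ha i hi)
    have b2 := S.order_le hai (ha i hi)
    have b3 := S.le_order haj (ha j hj)
    have b4 := S.order_le haj (ha j hj)
    have hQ' : ((Fintype.card G * (S.e * l) : ℕ) : ℤ) + ((S.e * l : ℕ) : ℤ) < (Q : ℤ) := by
      have : Fintype.card G * (S.e * l) + S.e * l < Q := by linarith
      exact_mod_cast this
    by_contra hne
    rcases lt_or_gt_of_ne hne with h | h
    · have : (Q : ℤ) * (i + 1) ≤ Q * j := by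
        apply mul_le_mul_of_nonneg_left <;> omega
      rw [mul_add] at this
      omega
    · have : (Q : ℤ) * (j + 1) ≤ Q * i := by
        apply mul_le_mul_of_nonneg_left <;> omega
      rw [mul_add] at this
      omega

theorem exists_lagrange {ι : Type} [Fintype ι] (P : ι → (B →ₐ[k] k)) (i : ι)
    (h : ∀ j, j ≠ i → P j ≠ P i) : ∃ f : B, P i f = 1 ∧ ∀ j, j ≠ i → P j f = 0 := by
  classical
  have h1 : ∀ j : ι, ∃ f : B, P i f = 1 ∧ (j ≠ i → P j f = 0) := by
    intro j
    by_cases hj : j = i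
    · exact ⟨1, by simp, fun h => absurd hj h⟩
    have : ∃ f, P j f ≠ P i f := by
      by_contra hcon
      push Not at hcon
      exact h j hj (AlgHom.ext hcon)
    obtain ⟨f, hf⟩ := this
    have hd : P i f - P j f ≠ 0 := sub_ne_zero.2 hf.symm
    refine ⟨(P i f - P j f)⁻¹ • (f - algebraMap k B (P j f)), ?_, fun _ => ?_⟩
    · simp [hd]
    · simp
  choose f hf1 hf2 using h1
  refine ⟨∏ j, f j, ?_, ?_⟩
  · rw [map_prod]; exact Finset.prod_eq_one fun j _ => hf1 j
  · intro j hj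
    rw [map_prod]
    exact Finset.prod_eq_zero (Finset.mem_univ j) (hf2 j hj)

theorem surj_of_dual {ι : Type} [Fintype ι] (T : B →ₗ[k] (ι → k))
    (h : ∀ c : ι → k, (∀ f, ∑ i, c i * T f i = 0) → c = 0) : Function.Surjective T := by
  classical
  rw [← LinearMap.range_eq_top]
  by_contra hne
  obtain ⟨l, hl, hle⟩ := Submodule.exists_le_ker_of_lt_top _ (lt_top_iff_ne_top.2 hne)
  apply hl
  have hc := h (fun i => l (Pi.single i 1)) ?_
  · ext i
    simpa using congrFun hc i
  · intro f
    have h1 : l (T f) = 0 := hle ⟨f, rfl⟩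
    rw [← h1, LinearMap.pi_apply_eq_sum_univ l (T f)]
    refine Finset.sum_congr rfl fun i _ => ?_
    rw [smul_eq_mul, mul_comm]
    congr 2
    ext j
    simp [Pi.single_apply, eq_comm]

theorem surj_eval {ι : Type} [Fintype ι] (P : ι → (B →ₐ[k] k)) (hP : Function.Injective P) :
    Function.Surjective (LinearMap.pi fun i => (P i).toLinearMap : B →ₗ[k] (ι → k)) := by
  classical
  apply surj_of_dual
  intro c hc
  ext i
  obtain ⟨f, h1, h2⟩ := exists_lagrange P i (fun j hj h => hj (hP h))
  have := hc f
  rw [Finset.sum_eq_single i] at this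
  · simpa [h1] using this
  · intro j _ hj; simp [h2 j hj]
  · simp

theorem j1_bound {d M : ℕ} (hd : 0 < d) : M + 1 ≤ d * (M / d + 1) := by
  have := Nat.lt_div_mul_add (a := M) hd
  nlinarith

/-- Stepanov, small characteristic. -/
theorem stepanov_small [IsAlgClosed k] (ℓ : ℕ) [hℓ : Fact ℓ.Prime] [CharP k ℓ] (a Q : ℕ)
    (θ : B →+* B) (hθ : ∀ m f, f ∈ S.V m → θ f ∈ S.V m)
    {ι : Type} [Fintype ι] (P : ι → (B →ₐ[k] k)) (hP : Function.Injective P)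
    (hPθ : ∀ i f, P i f ^ (ℓ ^ a * Q) = P i (θ f))
    (d M l : ℕ) (hd : d = Fintype.card G) (hM : M = ℓ ^ a)
    (hl : l = d + (M * d + 2 * d + M / d))
    (hQ : (d + 1) * (S.e * l) < Q) :
    Fintype.card ι ≤ d * (l + (d + M / d) * Q + 2 * d) := by
  classical
  have hdpos : 0 < d := hd ▸ Fintype.card_pos
  have hM0 : 0 < M := hM ▸ pow_pos hℓ.1.pos _
  have : CharP B ℓ := charP_of_injective_algebraMap (algebraMap k B).injective ℓ
  have : ExpChar B ℓ := ExpChar.prime hℓ.1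
  have : ExpChar k ℓ := ExpChar.prime hℓ.1
  set j1 := M / d with hj1
  obtain ⟨O, s, hO, hs⟩ := S.exists_orders (d + j1)
  have hO' : M + 1 ≤ O.card := by
    have h1 := S.le_finrank_V j1
    rw [← hd, add_comm j1 d] at h1
    have := j1_bound (M := M) hdpos
    rw [← hj1] at this
    omega
  set r := Module.finrank k (S.V l) with hr
  let v := Module.finBasis k (S.V l)
  have hr' : d * (M * d + 2 * d + j1 + 1) ≤ r := by
    have h1 := S.le_finrank_V (M * d + 2 * d + j1)
    rw [← hd, add_comm _ d, ← hl] at h1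
    exact h1
  let vec : O × Fin r → S.V (l * M + (d + j1)) := fun oi =>
    ⟨(v oi.2 : B) ^ M * θ (s oi.1), S.V_mul (S.V_pow (v oi.2).2 M) (hθ _ _ (hs _ oi.1.2).1)⟩
  have hdep : ¬ LinearIndependent k vec := by
    intro hli
    have h1 := hli.fintype_card_le_finrank
    have h2 := S.finrank_V_le (l * M + (d + j1))
    rw [← hd] at h2
    simp only [Fintype.card_prod, Fintype.card_coe, Fintype.card_fin] at h1
    have h3 : (M + 1) * (d * (M * d + 2 * d + j1 + 1)) ≤ d * (l * M + (d + j1) + d) :=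
      ((Nat.mul_le_mul hO' hr').trans h1).trans h2
    rw [hl] at h3
    have h4 : (M + 1) * (M * d + 2 * d + j1 + 1) ≤
      ((d + (M * d + 2 * d + j1)) * M + (d + j1) + d) := by
      apply Nat.le_of_mul_le_mul_left _ hdpos
      calc _ = _ := by ring
        _ ≤ _ := h3
    nlinarith
  obtain ⟨c, hc0, hcne⟩ := Fintype.not_linearIndependent_iff.1 hdep
  have hroot : ∀ oi, ∃ z : k, z ^ M = c oi := fun oi => IsAlgClosed.exists_pow_nat_eq _ hM0
  choose z hz using hroot
  let A : ℤ → B := fun o => if h : o ∈ O then ∑ i, z (⟨o, h⟩, i) • (v i : B) else 0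
  have hA : ∀ o ∈ O, A o ∈ S.V l := by
    intro o ho
    simp only [A, dif_pos ho]
    exact Submodule.sum_mem _ fun i _ => Submodule.smul_mem _ _ (v i).2
  have hA0 : ∃ o ∈ O, A o ≠ 0 := by
    obtain ⟨⟨o, i⟩, hne⟩ := hcne
    refine ⟨o, o.2, ?_⟩
    simp only [A, dif_pos o.2]
    intro h
    have h1 : ∑ i, z (o, i) • v i = 0 := by
      apply Subtype.ext
      simpa using h
    have h2 := Fintype.linearIndependent_iff.1 v.linearIndependent _ h1 i
    apply hne
    rw [← hz, h2, zero_pow hM0.ne']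
  have hAz : ∑ o ∈ O, A o ^ M * θ (s o) = 0 := by
    have h1 := congrArg Subtype.val hc0
    simp only [vec, ZeroMemClass.coe_zero, AddSubmonoidClass.coe_finsetSum,
      Submodule.coe_smul] at h1
    rw [Fintype.sum_prod_type] at h1
    rw [← h1, ← Finset.sum_coe_sort O]
    refine Finset.sum_congr rfl fun o _ => ?_
    simp only [A, dif_pos o.2]
    rw [hM, sum_pow_char_pow, Finset.sum_mul]
    refine Finset.sum_congr rfl fun i _ => ?_
    rw [_root_.smul_pow, ← hM, hz, smul_mul_assoc]
  set g := ∑ o ∈ O, A o * s o ^ Q with hg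
  have hgne : g ≠ 0 := S.nonvanish (fun o ho => (hs o ho).2) hA hA0 (by rw [← hd]; exact hQ)
  have hgV : g ∈ S.V (l + (d + j1) * Q) :=
    Submodule.sum_mem _ fun o ho => S.V_mul (hA o ho) (S.V_pow (hs o ho).1 Q)
  have hPg : ∀ i, P i g = 0 := by
    intro i
    have h1 : P i g ^ M = P i (∑ o ∈ O, A o ^ M * θ (s o)) := by
      rw [hg, map_sum, hM, sum_pow_char_pow, map_sum]
      refine Finset.sum_congr rfl fun o _ => ?_
      rw [map_mul, map_mul, ← hPθ, mul_pow, map_pow, map_pow, mul_comm (ℓ ^ a) Q, pow_mul (P i (s o))]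
    rw [hAz, map_zero] at h1
    exact pow_eq_zero_iff hM0.ne' |>.1 h1
  have := S.zero_count _ (surj_eval P hP) hgne hgV (by
    intro f
    ext i
    simp [hPg i])
  rw [← hd] at this
  exact this

end CD


namespace CD
variable {k B G : Type} [Field k] [CommRing B] [IsDomain B] [Algebra k B] [Group G]
    [MulSemiringAction G B] [SMulCommClass G k B] [Fintype G] (S : CD k B G)

theorem van_mul (D : Derivation k B B) (P : B →ₐ[k] k) (n : ℕ) : ∀ (h f : B),
    (∀ i ≤ n, P (D^[i] h) = 0) → P (D^[n] (h * f)) = 0 := by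
  induction n with
  | zero =>
    intro h f hh
    have := hh 0 le_rfl
    simp only [Function.iterate_zero, id_eq] at this ⊢
    rw [map_mul, this, zero_mul]
  | succ n ih =>
    intro h f hh
    have hadd : ∀ (m : ℕ) (a b : B), D^[m] (a + b) = D^[m] a + D^[m] b := by
      intro m a b
      exact iterate_map_add D m a b
    rw [Function.iterate_succ_apply, Derivation.leibniz, hadd, map_add, smul_eq_mul, smul_eq_mul,
      mul_comm f, ih h (D f) (fun i hi => hh i (by omega)), zero_add]
    apply ih
    intro i hi
    rw [← Function.iterate_succ_apply]
    exact hh _ (by omega)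

/-- the exact leading term of `u ^ n * f` at a zero of `u`. -/
theorem van_step (D : Derivation k B B) (P : B →ₐ[k] k) (u : B) (hu : P u = 0) (n : ℕ) : ∀ (f : B),
    (∀ i < n, P (D^[i] f) = 0) →
    P (D^[n] (u * f)) = 0 ∧
    P (D^[n + 1] (u * f)) = (n + 1) * P (D u) * P (D^[n] f) := by
  have hadd : ∀ (m : ℕ) (a b : B), D^[m] (a + b) = D^[m] a + D^[m] b := by
    intro m a b
    exact iterate_map_add D m a b
  have hv : ∀ m (a b : B), (∀ i ≤ m, P (D^[i] a) = 0) → P (D^[m] (b * a)) = 0 := by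
    intro m a b h
    rw [mul_comm]; exact van_mul D P m a b h
  induction n with
  | zero =>
    intro f _
    simp [hu, mul_comm]
  | succ n ih =>
    intro f hf
    have e1 : ∀ m, D^[m + 1] (u * f) = D^[m] (u * D f) + D^[m] (D u * f) := by
      intro m
      rw [Function.iterate_succ_apply, Derivation.leibniz, hadd, smul_eq_mul, smul_eq_mul, mul_comm f]
    have hf' : ∀ i < n, P (D^[i] (D f)) = 0 := by
      intro i hi
      rw [← Function.iterate_succ_apply]; exact hf _ (by omega)
    obtain ⟨i1, i2⟩ := ih (D f) hf'
    have hz : P (D^[n] (D u * f)) = 0 := hv _ _ _ fun i hi => hf i (by omega)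
    constructor
    · rw [e1, map_add, i1, hz, add_zero]
    · rw [e1, map_add, i2, ← Function.iterate_succ_apply]
      -- leading term of `D u * f`
      have hlead : ∀ m (a b : B), (∀ i < m, P (D^[i] b) = 0) →
          P (D^[m] (a * b)) = P a * P (D^[m] b) := by
        intro m
        induction m with
        | zero => intro a b _; simp
        | succ m ihm =>
          intro a b hb
          rw [Function.iterate_succ_apply, Derivation.leibniz, hadd, map_add, smul_eq_mul,
            smul_eq_mul, mul_comm b, hv m b (D a) (fun i hi => hb i (by omega)), add_zero, ihm a (D b),
            ← Function.iterate_succ_apply]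
          intro i hi
          rw [← Function.iterate_succ_apply]; exact hb _ (by omega)
      rw [hlead (n + 1) (D u) f hf]
      push_cast
      ring

theorem van_pow (D : Derivation k B B) (P : B →ₐ[k] k) (u f : B) (hu : P u = 0) (n : ℕ) :
    (∀ i < n, P (D^[i] (u ^ n * f)) = 0) ∧
    P (D^[n] (u ^ n * f)) = n.factorial * P (D u) ^ n * P f := by
  induction n with
  | zero => simp
  | succ n ih =>
    obtain ⟨h1, h2⟩ := ih
    have e : u ^ (n + 1) * f = u * (u ^ n * f) := by ring
    rw [e]
    have hs := van_step D P u hu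
    constructor
    · intro i hi
      exact (hs i _ fun i' hi' => h1 i' (by omega)).1
    · rw [(hs n _ h1).2, h2, Nat.factorial_succ]
      push_cast
      ring

theorem surj_jets (ℓ : ℕ) [hℓ : Fact ℓ.Prime] [CharP k ℓ] (M : ℕ) (hM : M ≤ ℓ)
    (D : Derivation k B B) (x : B)
    {ι : Type} [Fintype ι] (P : ι → (B →ₐ[k] k)) (hP : Function.Injective P)
    (hD : ∀ i, P i (D x) ≠ 0) :
    Function.Surjective (LinearMap.pi fun i : Fin M × ι =>
      (P i.2).toLinearMap ∘ₗ ((D : B →ₗ[k] B) ^ (i.1 : ℕ)) : B →ₗ[k] (Fin M × ι → k)) := by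
  classical
  apply surj_of_dual
  intro c hc
  by_contra hne
  obtain ⟨⟨n₁, i⟩, hni⟩ := Function.ne_iff.1 hne
  -- largest `n` with `c (n, i) ≠ 0`
  obtain ⟨n, hn, hmax⟩ := Finset.exists_max_image
    (Finset.univ.filter fun n : Fin M => c (n, i) ≠ 0) id ⟨n₁, by simpa using hni⟩
  simp only [Finset.mem_filter, Finset.mem_univ, true_and, id] at hn hmax
  obtain ⟨f, h1, h2⟩ := exists_lagrange P i (fun j hj h => hj (hP h))
  set u := x - algebraMap k B (P i x) with hu
  have hPu : P i u = 0 := by simp [hu]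
  have hDu : D u = D x := by simp [hu]
  have := hc (u ^ (n : ℕ) * f ^ M)
  have hT : ∀ (m : Fin M) (j : ι) (F : B), (LinearMap.pi fun i : Fin M × ι =>
      (P i.2).toLinearMap ∘ₗ ((D : B →ₗ[k] B) ^ (i.1 : ℕ)) : B →ₗ[k] (Fin M × ι → k)) F (m, j) =
      P j (D^[m] F) := by
    intro m j F
    simp [Module.End.pow_apply]
  rw [Finset.sum_eq_single (n, i)] at this
  · rw [hT, (van_pow D (P i) u (f ^ M) hPu n).2] at this
    rw [map_pow, h1, one_pow, mul_one, hDu] at this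
    have hfac : ((n : ℕ).factorial : k) ≠ 0 := by
      intro h
      rw [CharP.cast_eq_zero_iff k ℓ, hℓ.1.dvd_factorial] at h
      have := n.2
      omega
    exact (mul_ne_zero hn (mul_ne_zero hfac (pow_ne_zero _ (hD i)))) this
  · rintro ⟨m, j⟩ - hmj
    rw [hT]
    by_cases hj : j = i
    · subst hj
      rcases lt_trichotomy m n with hlt | heq | hgt
      · rw [(van_pow D (P j) u (f ^ M) hPu n).1 m hlt, mul_zero]
      · exact absurd (by rw [heq]) hmj
      · have : c (m, j) = 0 := by
          by_contra hcm
          exact absurd (hmax m hcm) (not_le.2 hgt)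
        rw [this, zero_mul]
    · rw [mul_comm (u ^ (n : ℕ)), (van_pow D (P j) f (u ^ (n : ℕ)) (h2 j hj) M).1 m m.2, mul_zero]
  · simp

/-- Stepanov, large characteristic. -/
theorem stepanov_large (ℓ : ℕ) [hℓ : Fact ℓ.Prime] [CharP k ℓ] (q : ℕ) (hq : ℓ ∣ q)
    (θ : B →+* B) (hθ : ∀ m f, f ∈ S.V m → θ f ∈ S.V m)
    (D : Derivation k B B) (κ : ℕ) (hD : ∀ m f, f ∈ S.V m → D f ∈ S.V (m + κ))
    {ι : Type} [Fintype ι] (P : ι → (B →ₐ[k] k)) (hP : Function.Injective P)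
    (hPθ : ∀ i f, P i f ^ q = P i (θ f)) (hPD : ∀ i, P i (D S.x) ≠ 0)
    (d M l : ℕ) (hd : d = Fintype.card G) (hM : M ≤ ℓ)
    (hl : l = d + (M * (3 * d + M * κ + M / d)))
    (hQ : (d + 1) * (S.e * l) < q) :
    M * Fintype.card ι ≤ d * (l + (d + M / d) * q + 2 * d) := by
  classical
  have hdpos : 0 < d := hd ▸ Fintype.card_pos
  set j1 := M / d with hj1
  obtain ⟨O, s, hO, hs⟩ := S.exists_orders (d + j1)
  have hO' : M + 1 ≤ O.card := by
    have h1 := S.le_finrank_V j1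
    rw [← hd, add_comm j1 d] at h1
    have := j1_bound (M := M) hdpos
    rw [← hj1] at this
    omega
  set r := Module.finrank k (S.V l) with hr
  let v := Module.finBasis k (S.V l)
  have hr' : d * (M * (3 * d + M * κ + j1) + 1) ≤ r := by
    have h1 := S.le_finrank_V (M * (3 * d + M * κ + j1))
    rw [← hd, add_comm _ d, ← hl] at h1
    exact h1
  have hDn : ∀ (n m : ℕ) f, f ∈ S.V m → D^[n] f ∈ S.V (m + n * κ) := by
    intro n
    induction n with
    | zero => intro m f hf; simpa using hf
    | succ n ih =>
      intro m f hf
      rw [Function.iterate_succ_apply]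
      have := ih _ _ (hD m f hf)
      convert this using 2
      ring
  let vec : O × Fin r → (Fin M → S.V (l + M * κ + (d + j1))) := fun oi n =>
    ⟨D^[(n : ℕ)] (v oi.2 : B) * θ (s oi.1), S.V_mul
      (S.V_mono (by have := Nat.mul_le_mul_right κ n.2.le; omega) (hDn n l _ (v oi.2).2))
      (hθ _ _ (hs _ oi.1.2).1)⟩
  have hdep : ¬ LinearIndependent k vec := by
    intro hli
    have h1 := hli.fintype_card_le_finrank
    have h2 := S.finrank_V_le (l + M * κ + (d + j1))
    rw [← hd] at h2
    rw [Module.finrank_pi_fintype] at h1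
    simp only [Fintype.card_prod, Fintype.card_coe, Fintype.card_fin, Finset.sum_const,
      Finset.card_univ, smul_eq_mul] at h1
    have h3 : (M + 1) * (d * (M * (3 * d + M * κ + j1) + 1)) ≤
        M * (d * (l + M * κ + (d + j1) + d)) :=
      ((Nat.mul_le_mul hO' hr').trans h1).trans (Nat.mul_le_mul_left _ h2)
    rw [hl] at h3
    have h4 : (M + 1) * (M * (3 * d + M * κ + j1) + 1) ≤
      M * (d + M * (3 * d + M * κ + j1) + M * κ + (d + j1) + d) := by
      apply Nat.le_of_mul_le_mul_left _ hdpos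
      calc _ = _ := by ring
        _ ≤ _ := h3
        _ = _ := by ring
    nlinarith
  obtain ⟨c, hc0, hcne⟩ := Fintype.not_linearIndependent_iff.1 hdep
  let A : ℤ → B := fun o => if h : o ∈ O then ∑ i, c (⟨o, h⟩, i) • (v i : B) else 0
  have hA : ∀ o ∈ O, A o ∈ S.V l := by
    intro o ho
    simp only [A, dif_pos ho]
    exact Submodule.sum_mem _ fun i _ => Submodule.smul_mem _ _ (v i).2
  have hA0 : ∃ o ∈ O, A o ≠ 0 := by
    obtain ⟨⟨o, i⟩, hne⟩ := hcne
    refine ⟨o, o.2, ?_⟩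
    simp only [A, dif_pos o.2]
    intro h
    have h1 : ∑ i, c (o, i) • v i = 0 := by
      apply Subtype.ext
      simpa using h
    exact hne (Fintype.linearIndependent_iff.1 v.linearIndependent _ h1 i)
  have hDsum : ∀ (n : ℕ) {ι' : Type} (t : Finset ι') (f : ι' → B),
      D^[n] (∑ i ∈ t, f i) = ∑ i ∈ t, D^[n] (f i) := by
    intro n ι' t f
    have h1 : ∀ F : B, D^[n] F = ((D : B →ₗ[k] B) ^ n) F := by
      intro F; rw [Module.End.pow_apply]; rfl
    simp only [h1, map_sum]
  have hDsmul : ∀ (n : ℕ) (a : k) (f : B), D^[n] (a • f) = a • D^[n] f := by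
    intro n a f
    have h1 : ∀ F : B, D^[n] F = ((D : B →ₗ[k] B) ^ n) F := by
      intro F; rw [Module.End.pow_apply]; rfl
    simp only [h1, map_smul]
  have hAz : ∀ n : Fin M, ∑ o ∈ O, D^[(n : ℕ)] (A o) * θ (s o) = 0 := by
    intro n
    have h1 := congrArg Subtype.val (congrFun hc0 n)
    simp only [vec, ZeroMemClass.coe_zero, AddSubmonoidClass.coe_finsetSum, Finset.sum_apply,
      Pi.smul_apply, Submodule.coe_smul, Pi.zero_apply] at h1
    rw [Fintype.sum_prod_type] at h1
    rw [← h1, ← Finset.sum_coe_sort O]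
    refine Finset.sum_congr rfl fun o _ => ?_
    simp only [A, dif_pos o.2]
    rw [hDsum, Finset.sum_mul]
    refine Finset.sum_congr rfl fun i _ => ?_
    rw [hDsmul, smul_mul_assoc]
  set g := ∑ o ∈ O, A o * s o ^ q with hg
  have hgne : g ≠ 0 := S.nonvanish (fun o ho => (hs o ho).2) hA hA0 (by rw [← hd]; exact hQ)
  have hgV : g ∈ S.V (l + (d + j1) * q) :=
    Submodule.sum_mem _ fun o ho => S.V_mul (hA o ho) (S.V_pow (hs o ho).1 q)
  have hqB : (q : B) = 0 := by
    have : CharP B ℓ := charP_of_injective_algebraMap (algebraMap k B).injective ℓ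
    rw [CharP.cast_eq_zero_iff B ℓ]; exact hq
  have hDq : ∀ (n : ℕ) (a t : B), D^[n] (a * t ^ q) = D^[n] a * t ^ q := by
    intro n
    induction n with
    | zero => intro a t; rfl
    | succ n ih =>
      intro a t
      rw [Function.iterate_succ_apply, Function.iterate_succ_apply, Derivation.leibniz,
        Derivation.leibniz_pow, ← ih]
      congr 1
      rw [nsmul_eq_mul, hqB, zero_mul, smul_zero, zero_add, smul_eq_mul, mul_comm]
  have hPg : ∀ i, ∀ n : ℕ, n < M → P i (D^[n] g) = 0 := by
    intro i n hn
    have h1 := congrArg (P i) (hAz ⟨n, hn⟩)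
    rw [map_zero, map_sum] at h1
    rw [hg, hDsum, map_sum, ← h1]
    refine Finset.sum_congr rfl fun o _ => ?_
    rw [hDq, map_mul, map_mul, map_pow, hPθ]
  have := S.zero_count _ (surj_jets ℓ M hM D S.x P hP hPD) hgne hgV (by
    intro f
    ext ⟨n, i⟩
    have := van_mul D (P i) n g f (fun m hm => hPg i m (by have := n.2; omega))
    simpa [Module.End.pow_apply] using this)
  rw [← hd] at this
  simpa using this

end CD


namespace CD
variable {k B G : Type} [Field k] [CommRing B] [IsDomain B] [Algebra k B] [Group G]
    [MulSemiringAction G B] [SMulCommClass G k B] [Fintype G] (S : CD k B G)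

theorem exists_point [IsAlgClosed k] (r : k) : ∃ P : B →ₐ[k] k, P S.x = r := by
  classical
  have hne : Ideal.span {S.x - algebraMap k B r} ≠ ⊤ := by
    intro h
    rw [Ideal.span_singleton_eq_top] at h
    obtain ⟨u, hu⟩ := h
    have hinv : ∀ g : G, g • (↑u⁻¹ : B) = ↑u⁻¹ := by
      intro g
      have h1 : g • (u : B) = u := by
        rw [hu, smul_sub, S.hgx, Algebra.algebraMap_eq_smul_one, smul_comm, smul_one]
      have h2 : (u : B) * (g • (↑u⁻¹ : B)) = 1 := by
        conv_lhs => rw [← h1]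
        rw [← smul_mul', Units.mul_inv, smul_one]
      exact (Units.mul_right_inj u).1 (by rw [h2, Units.mul_inv])
    obtain ⟨P, hP⟩ := S.inv _ hinv
    have h3 : aeval S.x ((X - C r) * P - 1) = 0 := by
      rw [map_sub, map_mul, ← hP, map_sub, aeval_X, aeval_C, ← hu, map_one, Units.mul_inv, sub_self]
    have h4 := sub_eq_zero.1 (S.aeval_inj h3)
    exact (not_isUnit_X_sub_C r) (IsUnit.of_mul_eq_one _ h4)
  obtain ⟨m, hm, hle⟩ := Ideal.exists_le_maximal _ hne
  let _ : Field (B ⧸ m) := Ideal.Quotient.field m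
  have hxr : (Ideal.Quotient.mkₐ k m) S.x = algebraMap k (B ⧸ m) r := by
    have : S.x - algebraMap k B r ∈ m := hle (Ideal.subset_span rfl)
    rw [← sub_eq_zero]
    have h2 := Ideal.Quotient.eq_zero_iff_mem.2 this
    rw [map_sub] at h2
    exact h2
  have hIntegral : Algebra.IsIntegral k (B ⧸ m) := by
    constructor
    intro z
    obtain ⟨f, rfl⟩ := Ideal.Quotient.mkₐ_surjective k m z
    -- characteristic polynomial
    have hcoef : ∀ n, ∃ c : k, (Ideal.Quotient.mkₐ k m)
        ((∏ g : G, (X - C (g • f)) : B[X]).coeff n) = algebraMap k _ c := by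
      intro n
      obtain ⟨Q, hQ⟩ := S.inv ((∏ g : G, (X - C (g • f)) : B[X]).coeff n) (by
        intro g
        have h1 := congrArg (fun p => Polynomial.coeff p n)
          (MulSemiringAction.smul_charpoly (G := G) f g)
        simp only [Polynomial.coeff_smul] at h1
        rw [MulSemiringAction.charpoly_eq] at h1
        exact h1)
      refine ⟨Q.eval r, ?_⟩
      rw [hQ, ← Polynomial.aeval_algHom_apply, hxr, aeval_algebraMap_apply]
      simp
    choose c hc using hcoef
    set p : k[X] := ∑ n ∈ Finset.range (Fintype.card G + 1), monomial n (c n) with hp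
    have hdeg : (∏ g : G, (X - C (g • f)) : B[X]).natDegree = Fintype.card G := by
      rw [natDegree_prod_of_monic _ _ fun g _ => monic_X_sub_C _]
      simp
    have hmon : (∏ g : G, (X - C (g • f)) : B[X]).Monic :=
      monic_prod_of_monic _ _ fun g _ => monic_X_sub_C _
    have hmap : p.map (algebraMap k (B ⧸ m)) = (∏ g : G, (X - C (g • f)) : B[X]).map
        (Ideal.Quotient.mkₐ k m : B →+* B ⧸ m) := by
      ext n
      rw [coeff_map, coeff_map, hp]
      simp only [finsetSum_coeff, coeff_monomial, Finset.sum_ite_eq', Finset.mem_range]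
      split_ifs with h
      · exact (hc n).symm
      · rw [coeff_eq_zero_of_natDegree_lt (by rw [hdeg]; omega), map_zero, map_zero]
    refine ⟨p, ?_, ?_⟩
    · have : (p.map (algebraMap k (B ⧸ m))).Monic := hmap ▸ hmon.map _
      exact monic_of_injective (algebraMap k (B ⧸ m)).injective this
    · rw [← eval_map, hmap, eval_map]
      change eval₂ _ ((Ideal.Quotient.mkₐ k m : B →+* B ⧸ m) f) _ = 0
      rw [eval₂_at_apply, eval_prod]
      rw [Finset.prod_eq_zero (Finset.mem_univ (1 : G)), map_zero]
      simp
  have hbij := IsAlgClosed.algebraMap_bijective_of_isIntegral (k := k) (K := B ⧸ m)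
  let E : k ≃ₐ[k] (B ⧸ m) := AlgEquiv.ofBijective (Algebra.ofId k (B ⧸ m)) hbij
  refine ⟨(E.symm : (B ⧸ m) →ₐ[k] k).comp (Ideal.Quotient.mkₐ k m), ?_⟩
  rw [AlgHom.comp_apply, hxr]
  exact E.symm.commutes r

/-- Translate of a point. -/
noncomputable def tp (P : B →ₐ[k] k) (g : G) : B →ₐ[k] k :=
  { (P : B →+* k).comp (MulSemiringAction.toRingHom G B g) with
    commutes' := by
      intro c
      change P (g • algebraMap k B c) = c
      rw [Algebra.algebraMap_eq_smul_one, smul_comm, smul_one, ← Algebra.algebraMap_eq_smul_one]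
      exact P.commutes c }

theorem tp_apply (P : B →ₐ[k] k) (g : G) (f : B) : tp P g f = P (g • f) := rfl

theorem P_aeval (P : B →ₐ[k] k) (Q : k[X]) : P (aeval S.x Q) = Q.eval (P S.x) := by
  rw [← Polynomial.aeval_algHom_apply]
  simp [aeval_def]

theorem transitive (P P' : B →ₐ[k] k) (h : P S.x = P' S.x) : ∃ σ : G, P' = tp P σ := by
  classical
  by_contra hcon
  push Not at hcon
  let Pt : Option G → (B →ₐ[k] k) := fun o => o.elim P' (fun g => tp P g)
  obtain ⟨f, h1, h2⟩ := exists_lagrange Pt none (by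
    intro j hj
    cases j with
    | none => exact absurd rfl hj
    | some g => exact (hcon g).symm)
  obtain ⟨Q, hQ⟩ := S.exists_norm (1 - f)
  have e1 : P' (∏ g : G, g • (1 - f)) = 0 := by
    rw [map_prod, Finset.prod_eq_zero (Finset.mem_univ (1 : G))]
    rw [one_smul, map_sub, map_one]
    change P' f = 1 at h1
    rw [h1, sub_self]
  have e2 : P (∏ g : G, g • (1 - f)) = 1 := by
    rw [map_prod]
    apply Finset.prod_eq_one
    intro g _
    have := h2 (some g) (by simp)
    change tp P g f = 0 at this
    rw [← tp_apply, map_sub, this]; simp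
  rw [hQ, S.P_aeval] at e1 e2
  rw [← h, e2] at e1
  exact one_ne_zero e1

/-- The ramification set is small. -/
theorem exists_bad : ∃ bad : Finset k, bad.card ≤ Fintype.card G * Fintype.card G ∧
    ∀ P : B →ₐ[k] k, P S.x ∉ bad → Function.Injective fun g : G => tp P g := by
  classical
  have h1 : ∀ g : G, ∃ Q : k[X], ∏ h : G, h • (S.y - g • S.y) = aeval S.x Q :=
    fun g => S.exists_norm _
  choose Q hQ using h1
  have hQ0 : ∀ g : G, g ≠ 1 → Q g ≠ 0 := by
    intro g hg h
    have := hQ g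
    rw [h, map_zero, Finset.prod_eq_zero_iff] at this
    obtain ⟨a, -, ha⟩ := this
    rw [smul_eq_zero_iff_eq, sub_eq_zero] at ha
    exact S.hsep g hg ha.symm
  refine ⟨Finset.univ.biUnion fun g : G => (Q g).roots.toFinset, ?_, ?_⟩
  · apply Finset.card_biUnion_le_card_mul
    intro g _
    refine (Multiset.toFinset_card_le _).trans ((card_roots' _).trans ?_)
    apply S.natDegree_le
    rw [← hQ]
    have := S.V_prod Finset.univ (fun h : G => h • (S.y - g • S.y)) (fun _ => 1) (by
      intro h _
      exact S.V_smul (Submodule.sub_mem _ S.V_y (S.V_smul S.V_y g)) h)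
    simpa using this
  · intro P hP g h hgh
    simp only at hgh
    by_contra hne
    have hne' : h * g⁻¹ ≠ 1 := fun h' => hne (mul_inv_eq_one.1 h').symm
    apply hP
    rw [Finset.mem_biUnion]
    refine ⟨h * g⁻¹, Finset.mem_univ _, ?_⟩
    rw [Multiset.mem_toFinset, mem_roots (hQ0 _ hne'), IsRoot.def, ← S.P_aeval, ← hQ, map_prod]
    apply Finset.prod_eq_zero (Finset.mem_univ (1 : G))
    have := congrArg (fun T : B →ₐ[k] k => T (g⁻¹ • S.y)) hgh
    simp only [tp_apply, smul_smul, mul_inv_cancel, one_smul] at this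
    rw [one_smul, map_sub, this, sub_self]

theorem exists_type [IsAlgClosed k] (ℓ : ℕ) [hℓ : Fact ℓ.Prime] [CharP k ℓ] (s : ℕ)
    (θ : B →+* B) (hθk : ∀ c, θ (algebraMap k B c) = algebraMap k B (c ^ ℓ ^ s)) (hθx : θ S.x = S.x)
    (P : B →ₐ[k] k) (hP : P S.x ^ ℓ ^ s = P S.x) :
    ∃ σ : G, ∀ f, P f ^ ℓ ^ s = P (θ (σ • f)) := by
  have : ExpChar k ℓ := ExpChar.prime hℓ.1
  have hbij : Function.Bijective (iterateFrobenius k ℓ s) := by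
    refine ⟨(iterateFrobenius k ℓ s).injective, fun c => ?_⟩
    obtain ⟨z, hz⟩ := IsAlgClosed.exists_pow_nat_eq c (pow_pos hℓ.1.pos s)
    exact ⟨z, by rw [iterateFrobenius_def, hz]⟩
  let E : k ≃+* k := RingEquiv.ofBijective _ hbij
  have hE : ∀ c, E c = c ^ ℓ ^ s := fun c => iterateFrobenius_def _ _ _
  let P1 : B →ₐ[k] k :=
    { (E.symm : k →+* k).comp ((P : B →+* k).comp θ) with
      commutes' := by
        intro c
        change E.symm (P (θ (algebraMap k B c))) = c
        rw [hθk, AlgHom.commutes]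
        change E.symm (c ^ ℓ ^ s) = c
        rw [← hE, RingEquiv.symm_apply_apply] }
  have hP1 : ∀ f, P1 f ^ ℓ ^ s = P (θ f) := by
    intro f
    change (E.symm (P (θ f))) ^ ℓ ^ s = _
    rw [← hE, RingEquiv.apply_symm_apply]
  obtain ⟨σ, hσ⟩ := S.transitive P P1 (by
    apply E.injective
    rw [hE, hE, hP1, hP, hθx])
  refine ⟨σ⁻¹, fun f => ?_⟩
  rw [← hP1, hσ, tp_apply, smul_inv_smul]

/-- The `λ`-parameter of the two versions of Stepanov's method. -/
def l1 (d M : ℕ) : ℕ := d + (M * d + 2 * d + M / d)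
/-- The `λ`-parameter of the two versions of Stepanov's method. -/
def l2 (d κ M : ℕ) : ℕ := d + (M * (3 * d + M * κ + M / d))
/-- error constant -/
def cc (d κ M : ℕ) : ℕ := d * (M * l1 d M + l2 d κ M + 2 * d * M)
/-- size constant -/
def nn (d e κ δ M : ℕ) : ℕ :=
  d * M * (d * d + δ) + d * cc d κ M + M * (d + 1) * e * (l1 d M + l2 d κ M)
/-- the threshold for `q`. -/
def chN (d e κ δ : ℕ) : ℕ :=
  (∑ M ∈ Finset.range ((d ^ 3 + 1) ^ 2 + 1), nn d e κ δ M) + (d ^ 3 + 1) ^ 2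

theorem exists_M (ℓ : ℕ) (hℓ : ℓ.Prime) (s M0 : ℕ) (hM0 : 1 < M0) (h : M0 ^ 2 < ℓ ^ s)
    (hle : ℓ ≤ M0) :
    ∃ a b, s = a + b ∧ M0 ≤ ℓ ^ a ∧ ℓ ^ a ≤ M0 ^ 2 := by
  have hex : ∃ a, M0 ≤ ℓ ^ a := ⟨M0, (Nat.lt_pow_self hℓ.one_lt).le⟩
  classical
  set a := Nat.find hex with ha
  have h1 : M0 ≤ ℓ ^ a := Nat.find_spec hex
  have h2 : ℓ ^ a ≤ M0 ^ 2 := by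
    rcases Nat.eq_zero_or_pos a with h0 | h0
    · rw [h0] at h1; simp at h1; omega
    · have h3 : ¬ M0 ≤ ℓ ^ (a - 1) := Nat.find_min hex (by omega)
      obtain ⟨b, hb⟩ : ∃ b, a = b + 1 := ⟨a - 1, by omega⟩
      rw [hb] at h3 ⊢
      rw [Nat.add_sub_cancel] at h3
      rw [pow_succ, pow_two]
      exact Nat.mul_le_mul (by omega) hle
  have h4 : a < s := (Nat.pow_lt_pow_iff_right hℓ.one_lt).1 (h2.trans_lt h)
  exact ⟨a, s - a, by omega, h1, h2⟩

theorem final_ineq {d M q bad n C : ℕ} (hd : 0 < d) (hM : d ^ 3 + 1 ≤ M)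
    (h : M * (d * n) ≤ (d - 1) * ((d * d + M) * q + C)) (hn : q ≤ n + bad)
    (hq : d * M * bad + d * C < q) : False := by
  obtain ⟨c, rfl⟩ : ∃ c, d = c + 1 := ⟨d - 1, by omega⟩
  rw [Nat.add_sub_cancel] at h
  have h1 : M * ((c + 1) * q) ≤ M * ((c + 1) * (n + bad)) :=
    Nat.mul_le_mul_left _ (Nat.mul_le_mul_left _ hn)
  have h2 : M * ((c + 1) * q) ≤ c * (((c + 1) * (c + 1) + M) * q + C) + (c + 1) * M * bad := by
    calc _ ≤ _ := h1
      _ = M * ((c + 1) * n) + (c + 1) * M * bad := by ring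
      _ ≤ _ := by omega
  have h3 : M * q ≤ c * ((c + 1) * (c + 1)) * q + c * C + (c + 1) * M * bad := by nlinarith
  have h4 : c * ((c + 1) * (c + 1)) + 1 ≤ M := by
    refine le_trans ?_ hM
    nlinarith [Nat.zero_le (c * c)]
  have h5 := Nat.mul_le_mul_right q h4
  nlinarith

theorem chebotarev [IsAlgClosed k] (ℓ : ℕ) [hℓ : Fact ℓ.Prime] [CharP k ℓ] (s q : ℕ)
    (hqs : q = ℓ ^ s)
    (θ : B →+* B) (hθk : ∀ c, θ (algebraMap k B c) = algebraMap k B (c ^ q)) (hθx : θ S.x = S.x)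
    (hθV : ∀ m f, f ∈ S.V m → θ f ∈ S.V m)
    (Fr : Finset k) (hFr : Fr.card = q) (hFrq : ∀ r ∈ Fr, r ^ q = r)
    (D : Derivation k B B) (κ δ : ℕ) (hD : ∀ m f, f ∈ S.V m → D f ∈ S.V (m + κ))
    (Δ : k[X]) (hΔ : D S.x = aeval S.x Δ) (hΔ0 : Δ ≠ 0) (hΔδ : Δ.natDegree ≤ δ)
    (hq : chN (Fintype.card G) S.e κ δ < q) (σ : G) :
    ∃ P : B →ₐ[k] k, P S.x ∈ Fr ∧ ∀ f, P f ^ q = P (θ (σ • f)) := by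
  classical
  set d := Fintype.card G with hd
  have hdpos : 0 < d := Fintype.card_pos
  by_contra hcon
  push Not at hcon
  obtain ⟨bad, hbad, hbadinj⟩ := S.exists_bad
  set bad' := bad ∪ Δ.roots.toFinset with hbad'
  have hbc : bad'.card ≤ d * d + δ := by
    refine (Finset.card_union_le _ _).trans (Nat.add_le_add hbad ?_)
    exact (Multiset.toFinset_card_le _).trans ((card_roots' _).trans hΔδ)
  set good := Fr \ bad' with hgood
  have hgc : q ≤ good.card + bad'.card := by
    rw [← hFr]
    have := Finset.le_card_sdiff bad' Fr
    rw [← hgood] at this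
    omega
  choose P hP using fun r : k => S.exists_point r
  have hgood1 : ∀ r ∈ good, r ∈ Fr ∧ r ∉ bad ∧ Δ.eval r ≠ 0 := by
    intro r hr
    rw [hgood, Finset.mem_sdiff, hbad', Finset.mem_union, not_or] at hr
    refine ⟨hr.1, hr.2.1, fun h => hr.2.2 ?_⟩
    rw [Multiset.mem_toFinset, mem_roots hΔ0]
    exact h
  let pt : good × G → (B →ₐ[k] k) := fun z => tp (P z.1) z.2
  have hptx : ∀ z, pt z S.x = z.1 := by
    intro z
    change P z.1 (z.2 • S.x) = _
    rw [S.hgx, hP]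
  have hpt : Function.Injective pt := by
    rintro ⟨r, g⟩ ⟨r', g'⟩ h
    have h1 := congrArg (fun T : B →ₐ[k] k => T S.x) h
    simp only [hptx] at h1
    have h1' : r = r' := Subtype.ext h1
    subst h1'
    have h2 := hbadinj (P r) (by rw [hP]; exact (hgood1 r r.2).2.1) h
    exact Prod.ext rfl h2
  have htype : ∀ z, ∃ τ : G, ∀ f, pt z f ^ q = pt z (θ (τ • f)) := by
    intro z
    rw [hqs]
    apply S.exists_type ℓ s θ (by rw [← hqs]; exact hθk) hθx
    rw [hptx, ← hqs]
    exact hFrq _ (hgood1 _ z.1.2).1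
  choose ty hty using htype
  have hne : ∀ z, ty z ≠ σ := by
    intro z hz
    obtain ⟨f, hf⟩ := hcon (pt z) (by rw [hptx]; exact (hgood1 _ z.1.2).1)
    apply hf
    rw [← hz]; exact hty z f
  -- choose M
  obtain ⟨M, hM0, hM1, hMb⟩ : ∃ M, d ^ 3 + 1 ≤ M ∧ M ≤ (d ^ 3 + 1) ^ 2 ∧
      ∀ τ : G, M * Fintype.card {z // ty z = τ} ≤ (d * d + M) * q + cc d κ M := by
    have hqM : (d ^ 3 + 1) ^ 2 < q := by
      refine lt_of_le_of_lt ?_ hq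
      unfold chN; omega
    have hnn : ∀ M, M ≤ (d ^ 3 + 1) ^ 2 → nn d S.e κ δ M < q := by
      intro M hM
      refine lt_of_le_of_lt ?_ hq
      unfold chN
      have : nn d S.e κ δ M ≤ ∑ M ∈ Finset.range ((d ^ 3 + 1) ^ 2 + 1), nn d S.e κ δ M :=
        Finset.single_le_sum (f := nn d S.e κ δ) (fun _ _ => Nat.zero_le _)
          (Finset.mem_range.2 (by omega))
      omega
    have hθσ : ∀ τ : G, ∀ m f, f ∈ S.V m →
        (θ.comp (MulSemiringAction.toRingHom G B τ)) f ∈ S.V m := by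
      intro τ m f hf
      exact hθV m _ (S.V_smul hf τ)
    have hdM : ∀ M, d * (M / d) ≤ M := fun M => Nat.mul_div_le M d
    have hd3 : 1 < d ^ 3 + 1 := by have := pow_pos hdpos 3; omega
    by_cases hlM : ℓ ≤ d ^ 3 + 1
    · obtain ⟨a, b, hab, h1, h2⟩ := exists_M ℓ hℓ.1 s (d ^ 3 + 1) hd3
        (by rw [← hqs]; exact hqM) hlM
      refine ⟨ℓ ^ a, h1, h2, fun τ => ?_⟩
      have hqab : q = ℓ ^ a * ℓ ^ b := by rw [hqs, hab, pow_add]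
      have hn := hnn _ h2
      have := S.stepanov_small ℓ a (ℓ ^ b) (θ.comp (MulSemiringAction.toRingHom G B τ))
        (hθσ τ) (fun z : {z // ty z = τ} => pt z) (fun z z' h => Subtype.ext (hpt h))
        (by
          rintro ⟨z, hz⟩ f
          rw [← hqab]
          subst hz
          exact hty z f) d (ℓ ^ a) (l1 d (ℓ ^ a)) hd rfl rfl (by
          have hpos : 0 < ℓ ^ a := pow_pos hℓ.1.pos a
          apply Nat.lt_of_mul_lt_mul_left (a := ℓ ^ a)
          rw [← hqab]
          refine lt_of_le_of_lt ?_ hn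
          unfold nn
          have : ℓ ^ a * ((d + 1) * (S.e * l1 d (ℓ ^ a))) ≤
            ℓ ^ a * (d + 1) * S.e * (l1 d (ℓ ^ a) + l2 d κ (ℓ ^ a)) := by
            calc _ = ℓ ^ a * (d + 1) * S.e * (l1 d (ℓ ^ a)) := by ring
              _ ≤ _ := Nat.mul_le_mul_left _ (Nat.le_add_right _ _)
          omega)
      have h3 := Nat.mul_le_mul_left (ℓ ^ a) this
      refine h3.trans ?_
      have h4 : ℓ ^ a * (d * (l1 d (ℓ ^ a) + (d + ℓ ^ a / d) * ℓ ^ b + 2 * d)) =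
        d * (ℓ ^ a * l1 d (ℓ ^ a) + 2 * d * ℓ ^ a) + (d * d + d * (ℓ ^ a / d)) * q := by
        rw [hqab]; ring
      rw [h4]
      have h5 := Nat.mul_le_mul_right q (Nat.add_le_add_left (hdM (ℓ ^ a)) (d * d))
      have h6 : d * (ℓ ^ a * l1 d (ℓ ^ a) + 2 * d * ℓ ^ a) ≤ cc d κ (ℓ ^ a) := by
        unfold cc
        apply Nat.mul_le_mul_left
        omega
      omega
    · push Not at hlM
      refine ⟨d ^ 3 + 1, le_rfl, by nlinarith, fun τ => ?_⟩
      have hs0 : s ≠ 0 := by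
        rintro rfl
        rw [hqs, pow_zero] at hqM
        have := Nat.pow_pos (n := 2) (show 0 < d ^ 3 + 1 by omega)
        omega
      have hM2 : d ^ 3 + 1 ≤ (d ^ 3 + 1) ^ 2 := by nlinarith
      have hn := hnn _ hM2
      set M := d ^ 3 + 1 with hMdef
      have := S.stepanov_large ℓ q (hqs ▸ dvd_pow_self ℓ hs0)
        (θ.comp (MulSemiringAction.toRingHom G B τ))
        (hθσ τ) D κ hD (fun z : {z // ty z = τ} => pt z) (fun z z' h => Subtype.ext (hpt h))
        (by
          rintro ⟨z, hz⟩ f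
          subst hz
          exact hty z f)
        (by
          rintro ⟨z, hz⟩
          rw [hΔ, S.P_aeval, hptx]
          exact (hgood1 _ z.1.2).2.2) d M (l2 d κ M) hd hlM.le rfl (by
          refine lt_of_le_of_lt ?_ hn
          unfold nn
          have : ((d + 1) * (S.e * l2 d κ M)) ≤
            M * (d + 1) * S.e * (l1 d M + l2 d κ M) := by
            calc _ = 1 * ((d + 1) * S.e * l2 d κ M) := by ring
              _ ≤ M * ((d + 1) * S.e * (l1 d M + l2 d κ M)) :=
                Nat.mul_le_mul (by omega) (Nat.mul_le_mul_left _ (Nat.le_add_left _ _))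
              _ = _ := by ring
          omega)
      refine this.trans ?_
      have h4 : (d * (l2 d κ M + (d + M / d) * q + 2 * d)) =
        d * (l2 d κ M + 2 * d) + (d * d + d * (M / d)) * q := by
        ring
      rw [h4]
      have h5 := Nat.mul_le_mul_right q (Nat.add_le_add_left (hdM M) (d * d))
      have h6 : d * (l2 d κ M + 2 * d) ≤ cc d κ M := by
        unfold cc
        apply Nat.mul_le_mul_left
        have : 2 * d * 1 ≤ 2 * d * M := Nat.mul_le_mul_left _ (by omega)
        omega
      omega
  -- counting
  have hcount : d * good.card = ∑ τ ∈ Finset.univ.erase σ, Fintype.card {z // ty z = τ} := by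
    have h1 : Fintype.card (good × G) = ∑ τ : G, Fintype.card {z // ty z = τ} := by
      rw [← Fintype.card_sigma]
      exact Fintype.card_congr (Equiv.sigmaFiberEquiv ty).symm
    rw [Fintype.card_prod, Fintype.card_coe, ← Finset.add_sum_erase _ _ (Finset.mem_univ σ)] at h1
    have h2 : Fintype.card {z // ty z = σ} = 0 := by
      rw [Fintype.card_eq_zero_iff]
      exact ⟨fun z => hne z.1 z.2⟩
    rw [h2, zero_add] at h1
    rw [← h1, mul_comm]
  have hfin : M * (d * good.card) ≤ (d - 1) * ((d * d + M) * q + cc d κ M) := by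
    rw [hcount, Finset.mul_sum]
    refine (Finset.sum_le_card_nsmul _ _ _ fun τ _ => hMb τ).trans ?_
    rw [Finset.card_erase_of_mem (Finset.mem_univ _), Finset.card_univ, smul_eq_mul]
  refine final_ineq hdpos hM0 hfin (hgc.trans (Nat.add_le_add_left hbc _)) ?_
  refine lt_of_le_of_lt ?_ hq
  unfold chN
  have : nn d S.e κ δ M ≤ ∑ M ∈ Finset.range ((d ^ 3 + 1) ^ 2 + 1), nn d S.e κ δ M :=
    Finset.single_le_sum (f := nn d S.e κ δ) (fun _ _ => Nat.zero_le _)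
      (Finset.mem_range.2 (by omega))
  have h2 : d * M * (d * d + δ) + d * cc d κ M ≤ nn d S.e κ δ M := by
    unfold nn; omega
  omega

end CD


/-- Galois data: `L / k(x)` generated by the `w i`, embedded in Laurent series. -/
structure GD (k L ι : Type) [Field k] [Field L] [Algebra k L] [Algebra k[X] L]
    [Algebra (FractionRing k[X]) L] where
  p : ℕ
  hp : 2 < p
  ω : k
  hω : IsPrimitiveRoot ω p
  φ : L →+* HahnSeries ℤ k
  φ_C : ∀ c, φ (algebraMap k L c) = HahnSeries.C c
  φ_x : φ (algebraMap k[X] L X) = HahnSeries.single (-(p : ℤ)) 1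
  w : ι → L
  T : ι → k[X]
  rel : ∀ i, w i ^ p + (w i)⁻¹ ^ p + 2 = algebraMap k[X] L (T i)
  ordw : ∀ i, (φ (w i)).order = -2
  hT : ∀ i, (T i).natDegree = 2
  lead : ∀ i, (φ (w i)).coeff (-2) ^ p = (T i).leadingCoeff
  gen : ∀ g : L ≃ₐ[FractionRing k[X]] L, (∀ i, g (w i) = w i) → g = 1

namespace GD
variable {k L ι : Type} [Field k] [Field L] [Algebra k L] [Algebra k[X] L]
    [Algebra (FractionRing k[X]) L] [IsScalarTower k k[X] L]
    [IsScalarTower k[X] (FractionRing k[X]) L] [FiniteDimensional (FractionRing k[X]) L]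
    [IsGalois (FractionRing k[X]) L] [Fintype ι] (S : GD k L ι)

/-- The Galois group. -/
abbrev Gal (k L : Type) [Field k] [Field L] [Algebra (FractionRing k[X]) L] : Type :=
  L ≃ₐ[FractionRing k[X]] L

theorem φ_inj : Function.Injective S.φ := S.φ.injective

theorem w_ne (i : ι) : S.w i ≠ 0 := by
  intro h
  have := S.ordw i
  rw [h, map_zero, HahnSeries.order_zero] at this
  omega

theorem g_poly (g : Gal k L) (P : k[X]) : g (algebraMap k[X] L P) = algebraMap k[X] L P := by
  rw [IsScalarTower.algebraMap_apply k[X] (FractionRing k[X]) L, AlgEquiv.commutes]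

theorem g_k (g : Gal k L) (c : k) : g (algebraMap k L c) = algebraMap k L c := by
  rw [IsScalarTower.algebraMap_apply k k[X] L, g_poly]

theorem hωL : IsPrimitiveRoot (algebraMap k L S.ω) S.p :=
  S.hω.map_of_injective (algebraMap k L).injective

/-- Roots of the defining equation. -/
theorem root_cases {u v : L} (hu : u ≠ 0) (hv : v ≠ 0)
    (h : u ^ S.p + u⁻¹ ^ S.p = v ^ S.p + v⁻¹ ^ S.p) :
    ∃ a < S.p, u = algebraMap k L (S.ω ^ a) * v ∨ u = algebraMap k L (S.ω ^ a) * v⁻¹ := by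
  have hp0 : NeZero S.p := ⟨by have := S.hp; omega⟩
  have key : (u ^ S.p - v ^ S.p) * (u ^ S.p - v⁻¹ ^ S.p) = 0 := by
    have h1 : u ^ S.p * u⁻¹ ^ S.p = 1 := by rw [← mul_pow, mul_inv_cancel₀ hu, one_pow]
    have h2 : v ^ S.p * v⁻¹ ^ S.p = 1 := by rw [← mul_pow, mul_inv_cancel₀ hv, one_pow]
    linear_combination (u ^ S.p) * h - h1 + h2
  have fin : ∀ z : L, z ≠ 0 → u ^ S.p = z ^ S.p → ∃ a < S.p, u = algebraMap k L (S.ω ^ a) * z := by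
    intro z hz hzu
    obtain ⟨a, ha, haz⟩ := S.hωL.eq_pow_of_pow_eq_one (ξ := u / z) (by
      rw [div_pow, hzu, div_self (pow_ne_zero _ hz)])
    refine ⟨a, ha, ?_⟩
    rw [map_pow, haz, div_mul_cancel₀ _ hz]
  rcases mul_eq_zero.1 key with h | h
  · obtain ⟨a, ha, h⟩ := fin v hv (sub_eq_zero.1 h)
    exact ⟨a, ha, Or.inl h⟩
  · obtain ⟨a, ha, h⟩ := fin v⁻¹ (inv_ne_zero hv) (sub_eq_zero.1 h)
    exact ⟨a, ha, Or.inr h⟩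

theorem act (g : Gal k L) (i : ι) : ∃ a < S.p, g (S.w i) = algebraMap k L (S.ω ^ a) * S.w i ∨
    g (S.w i) = algebraMap k L (S.ω ^ a) * (S.w i)⁻¹ := by
  apply S.root_cases
  · rw [_root_.map_ne_zero]; exact S.w_ne i
  · exact S.w_ne i
  · have h1 := congrArg g (S.rel i)
    rw [g_poly, ← S.rel i, map_add, map_add, map_pow, map_pow, map_inv₀, map_ofNat] at h1
    exact add_right_cancel h1

/-- The generators of `B`. -/
def gens : Set L := {algebraMap k[X] L X} ∪ (Set.range S.w ∪ Set.range fun i => (S.w i)⁻¹)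

/-- The ring `B`. -/
def B : Subalgebra k L := Algebra.adjoin k S.gens

theorem w_mem (i : ι) : S.w i ∈ S.B := Algebra.subset_adjoin (Or.inr (Or.inl ⟨i, rfl⟩))
theorem wi_mem (i : ι) : (S.w i)⁻¹ ∈ S.B := Algebra.subset_adjoin (Or.inr (Or.inr ⟨i, rfl⟩))
theorem x_mem : algebraMap k[X] L X ∈ S.B := Algebra.subset_adjoin (Or.inl rfl)
theorem k_mem (c : k) : algebraMap k L c ∈ S.B := S.B.algebraMap_mem c
theorem poly_mem (P : k[X]) : algebraMap k[X] L P ∈ S.B := by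
  have : algebraMap k[X] L P = aeval (algebraMap k[X] L X) P := by
    rw [aeval_algebraMap_apply]; simp
  rw [this]
  rw [aeval_eq_sum_range]
  exact S.B.sum_mem fun i _ => S.B.smul_mem (S.B.pow_mem S.x_mem i) _

theorem g_mem (g : Gal k L) {b : L} (hb : b ∈ S.B) : g b ∈ S.B := by
  refine Algebra.adjoin_induction (p := fun b _ => g b ∈ S.B) ?_ ?_ ?_ ?_ hb
  · rintro b (rfl | ⟨i, rfl⟩ | ⟨i, rfl⟩)
    · rw [g_poly]; exact S.x_mem
    · obtain ⟨a, -, h | h⟩ := S.act g i <;> rw [h]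
      · exact S.B.mul_mem (S.k_mem _) (S.w_mem i)
      · exact S.B.mul_mem (S.k_mem _) (S.wi_mem i)
    · have hom : algebraMap k L (S.ω ^ 1) ≠ 0 := by
        rw [Ne, map_eq_zero, pow_one]
        exact S.hω.ne_zero (by have := S.hp; omega)
      simp only [map_inv₀]
      obtain ⟨a, -, h | h⟩ := S.act g i <;> rw [h, mul_inv, ← map_inv₀]
      · exact S.B.mul_mem (S.k_mem _) (S.wi_mem i)
      · rw [inv_inv]; exact S.B.mul_mem (S.k_mem _) (S.w_mem i)
  · intro c; rw [g_k]; exact S.k_mem c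
  · intro a b _ _ ha hb; rw [map_add]; exact S.B.add_mem ha hb
  · intro a b _ _ ha hb; rw [map_mul]; exact S.B.mul_mem ha hb

noncomputable instance : MulSemiringAction (Gal k L) S.B where
  smul g b := ⟨g b, S.g_mem g b.2⟩
  one_smul b := Subtype.ext rfl
  mul_smul g h b := Subtype.ext rfl
  smul_zero g := Subtype.ext (map_zero g)
  smul_add g a b := Subtype.ext (map_add g _ _)
  smul_one g := Subtype.ext (map_one g)
  smul_mul g a b := Subtype.ext (map_mul g _ _)

theorem smul_def (g : Gal k L) (b : S.B) : ((g • b : S.B) : L) = g b := rfl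

instance : SMulCommClass (Gal k L) k S.B where
  smul_comm g c b := by
    apply Subtype.ext
    rw [smul_def, Subalgebra.coe_smul, Subalgebra.coe_smul, smul_def, Algebra.smul_def, map_mul, g_k,
      Algebra.smul_def]

theorem integral {b : L} (hb : b ∈ S.B) : IsIntegral k[X] b := by
  have hp0 : 0 < S.p := by have := S.hp; omega
  have key : ∀ u : L, (∃ P : k[X], u ≠ 0 ∧ u ^ S.p + u⁻¹ ^ S.p + 2 = algebraMap k[X] L P) →
      IsIntegral k[X] u := by
    rintro u ⟨P, hu, hP⟩
    apply IsIntegral.of_pow hp0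
    obtain ⟨Q, hQ⟩ : ∃ Q : k[X], u ^ S.p + u⁻¹ ^ S.p = algebraMap k[X] L Q :=
      ⟨P - 2, by rw [map_sub, ← hP, map_ofNat]; ring⟩
    refine ⟨X ^ 2 - (C Q * X - 1), ?_, ?_⟩
    · apply monic_X_pow_sub
      compute_degree!
    · have h1 : u ^ S.p * u⁻¹ ^ S.p = 1 := by rw [← mul_pow, mul_inv_cancel₀ hu, one_pow]
      simp only [eval₂_sub, eval₂_pow, eval₂_X, eval₂_mul, eval₂_C, eval₂_one, ← hQ]
      linear_combination (-1 : L) * h1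
  refine Algebra.adjoin_induction (p := fun b _ => IsIntegral k[X] b) ?_ ?_ ?_ ?_ hb
  · rintro b (rfl | ⟨i, rfl⟩ | ⟨i, rfl⟩)
    · exact isIntegral_algebraMap
    · exact key _ ⟨S.T i, S.w_ne i, S.rel i⟩
    · refine key _ ⟨S.T i, inv_ne_zero (S.w_ne i), ?_⟩
      rw [inv_inv, ← S.rel i]; ring
  · intro c
    rw [IsScalarTower.algebraMap_apply k k[X] L]
    exact isIntegral_algebraMap
  · intro a b _ _ ha hb; exact ha.add hb
  · intro a b _ _ ha hb; exact ha.mul hb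

theorem fixed {b : L} (hb : b ∈ S.B) (hg : ∀ g : Gal k L, g b = b) :
    ∃ P : k[X], b = algebraMap k[X] L P := by
  obtain ⟨z, rfl⟩ := (IsGalois.mem_range_algebraMap_iff_fixed (F := FractionRing k[X]) b).2 hg
  have h1 : IsIntegral k[X] z :=
    (isIntegral_algebraMap_iff (algebraMap (FractionRing k[X]) L).injective).1 (S.integral hb)
  obtain ⟨P, hP⟩ := IsIntegrallyClosed.isIntegral_iff.1 h1
  exact ⟨P, by rw [← hP, ← IsScalarTower.algebraMap_apply]⟩

theorem coeff_C_mul (c : k) (f : L) (n : ℤ) :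
    (S.φ (algebraMap k L c * f)).coeff n = c * (S.φ f).coeff n := by
  rw [map_mul, S.φ_C, HahnSeries.C_mul_eq_smul, HahnSeries.coeff_smul, smul_eq_mul]

theorem coeff_w (i : ι) {n : ℤ} (hn : n < -(S.p : ℤ)) : (S.φ (S.w i)).coeff n = 0 := by
  apply HahnSeries.coeff_eq_zero_of_lt_order
  rw [S.ordw]; have := S.hp; omega

theorem order_wi (i : ι) : (S.φ (S.w i)⁻¹).order = 2 := by
  have h1 : S.φ (S.w i) ≠ 0 := (map_ne_zero S.φ).2 (S.w_ne i)
  have h2 : S.φ (S.w i)⁻¹ ≠ 0 := (map_ne_zero S.φ).2 (inv_ne_zero (S.w_ne i))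
  have h3 := HahnSeries.order_mul h1 h2
  rw [← map_mul, mul_inv_cancel₀ (S.w_ne i), map_one, HahnSeries.order_one, S.ordw] at h3
  omega

theorem coeff_wi (i : ι) {n : ℤ} (hn : n < -(S.p : ℤ)) : (S.φ (S.w i)⁻¹).coeff n = 0 := by
  apply HahnSeries.coeff_eq_zero_of_lt_order
  rw [S.order_wi]; have := S.hp; omega

theorem coeff_gw (g : Gal k L) (i : ι) {n : ℤ} (hn : n < -(S.p : ℤ)) :
    (S.φ (g (S.w i))).coeff n = 0 := by
  obtain ⟨a, -, h | h⟩ := S.act g i <;> rw [h, coeff_C_mul]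
  · rw [S.coeff_w i hn, mul_zero]
  · rw [S.coeff_wi i hn, mul_zero]

theorem exists_y [Infinite k] : ∃ y : L, y ∈ S.B ∧
    (∀ (g : Gal k L) (n : ℤ), n < -(S.p : ℤ) → (S.φ (g y)).coeff n = 0) ∧
    ∀ g : Gal k L, g ≠ 1 → g y ≠ y := by
  classical
  let E := Fintype.equivFin ι
  let Q : Gal k L → L[X] := fun g => ∑ i, C (g (S.w i) - S.w i) * X ^ (E i : ℕ)
  have hQ : ∀ g, g ≠ 1 → Q g ≠ 0 := by
    intro g hg h
    apply hg
    apply S.gen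
    intro i
    have := congrArg (fun P => P.coeff (E i : ℕ)) h
    simp only [Q, finsetSum_coeff, coeff_C_mul_X_pow, coeff_zero] at this
    rw [Finset.sum_eq_single i] at this
    · simpa [sub_eq_zero] using this
    · intro j _ hj
      rw [if_neg]
      intro h
      exact hj (E.injective (Fin.ext h)).symm
    · simp
  have hfin : ∃ c : k, ∀ g : Gal k L, g ≠ 1 → (Q g).eval (algebraMap k L c) ≠ 0 := by
    let bad : Finset L := (Finset.univ.filter fun g : Gal k L => g ≠ 1).biUnion
      fun g => (Q g).roots.toFinset
    obtain ⟨c, hc⟩ : ∃ c : k, algebraMap k L c ∉ bad := by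
      by_contra hcon
      push Not at hcon
      have : Set.Finite (Set.range (algebraMap k L)) :=
        bad.finite_toSet.subset (by rintro _ ⟨c, rfl⟩; exact hcon c)
      exact Set.infinite_range_of_injective (algebraMap k L).injective this
    refine ⟨c, fun g hg h => hc ?_⟩
    rw [Finset.mem_biUnion]
    exact ⟨g, by simp [hg], by rw [Multiset.mem_toFinset, mem_roots (hQ g hg)]; exact h⟩
  obtain ⟨c, hc⟩ := hfin
  refine ⟨∑ i, algebraMap k L (c ^ (E i : ℕ)) * S.w i, ?_, ?_, ?_⟩
  · exact S.B.sum_mem fun i _ => S.B.mul_mem (S.k_mem _) (S.w_mem i)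
  · intro g n hn
    rw [map_sum, map_sum, HahnSeries.coeff_sum]
    apply Finset.sum_eq_zero
    intro i _
    rw [map_mul, g_k, coeff_C_mul, S.coeff_gw g i hn, mul_zero]
  · intro g hg h
    apply hc g hg
    simp only [Q, eval_finsetSum, eval_mul, eval_C, eval_pow, eval_X]
    rw [← sub_eq_zero, map_sum, ← Finset.sum_sub_distrib] at h
    rw [← h]
    refine Finset.sum_congr rfl fun i _ => ?_
    rw [map_mul, g_k, map_pow]
    ring

/-- The Chebotarev data. -/
noncomputable def cd [Infinite k] : CD k S.B (Gal k L) where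
  φ := S.φ.comp S.B.val.toRingHom
  x := ⟨algebraMap k[X] L X, S.x_mem⟩
  y := ⟨S.exists_y.choose, S.exists_y.choose_spec.1⟩
  e := S.p
  φ_smul := by
    intro c f n
    rw [Algebra.smul_def]
    exact S.coeff_C_mul c f n
  inj := fun a b h => Subtype.ext (S.φ_inj h)
  epos := by have := S.hp; omega
  hx := by
    change (S.φ (algebraMap k[X] L X)).order = _
    rw [S.φ_x, HahnSeries.order_single one_ne_zero]
  hgx := fun g => Subtype.ext (g_poly g X)
  inv := by
    intro f hf
    obtain ⟨P, hP⟩ := S.fixed f.2 (fun g => congrArg Subtype.val (hf g))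
    refine ⟨P, Subtype.ext ?_⟩
    have h2 := Polynomial.aeval_algHom_apply S.B.val
      (⟨algebraMap k[X] L X, S.x_mem⟩ : S.B) P
    change _ = S.B.val _
    rw [← h2, hP]
    change _ = aeval (algebraMap k[X] L X) P
    rw [aeval_algebraMap_apply]; simp
  hy := fun g n hn => S.exists_y.choose_spec.2.1 g n hn
  hsep := fun g hg h => S.exists_y.choose_spec.2.2 g hg (congrArg Subtype.val h)

theorem card_le : Fintype.card (Gal k L) ≤ (2 * S.p) ^ Fintype.card ι := by
  classical
  have h1 : ∀ (g : Gal k L) (i : ι), ∃ z : Bool × Fin S.p,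
      g (S.w i) = if z.1 then algebraMap k L (S.ω ^ (z.2 : ℕ)) * S.w i
        else algebraMap k L (S.ω ^ (z.2 : ℕ)) * (S.w i)⁻¹ := by
    intro g i
    obtain ⟨a, ha, h | h⟩ := S.act g i
    · exact ⟨(true, ⟨a, ha⟩), by simpa using h⟩
    · exact ⟨(false, ⟨a, ha⟩), by simpa using h⟩
  choose z hz using h1
  have hinj : Function.Injective z := by
    intro g h hgh
    have : h⁻¹ * g = 1 := by
      apply S.gen
      intro i
      rw [AlgEquiv.mul_apply, hz, hgh, ← hz, ← AlgEquiv.mul_apply, inv_mul_cancel, AlgEquiv.one_apply]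
    exact (inv_mul_eq_one.1 this).symm
  have := Fintype.card_le_of_injective z hinj
  simpa using this

end GD


namespace HS
variable {k : Type} [Field k]

/-- coefficientwise modification -/
def cmap (F : ℤ → k → k) (hF : ∀ n, F n 0 = 0) (f : HahnSeries ℤ k) : HahnSeries ℤ k where
  coeff n := F n (f.coeff n)
  isPWO_support' := f.isPWO_support.mono (by
    intro n hn h
    apply hn
    change F n (f.coeff n) = 0
    rw [h, hF])

theorem cmap_coeff (F : ℤ → k → k) (hF : ∀ n, F n 0 = 0) (f : HahnSeries ℤ k) (n : ℤ) :
    (cmap F hF f).coeff n = F n (f.coeff n) := rfl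

theorem cmap_support (F : ℤ → k → k) (hF : ∀ n, F n 0 = 0) (f : HahnSeries ℤ k) :
    (cmap F hF f).support ⊆ f.support := by
  intro n hn h
  apply hn
  change F n (f.coeff n) = 0
  rw [h, hF]

theorem coeff_mul_both (a b f g : HahnSeries ℤ k) (ha : a.support ⊆ f.support)
    (hb : b.support ⊆ g.support) (n : ℤ) : (a * b).coeff n =
      ∑ ij ∈ Finset.antidiagonal f.isPWO_support g.isPWO_support n, a.coeff ij.1 * b.coeff ij.2 := by
  rw [HahnSeries.coeff_mul]
  apply Finset.sum_subset
  · intro ij hij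
    rw [Finset.mem_antidiagonal] at hij ⊢
    exact ⟨ha hij.1, hb hij.2.1, hij.2.2⟩
  · intro ij hij hn
    rw [Finset.mem_antidiagonal] at hij hn
    by_cases h1 : a.coeff ij.1 = 0
    · rw [h1, zero_mul]
    · by_cases h2 : b.coeff ij.2 = 0
      · rw [h2, mul_zero]
      · exact absurd ⟨h1, h2, hij.2.2⟩ hn

/-- the derivation `z d/dz` -/
def dS (f : HahnSeries ℤ k) : HahnSeries ℤ k := cmap (fun n c => (n : k) * c) (by simp) f

theorem dS_coeff (f : HahnSeries ℤ k) (n : ℤ) : (dS f).coeff n = n * f.coeff n := rfl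

theorem dS_add (f g : HahnSeries ℤ k) : dS (f + g) = dS f + dS g := by
  ext n; simp only [dS_coeff, HahnSeries.coeff_add]; ring

theorem dS_C (c : k) : dS (HahnSeries.C c) = 0 := by
  ext n
  simp only [dS_coeff, HahnSeries.C_apply, HahnSeries.coeff_single, HahnSeries.coeff_zero]
  split_ifs with h
  · simp [h]
  · simp

theorem dS_single (m : ℤ) (c : k) : dS (HahnSeries.single m c) = HahnSeries.single m (m * c) := by
  ext n
  simp only [dS_coeff, HahnSeries.coeff_single]
  split_ifs with h
  · simp [h]
  · simp

theorem dS_mul (f g : HahnSeries ℤ k) : dS (f * g) = dS f * g + f * dS g := by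
  ext n
  rw [HahnSeries.coeff_add, dS_coeff, coeff_mul_both f g f g subset_rfl subset_rfl,
    coeff_mul_both (dS f) g f g (cmap_support _ _ _) subset_rfl,
    coeff_mul_both f (dS g) f g subset_rfl (cmap_support _ _ _), Finset.mul_sum,
    ← Finset.sum_add_distrib]
  refine Finset.sum_congr rfl fun ij hij => ?_
  rw [Finset.mem_antidiagonal] at hij
  rw [dS_coeff, dS_coeff, ← hij.2.2]
  push_cast
  ring

/-- the twist ring hom -/
noncomputable def twist (ψ : k →+* k) (ω : k) (hω : ω ≠ 0) : HahnSeries ℤ k →+* HahnSeries ℤ k where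
  toFun := cmap (fun n c => ω ^ n * ψ c) (by simp)
  map_zero' := by ext n; simp [cmap_coeff]
  map_one' := by
    ext n; simp only [cmap_coeff, HahnSeries.coeff_one]
    split_ifs with h
    · simp [h]
    · simp
  map_add' f g := by
    ext n; simp only [cmap_coeff, HahnSeries.coeff_add, map_add]; ring
  map_mul' f g := by
    ext n
    rw [coeff_mul_both _ _ f g (cmap_support _ _ _) (cmap_support _ _ _), cmap_coeff,
      HahnSeries.coeff_mul, map_sum, Finset.mul_sum]
    refine Finset.sum_congr rfl fun ij hij => ?_
    rw [Finset.mem_antidiagonal] at hij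
    rw [cmap_coeff, cmap_coeff, ← hij.2.2, map_mul, zpow_add₀ hω]
    ring

theorem twist_coeff (ψ : k →+* k) (ω : k) (hω : ω ≠ 0) (f : HahnSeries ℤ k) (n : ℤ) :
    (twist ψ ω hω f).coeff n = ω ^ n * ψ (f.coeff n) := rfl

theorem twist_single (ψ : k →+* k) (ω : k) (hω : ω ≠ 0) (m : ℤ) (c : k) :
    twist ψ ω hω (HahnSeries.single m c) = HahnSeries.single m (ω ^ m * ψ c) := by
  ext n
  simp only [twist_coeff, HahnSeries.coeff_single]
  split_ifs with h
  · simp [h]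
  · simp

end HS

namespace GD
variable {k L ι : Type} [Field k] [Field L] [Algebra k L] [Algebra k[X] L]
    [Algebra (FractionRing k[X]) L] [IsScalarTower k k[X] L]
    [IsScalarTower k[X] (FractionRing k[X]) L] [FiniteDimensional (FractionRing k[X]) L]
    [IsGalois (FractionRing k[X]) L] [Fintype ι] (S : GD k L ι)

theorem pne : (S.p : k) ≠ 0 := by
  have hp0 : NeZero S.p := ⟨by have := S.hp; omega⟩
  exact (S.hω.neZero').ne

/-- polynomial `T(T-4)` -/
noncomputable def td (i : ι) : k[X] := S.T i * (S.T i - 4)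

/-- The discriminant. -/
noncomputable def disc : k[X] := ∏ i, S.td i

/-- The discriminant without `i`. -/
noncomputable def disc' [DecidableEq ι] (i : ι) : k[X] := ∏ j ∈ Finset.univ.erase i, S.td j

theorem disc_eq [DecidableEq ι] (i : ι) : S.disc = S.td i * S.disc' i :=
  (Finset.mul_prod_erase _ _ (Finset.mem_univ i)).symm

theorem td_ne (i : ι) : S.td i ≠ 0 := by
  have h := S.hT i
  apply mul_ne_zero
  · intro h0; rw [h0] at h; simp at h
  · intro h0
    rw [sub_eq_zero] at h0
    rw [h0] at h
    have : (4 : k[X]).natDegree = 0 := natDegree_ofNat 4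
    omega

theorem td_deg (i : ι) : (S.td i).natDegree ≤ 4 := by
  have h := S.hT i
  have h4 : (4 : k[X]).natDegree = 0 := natDegree_ofNat 4
  refine natDegree_mul_le.trans ?_
  have := natDegree_sub_le (S.T i) 4
  omega

theorem disc_ne : S.disc ≠ 0 := Finset.prod_ne_zero_iff.2 fun i _ => S.td_ne i

theorem disc_deg : S.disc.natDegree ≤ 4 * Fintype.card ι := by
  refine (natDegree_prod_le _ _).trans ?_
  refine (Finset.sum_le_card_nsmul _ _ 4 fun i _ => S.td_deg i).trans ?_
  simp [mul_comm]

/-- `Disc * d/dx` on Laurent series. -/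
noncomputable def dop (f : HahnSeries ℤ k) : HahnSeries ℤ k :=
  S.φ (algebraMap k[X] L S.disc) * (HahnSeries.single (S.p : ℤ) (-(S.p : k)⁻¹) * HS.dS f)

theorem dop_add (f g : HahnSeries ℤ k) : S.dop (f + g) = S.dop f + S.dop g := by
  unfold dop; rw [HS.dS_add]; ring

theorem dop_mul (f g : HahnSeries ℤ k) : S.dop (f * g) = S.dop f * g + f * S.dop g := by
  unfold dop; rw [HS.dS_mul]; ring

theorem dop_C (c : k) : S.dop (HahnSeries.C c) = 0 := by
  unfold dop; rw [HS.dS_C]; simp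

theorem dop_x : S.dop (S.φ (algebraMap k[X] L X)) = S.φ (algebraMap k[X] L S.disc) := by
  unfold dop
  rw [S.φ_x, HS.dS_single, HahnSeries.single_mul_single]
  have := S.pne
  have h2 : -(S.p : k)⁻¹ * (((-(S.p : ℤ) : ℤ) : k) * 1) = 1 := by push_cast; field_simp
  rw [h2]
  simp

theorem dop_pow (f : HahnSeries ℤ k) (n : ℕ) :
    S.dop (f ^ n) = n * f ^ (n - 1) * S.dop f := by
  induction n with
  | zero => rw [pow_zero, ← map_one HahnSeries.C, dop_C]; simp
  | succ n ih =>
    rw [pow_succ, dop_mul, ih]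
    rcases n with _ | n
    · simp
    · simp only [Nat.add_sub_cancel]; push_cast; ring

theorem dop_poly (P : k[X]) : S.dop (S.φ (algebraMap k[X] L P)) =
    S.φ (algebraMap k[X] L (derivative P * S.disc)) := by
  induction P using Polynomial.induction_on' with
  | add P Q hP hQ => 
    rw [map_add, map_add, dop_add, hP, hQ, ← map_add, ← map_add]; congr 2; simp; ring
  | monomial n a =>
    have h1 : algebraMap k[X] L (monomial n a) = algebraMap k L a * algebraMap k[X] L X ^ n := by
      rw [← C_mul_X_pow_eq_monomial, map_mul, map_pow, IsScalarTower.algebraMap_apply k k[X] L]; rfl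
    rw [h1, map_mul, dop_mul, S.φ_C, dop_C, zero_mul, zero_add, map_pow, dop_pow,
      dop_x, ← C_mul_X_pow_eq_monomial, derivative_C_mul_X_pow]
    rw [map_mul, map_mul, map_mul, map_pow, map_mul, map_pow, C_mul, map_mul]
    have h2 : algebraMap k[X] L (C a) = algebraMap k L a := by
      rw [IsScalarTower.algebraMap_apply k k[X] L]; rfl
    rw [h2, map_mul, S.φ_C, map_natCast C, map_natCast, map_natCast]
    ring

/-- formula for the derivative of a root -/
noncomputable def dw [DecidableEq ι] (i : ι) (u : L) : L :=
  algebraMap k L (S.p : k)⁻¹ * u * algebraMap k[X] L (derivative (S.T i)) *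
    (u ^ S.p - u⁻¹ ^ S.p) * algebraMap k[X] L (S.disc' i)

theorem dop_root [DecidableEq ι] (i : ι) (u : L) (hu : u ≠ 0)
    (h : u ^ S.p + u⁻¹ ^ S.p + 2 = algebraMap k[X] L (S.T i)) :
    S.dop (S.φ u) = S.φ (S.dw i u) := by
  have hp0 : 0 < S.p := by have := S.hp; omega
  have h1 : u ^ S.p * u⁻¹ ^ S.p = 1 := by rw [← mul_pow, mul_inv_cancel₀ hu, one_pow]
  set Y := u ^ S.p - u⁻¹ ^ S.p with hY
  have hY2 : Y ^ 2 = algebraMap k[X] L (S.td i) := by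
    rw [td, map_mul, map_sub, ← h, hY, map_ofNat]
    linear_combination (-4 : L) * h1
  have hY0 : Y ≠ 0 := by
    intro h0
    rw [h0, zero_pow two_ne_zero] at hY2
    have := (map_eq_zero_iff (algebraMap k[X] L) (by
      rw [IsScalarTower.algebraMap_eq k[X] (FractionRing k[X]) L]
      exact (algebraMap (FractionRing k[X]) L).injective.comp
        (IsFractionRing.injective k[X] (FractionRing k[X])))).1 hY2.symm
    exact S.td_ne i this
  have hinv : S.φ u * S.dop (S.φ u⁻¹) = - S.φ u⁻¹ * S.dop (S.φ u) := by
    have := S.dop_mul (S.φ u) (S.φ u⁻¹)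
    rw [← map_mul, mul_inv_cancel₀ hu, map_one, ← map_one HahnSeries.C, dop_C] at this
    linear_combination -this
  have e1 := S.dop_poly (S.T i)
  rw [← h, map_add, map_add, dop_add, dop_add, map_pow, map_pow, dop_pow, dop_pow] at e1
  have e2 : S.dop (S.φ 2) = 0 := by
    have : S.φ 2 = HahnSeries.C 2 := by rw [map_ofNat, map_ofNat]
    rw [this, dop_C]
  rw [e2, add_zero] at e1
  have e3 : (S.p : HahnSeries ℤ k) * S.φ Y * S.dop (S.φ u) =
      S.φ u * S.φ (algebraMap k[X] L (derivative (S.T i) * S.disc)) := by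
    rw [← e1, hY, map_sub, map_pow, map_pow]
    obtain ⟨m, hm⟩ : ∃ m, S.p = m + 1 := ⟨S.p - 1, by omega⟩
    rw [hm]
    have h5 : S.φ u * S.φ u⁻¹ = 1 := by rw [← map_mul, mul_inv_cancel₀ hu, map_one]
    simp only [Nat.add_sub_cancel]
    rw [pow_succ, pow_succ]
    linear_combination -((m + 1 : ℕ) : HahnSeries ℤ k) * (S.φ u⁻¹) ^ m * hinv
  have hpp : (S.p : HahnSeries ℤ k) * S.φ (algebraMap k L (S.p : k)⁻¹) = 1 := by
    rw [S.φ_C, ← map_natCast HahnSeries.C, ← map_mul, mul_inv_cancel₀ S.pne, map_one]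
  have hp1 : (S.p : HahnSeries ℤ k) ≠ 0 := left_ne_zero_of_mul_eq_one hpp
  have hYφ : S.φ Y ≠ 0 := (_root_.map_ne_zero S.φ).2 hY0
  apply mul_left_cancel₀ (mul_ne_zero hp1 hYφ)
  rw [e3, S.disc_eq i, dw, ← hY]
  simp only [map_mul]
  have hY3 : S.φ Y ^ 2 = S.φ (algebraMap k[X] L (S.td i)) := by rw [← map_pow, hY2]
  rw [← hY3]
  linear_combination (-S.φ u * S.φ (algebraMap k[X] L (derivative (S.T i))) * S.φ Y ^ 2 *
    S.φ (algebraMap k[X] L (S.disc' i))) * hpp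

theorem g_dw [DecidableEq ι] (i : ι) (u : L) (g : Gal k L) : g (S.dw i u) = S.dw i (g u) := by
  unfold dw
  simp only [map_mul, map_sub, map_pow, map_inv₀, g_poly, g_k]

end GD


namespace GD
variable {k L ι : Type} [Field k] [Field L] [Algebra k L] [Algebra k[X] L]
    [Algebra (FractionRing k[X]) L] [IsScalarTower k k[X] L]
    [IsScalarTower k[X] (FractionRing k[X]) L] [FiniteDimensional (FractionRing k[X]) L]
    [IsGalois (FractionRing k[X]) L] [Fintype ι] (S : GD k L ι)

theorem dw_mem [DecidableEq ι] (i : ι) (u : L) (hu : u ∈ S.B) (hui : u⁻¹ ∈ S.B) :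
    S.dw i u ∈ S.B := by
  unfold dw
  exact S.B.mul_mem (S.B.mul_mem (S.B.mul_mem (S.B.mul_mem (S.k_mem _) hu) (S.poly_mem _))
    (S.B.sub_mem (S.B.pow_mem hu _) (S.B.pow_mem hui _))) (S.poly_mem _)

theorem exists_D (b : S.B) : ∃ b' : S.B, ∀ g : Gal k L, S.φ (g b') = S.dop (S.φ (g b)) := by
  classical
  obtain ⟨b, hb⟩ := b
  have key : ∀ (i : ι) (u : L), u ≠ 0 → u ∈ S.B → u⁻¹ ∈ S.B →
      u ^ S.p + u⁻¹ ^ S.p + 2 = algebraMap k[X] L (S.T i) →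
      ∃ b' : S.B, ∀ g : Gal k L, S.φ (g b') = S.dop (S.φ (g u)) := by
    intro i u hu h1 h2 h3
    refine ⟨⟨S.dw i u, S.dw_mem i u h1 h2⟩, fun g => ?_⟩
    rw [S.dop_root i (g u) ((_root_.map_ne_zero g).2 hu), S.g_dw]
    have := congrArg g h3
    simpa only [map_add, map_pow, map_inv₀, map_ofNat, g_poly] using this
  refine Algebra.adjoin_induction (p := fun b _ => ∃ b' : S.B, ∀ g : Gal k L,
    S.φ (g b') = S.dop (S.φ (g b))) ?_ ?_ ?_ ?_ hb
  · rintro b (rfl | ⟨i, rfl⟩ | ⟨i, rfl⟩)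
    · refine ⟨⟨algebraMap k[X] L S.disc, S.poly_mem _⟩, fun g => ?_⟩
      rw [g_poly, g_poly, S.dop_x]
    · exact key i _ (S.w_ne i) (S.w_mem i) (S.wi_mem i) (S.rel i)
    · refine key i _ (inv_ne_zero (S.w_ne i)) (S.wi_mem i) (by rw [inv_inv]; exact S.w_mem i) ?_
      rw [inv_inv, ← S.rel i]; ring
  · intro c
    refine ⟨0, fun g => ?_⟩
    rw [g_k, S.φ_C, S.dop_C]; simp
  · rintro a b _ _ ⟨a', ha⟩ ⟨b', hb⟩
    refine ⟨a' + b', fun g => ?_⟩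
    rw [map_add, map_add, dop_add, ← ha, ← hb, ← map_add, ← map_add]; rfl
  · rintro a b ha1 hb1 ⟨a', ha⟩ ⟨b', hb⟩
    refine ⟨a' * ⟨b, hb1⟩ + ⟨a, ha1⟩ * b', fun g => ?_⟩
    rw [map_mul, map_mul, dop_mul, ← ha, ← hb, ← map_mul, ← map_mul, ← map_mul, ← map_mul,
      ← map_add, ← map_add]; rfl

/-- the derivation as function -/
noncomputable def dfun (b : S.B) : S.B := (S.exists_D b).choose

theorem dfun_spec (b : S.B) (g : Gal k L) : S.φ (g (S.dfun b)) = S.dop (S.φ (g b)) :=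
  (S.exists_D b).choose_spec g

theorem dfun_spec1 (b : S.B) : S.φ (S.dfun b) = S.dop (S.φ b) := S.dfun_spec b 1

theorem dfun_add (a b : S.B) : S.dfun (a + b) = S.dfun a + S.dfun b := by
  apply Subtype.ext
  apply S.φ_inj
  rw [dfun_spec1, Subalgebra.coe_add, map_add, dop_add, ← dfun_spec1, ← dfun_spec1, ← map_add]; rfl

theorem dfun_mul (a b : S.B) : S.dfun (a * b) = S.dfun a * b + a * S.dfun b := by
  apply Subtype.ext
  apply S.φ_inj
  rw [dfun_spec1, Subalgebra.coe_mul, map_mul, dop_mul, ← dfun_spec1, ← dfun_spec1, ← map_mul,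
    ← map_mul, ← map_add]; rfl

theorem dfun_k (c : k) : S.dfun (algebraMap k S.B c) = 0 := by
  apply Subtype.ext
  apply S.φ_inj
  rw [dfun_spec1]
  change S.dop (S.φ (algebraMap k L c)) = _
  rw [S.φ_C, dop_C]; simp

/-- the derivation -/
noncomputable def der : Derivation k S.B S.B :=
  Derivation.mk' 
    { toFun := S.dfun
      map_add' := S.dfun_add
      map_smul' := by
        intro c b
        rw [Algebra.smul_def, dfun_mul, dfun_k, zero_mul, zero_add, ← Algebra.smul_def]; rfl }
    (by
      intro a b
      change S.dfun (a * b) = _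
      rw [dfun_mul, smul_eq_mul, smul_eq_mul, add_comm, mul_comm (S.dfun a)]
      rfl)

theorem der_apply (b : S.B) : S.der b = S.dfun b := rfl

theorem aeval_x [Infinite k] (P : k[X]) : ((aeval S.cd.x P : S.B) : L) = algebraMap k[X] L P := by
  have h2 := Polynomial.aeval_algHom_apply S.B.val
      (⟨algebraMap k[X] L X, S.x_mem⟩ : S.B) P
  change S.B.val _ = _
  change _ = S.B.val (aeval S.cd.x P) at h2
  rw [← h2]
  change aeval (algebraMap k[X] L X) P = _
  rw [aeval_algebraMap_apply]; simp

theorem der_x [Infinite k] : S.der S.cd.x = aeval S.cd.x S.disc := by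
  apply Subtype.ext
  apply S.φ_inj
  rw [der_apply, dfun_spec1, S.aeval_x]
  exact S.dop_x

theorem der_V [Infinite k] (m : ℕ) (f : S.B) (hf : f ∈ S.cd.V m) :
    S.der f ∈ S.cd.V (m + 4 * Fintype.card ι) := by
  intro g n hn
  have h1 := S.cd.V_aeval S.disc S.disc_deg
  have h2 : ∀ n < -((S.p * (4 * Fintype.card ι) : ℕ) : ℤ),
      (S.φ (algebraMap k[X] L S.disc)).coeff n = 0 := by
    intro n hn
    rw [← S.aeval_x]
    have := h1 1 n hn
    rwa [one_smul] at this
  change (S.φ (g (S.dfun f))).coeff n = 0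
  rw [dfun_spec, dop]
  refine CD.coeff_mul_zero h2 (n := -((S.p * m : ℕ) : ℤ)) ?_ n ?_
  · intro i hi
    rw [HahnSeries.coeff_single_mul, HS.dS_coeff]
    have : (S.φ (g f)).coeff (i - S.p) = 0 := hf g _ (by
      have : S.cd.e = S.p := rfl
      rw [this]; omega)
    rw [this]; ring
  · have : S.cd.e = S.p := rfl
    rw [this] at hn; push_cast at hn ⊢; linarith

section theta
variable (q : ℕ) (θ : L →+* L) (hθ : ∀ f n, (S.φ (θ f)).coeff n = (S.φ f).coeff n ^ q)
  (hTq : ∀ i n, (S.T i).coeff n ^ q = (S.T i).coeff n) (hq0 : q ≠ 0)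
  (hadd : ∀ a b : k, (a + b) ^ q = a ^ q + b ^ q)

/-- Frobenius power -/
def frq (q : ℕ) (hq0 : q ≠ 0) (hadd : ∀ a b : k, (a + b) ^ q = a ^ q + b ^ q) : k →+* k where
  toFun c := c ^ q
  map_one' := one_pow q
  map_mul' a b := mul_pow a b q
  map_zero' := zero_pow hq0
  map_add' := hadd

theorem θ_k (hθ : ∀ f n, (S.φ (θ f)).coeff n = (S.φ f).coeff n ^ q) (hq0 : q ≠ 0) (c : k) :
    θ (algebraMap k L c) = algebraMap k L (c ^ q) := by
  apply S.φ_inj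
  ext n
  rw [hθ, S.φ_C, S.φ_C, HahnSeries.C_apply, HahnSeries.C_apply, HahnSeries.coeff_single,
    HahnSeries.coeff_single]
  split_ifs
  · rfl
  · exact zero_pow hq0

theorem θ_x (hθ : ∀ f n, (S.φ (θ f)).coeff n = (S.φ f).coeff n ^ q) (hq0 : q ≠ 0) :
    θ (algebraMap k[X] L X) = algebraMap k[X] L X := by
  apply S.φ_inj
  ext n
  rw [hθ, S.φ_x, HahnSeries.coeff_single]
  split_ifs
  · exact one_pow q
  · exact zero_pow hq0

theorem θ_poly (hθ : ∀ f n, (S.φ (θ f)).coeff n = (S.φ f).coeff n ^ q) (hq0 : q ≠ 0)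
    (hadd : ∀ a b : k, (a + b) ^ q = a ^ q + b ^ q) (P : k[X]) :
    θ (algebraMap k[X] L P) = algebraMap k[X] L (P.map (frq q hq0 hadd)) := by
  have hC : ∀ c : k, algebraMap k[X] L (C c) = algebraMap k L c := by
    intro c; rw [IsScalarTower.algebraMap_apply k k[X] L]; rfl
  induction P using Polynomial.induction_on' with
  | add P Q hP hQ => rw [map_add, map_add, hP, hQ, Polynomial.map_add, map_add]
  | monomial n a =>
    rw [Polynomial.map_monomial, ← C_mul_X_pow_eq_monomial, ← C_mul_X_pow_eq_monomial, map_mul,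
      map_mul, map_mul, map_pow, map_pow, S.θ_x q θ hθ hq0, hC, hC, S.θ_k q θ hθ hq0]
    rfl

theorem θ_T (hθ : ∀ f n, (S.φ (θ f)).coeff n = (S.φ f).coeff n ^ q) (hq0 : q ≠ 0)
    (hadd : ∀ a b : k, (a + b) ^ q = a ^ q + b ^ q)
    (hTq : ∀ i n, (S.T i).coeff n ^ q = (S.T i).coeff n) (i : ι) :
    θ (algebraMap k[X] L (S.T i)) = algebraMap k[X] L (S.T i) := by
  rw [S.θ_poly q θ hθ hq0 hadd]
  congr 1
  ext n
  rw [coeff_map]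
  exact hTq i n

theorem coeff_w_ne (i : ι) : (S.φ (S.w i)).coeff (-2) ≠ 0 := by
  rw [← S.ordw i]
  exact HahnSeries.coeff_order_eq_zero.not.2 ((_root_.map_ne_zero S.φ).2 (S.w_ne i))

theorem θ_w (hθ : ∀ f n, (S.φ (θ f)).coeff n = (S.φ f).coeff n ^ q) (hq0 : q ≠ 0)
    (hadd : ∀ a b : k, (a + b) ^ q = a ^ q + b ^ q)
    (hTq : ∀ i n, (S.T i).coeff n ^ q = (S.T i).coeff n) (hpq : S.p ∣ q - 1) (i : ι) :
    θ (S.w i) = algebraMap k L ((S.T i).leadingCoeff ^ ((q - 1) / S.p)) * S.w i := by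
  have h0 : θ (S.w i) ≠ 0 := (_root_.map_ne_zero θ).2 (S.w_ne i)
  have h1 : (θ (S.w i)) ^ S.p + (θ (S.w i))⁻¹ ^ S.p = (S.w i) ^ S.p + (S.w i)⁻¹ ^ S.p := by
    have := congrArg θ (S.rel i)
    rw [S.θ_T q θ hθ hq0 hadd hTq, ← S.rel i, map_add, map_add, map_pow, map_pow, map_inv₀,
      map_ofNat] at this
    exact add_right_cancel this
  have h3 := hθ (S.w i) (-2)
  have h4 := S.coeff_w_ne i
  obtain ⟨a, -, h | h⟩ := S.root_cases h0 (S.w_ne i) h1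
  · rw [h]
    congr 2
    rw [h, S.coeff_C_mul] at h3
    rw [← S.lead, ← pow_mul, Nat.mul_div_cancel' hpq]
    apply mul_right_cancel₀ h4
    rw [h3, ← pow_succ]
    congr 1
    omega
  · rw [h, S.coeff_C_mul, HahnSeries.coeff_eq_zero_of_lt_order, mul_zero] at h3
    · exact absurd h3.symm (pow_ne_zero _ h4)
    · rw [S.order_wi]; norm_num

theorem lead_ne (i : ι) : (S.T i).leadingCoeff ≠ 0 := by
  rw [Ne, leadingCoeff_eq_zero]
  intro h0; have := S.hT i; rw [h0] at this; simp at this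

theorem θ_surj [IsAlgClosed k] (hθ : ∀ f n, (S.φ (θ f)).coeff n = (S.φ f).coeff n ^ q) (hq0 : q ≠ 0)
    (hadd : ∀ a b : k, (a + b) ^ q = a ^ q + b ^ q)
    (hTq : ∀ i n, (S.T i).coeff n ^ q = (S.T i).coeff n) (hpq : S.p ∣ q - 1) :
    Function.Surjective θ := by
  have hfs : Function.Surjective (frq (k := k) q hq0 hadd) := by
    intro c
    obtain ⟨d, hd⟩ := IsAlgClosed.exists_pow_nat_eq c (Nat.pos_of_ne_zero hq0)
    exact ⟨d, hd⟩
  have hP : ∀ P : k[X], algebraMap k[X] L P ∈ θ.fieldRange := by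
    intro P
    obtain ⟨Q, rfl⟩ := Polynomial.map_surjective _ hfs P
    exact ⟨algebraMap k[X] L Q, S.θ_poly q θ hθ hq0 hadd Q⟩
  have hk : ∀ c : k, algebraMap k L c ∈ θ.fieldRange := by
    intro c
    rw [IsScalarTower.algebraMap_apply k k[X] L]; exact hP _
  let R : IntermediateField (FractionRing k[X]) L :=
    { θ.fieldRange with
      algebraMap_mem' := by
        intro z
        obtain ⟨a, b, -, rfl⟩ := IsFractionRing.div_surjective k[X] z
        change _ ∈ θ.fieldRange
        rw [map_div₀, ← IsScalarTower.algebraMap_apply, ← IsScalarTower.algebraMap_apply]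
        exact div_mem (hP a) (hP b) }
  have hw : ∀ i, S.w i ∈ R := by
    intro i
    change _ ∈ θ.fieldRange
    have h1 : θ (S.w i) ∈ θ.fieldRange := ⟨_, rfl⟩
    rw [S.θ_w q θ hθ hq0 hadd hTq hpq] at h1
    have h2 := div_mem h1 (hk ((S.T i).leadingCoeff ^ ((q - 1) / S.p)))
    rwa [mul_div_cancel_left₀] at h2
    exact (_root_.map_ne_zero _).2 (pow_ne_zero _ (S.lead_ne i))
  have hbot : R.fixingSubgroup = ⊥ := by
    rw [eq_bot_iff]
    intro g hg
    rw [Subgroup.mem_bot]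
    apply S.gen
    intro i
    exact (IntermediateField.mem_fixingSubgroup_iff R g).1 hg _ (hw i)
  have htop : R = ⊤ := by
    rw [← IsGalois.fixedField_fixingSubgroup R, hbot, IntermediateField.fixedField_bot]
  intro z
  have : z ∈ R := by rw [htop]; trivial
  exact this

theorem θ_conj [IsAlgClosed k] (hθ : ∀ f n, (S.φ (θ f)).coeff n = (S.φ f).coeff n ^ q) (hq0 : q ≠ 0)
    (hadd : ∀ a b : k, (a + b) ^ q = a ^ q + b ^ q)
    (hTq : ∀ i n, (S.T i).coeff n ^ q = (S.T i).coeff n) (hpq : S.p ∣ q - 1) (g : Gal k L) :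
    ∃ g' : Gal k L, ∀ f, g (θ f) = θ (g' f) := by
  let e : L ≃+* L := RingEquiv.ofBijective θ ⟨θ.injective, S.θ_surj q θ hθ hq0 hadd hTq hpq⟩
  have he : ∀ f, e f = θ f := fun f => rfl
  let r : L ≃+* L := (e.trans g.toRingEquiv).trans e.symm
  have hr : ∀ f, θ (r f) = g (θ f) := by
    intro f
    rw [← he]
    exact e.apply_symm_apply _
  refine ⟨AlgEquiv.ofRingEquiv (f := r) ?_, fun f => (hr f).symm⟩
  have : (r : L →+* L).comp (algebraMap (FractionRing k[X]) L) =
      algebraMap (FractionRing k[X]) L := by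
    apply IsLocalization.ringHom_ext (nonZeroDivisors k[X])
    refine RingHom.ext fun P => ?_
    change r (algebraMap (FractionRing k[X]) L (algebraMap k[X] (FractionRing k[X]) P)) =
      algebraMap (FractionRing k[X]) L (algebraMap k[X] (FractionRing k[X]) P)
    rw [← IsScalarTower.algebraMap_apply]
    apply θ.injective
    rw [hr, S.θ_poly q θ hθ hq0 hadd, g_poly]
  exact fun z => congrArg (fun f => f z) this

theorem θ_mem (hθ : ∀ f n, (S.φ (θ f)).coeff n = (S.φ f).coeff n ^ q) (hq0 : q ≠ 0)
    (hadd : ∀ a b : k, (a + b) ^ q = a ^ q + b ^ q)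
    (hTq : ∀ i n, (S.T i).coeff n ^ q = (S.T i).coeff n) (hpq : S.p ∣ q - 1) {b : L} (hb : b ∈ S.B) :
    θ b ∈ S.B := by
  refine Algebra.adjoin_induction (p := fun b _ => θ b ∈ S.B) ?_ ?_ ?_ ?_ hb
  · rintro b (rfl | ⟨i, rfl⟩ | ⟨i, rfl⟩)
    · rw [S.θ_x q θ hθ hq0]; exact S.x_mem
    · rw [S.θ_w q θ hθ hq0 hadd hTq hpq]
      exact S.B.mul_mem (S.k_mem _) (S.w_mem i)
    · simp only [map_inv₀]
      rw [S.θ_w q θ hθ hq0 hadd hTq hpq, mul_inv, ← map_inv₀]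
      exact S.B.mul_mem (S.k_mem _) (S.wi_mem i)
  · intro c; rw [S.θ_k q θ hθ hq0]; exact S.k_mem _
  · intro a b _ _ ha hb; rw [map_add]; exact S.B.add_mem ha hb
  · intro a b _ _ ha hb; rw [map_mul]; exact S.B.mul_mem ha hb

end theta

/-- threshold -/
def thr (p c : ℕ) : ℕ := ∑ d ∈ Finset.range ((2 * p) ^ c + 1), CD.chN d p (4 * c) (4 * c)

theorem frob_pt [IsAlgClosed k] (ℓ : ℕ) [hℓ : Fact ℓ.Prime] [CharP k ℓ] (s q : ℕ)
    (hqs : q = ℓ ^ s) (θ : L →+* L)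
    (hθ : ∀ f n, (S.φ (θ f)).coeff n = (S.φ f).coeff n ^ q)
    (hTq : ∀ i n, (S.T i).coeff n ^ q = (S.T i).coeff n) (hpq : S.p ∣ q - 1)
    (Fr : Finset k) (hFr : Fr.card = q) (hFrq : ∀ r ∈ Fr, r ^ q = r)
    (hq : thr S.p (Fintype.card ι) < q) (hωq : S.ω ^ q = S.ω) (σ : Gal k L) (m : ι → ℕ)
    (hσ : ∀ i, σ (S.w i) = algebraMap k L (S.ω ^ m i) * S.w i) :
    ∃ r ∈ Fr, ∀ i, ∃ lam : k, lam ≠ 0 ∧ lam ^ q = lam ∧ lam + lam⁻¹ + 2 = (S.T i).eval r ∧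
      lam ^ ((q - 1) / S.p) = S.ω ^ m i * (S.T i).leadingCoeff ^ ((q - 1) / S.p) := by
  have : Infinite k := IsAlgClosed.instInfinite
  have hq0 : q ≠ 0 := by rw [hqs]; exact pow_ne_zero _ hℓ.out.ne_zero
  have hadd : ∀ a b : k, (a + b) ^ q = a ^ q + b ^ q := by
    intro a b; rw [hqs]; exact add_pow_char_pow a b ℓ s
  let θB : S.B →+* S.B :=
    { toFun := fun b => ⟨θ b, S.θ_mem q θ hθ hq0 hadd hTq hpq b.2⟩
      map_one' := Subtype.ext (map_one θ)
      map_zero' := Subtype.ext (map_zero θ)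
      map_add' := fun a b => Subtype.ext (map_add θ _ _)
      map_mul' := fun a b => Subtype.ext (map_mul θ _ _) }
  have hθBv : ∀ b, ((θB b : S.B) : L) = θ b := fun b => rfl
  obtain ⟨P, hPx, hP⟩ := S.cd.chebotarev ℓ s q hqs θB (fun c => Subtype.ext (S.θ_k q θ hθ hq0 c))
    (Subtype.ext (S.θ_x q θ hθ hq0)) (by
      intro m f hf g n hn
      obtain ⟨g', hg'⟩ := S.θ_conj q θ hθ hq0 hadd hTq hpq g
      change (S.φ (g (θ f))).coeff n = 0
      rw [hg', hθ]
      have : (S.φ (g' f)).coeff n = 0 := hf g' n hn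
      rw [this, zero_pow hq0]) Fr hFr hFrq S.der (4 * Fintype.card ι) (4 * Fintype.card ι)
    S.der_V S.disc S.der_x S.disc_ne S.disc_deg (by
      refine lt_of_le_of_lt ?_ hq
      exact Finset.single_le_sum (f := fun d => CD.chN d S.p (4 * Fintype.card ι)
        (4 * Fintype.card ι)) (fun _ _ => Nat.zero_le _)
        (Finset.mem_range.2 (Nat.lt_succ_of_le S.card_le))) σ
  refine ⟨P S.cd.x, hPx, fun i => ?_⟩
  set W : S.B := ⟨S.w i, S.w_mem i⟩ with hW
  set W' : S.B := ⟨(S.w i)⁻¹, S.wi_mem i⟩ with hW'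
  have hWW : W * W' = 1 := Subtype.ext (mul_inv_cancel₀ (S.w_ne i))
  have hPW : P W * P W' = 1 := by rw [← map_mul, hWW, map_one]
  have hPW0 : P W ≠ 0 := left_ne_zero_of_mul_eq_one hPW
  have hPinv : P W' = (P W)⁻¹ := (inv_eq_of_mul_eq_one_right hPW).symm
  set χ := (S.T i).leadingCoeff ^ ((q - 1) / S.p) with hχ
  have h1 : P W ^ q = S.ω ^ m i * χ * P W := by
    rw [hP]
    have : θB (σ • W) = algebraMap k S.B (S.ω ^ m i * χ) * W := by
      apply Subtype.ext
      rw [hθBv, smul_def]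
      change θ (σ (S.w i)) = algebraMap k L _ * S.w i
      rw [hσ, map_mul, S.θ_k q θ hθ hq0, S.θ_w q θ hθ hq0 hadd hTq hpq, map_mul, ← pow_mul,
        mul_comm (m i) q, pow_mul, hωq]
      ring
    rw [this, map_mul, AlgHom.commutes]; rfl
  have h2 : P W ^ (q - 1) = S.ω ^ m i * χ := by
    apply mul_right_cancel₀ hPW0
    rw [← h1, ← pow_succ]
    congr 1; omega
  have hlc : (S.T i).leadingCoeff ^ (q - 1) = 1 := by
    apply mul_right_cancel₀ (S.lead_ne i)
    rw [← pow_succ, Nat.sub_add_cancel (by omega), one_mul]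
    exact hTq i _
  have hp1 : (S.ω ^ m i * χ) ^ S.p = 1 := by
    rw [mul_pow, ← pow_mul, mul_comm (m i), pow_mul, S.hω.pow_eq_one, one_pow, one_mul, hχ,
      ← pow_mul, Nat.div_mul_cancel hpq, hlc]
  refine ⟨P W ^ S.p, pow_ne_zero _ hPW0, ?_, ?_, ?_⟩
  · rw [← pow_mul, mul_comm, pow_mul, h1, mul_pow, hp1, one_mul]
  · have e1 : W ^ S.p + W' ^ S.p + 2 = aeval S.cd.x (S.T i) := by
      apply Subtype.ext
      rw [S.aeval_x, ← S.rel i]; rfl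
    rw [← S.cd.P_aeval, ← e1, map_add, map_add, map_pow, map_pow, hPinv, map_ofNat, inv_pow]
  · rw [← pow_mul, Nat.mul_div_cancel' hpq, h2]

end GD


namespace GD
variable {k L ι : Type} [Field k] [Field L] [Algebra k L] [Algebra k[X] L]
    [Algebra (FractionRing k[X]) L] [IsScalarTower k k[X] L]
    [IsScalarTower k[X] (FractionRing k[X]) L] [FiniteDimensional (FractionRing k[X]) L]
    [IsGalois (FractionRing k[X]) L] [Fintype ι] (S : GD k L ι)

/-- square root of `T(T-4)` -/
noncomputable def Y (i : ι) : L := S.w i ^ S.p - (S.w i)⁻¹ ^ S.p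

theorem poly_inj : Function.Injective (algebraMap k[X] L) := by
  rw [IsScalarTower.algebraMap_eq k[X] (FractionRing k[X]) L]
  exact (algebraMap (FractionRing k[X]) L).injective.comp
    (IsFractionRing.injective k[X] (FractionRing k[X]))

theorem Y_sq (i : ι) : S.Y i ^ 2 = algebraMap k[X] L (S.td i) := by
  have h1 : S.w i ^ S.p * (S.w i)⁻¹ ^ S.p = 1 := by
    rw [← mul_pow, mul_inv_cancel₀ (S.w_ne i), one_pow]
  rw [td, map_mul, map_sub, ← S.rel i, Y, map_ofNat]
  linear_combination (-4 : L) * h1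

theorem Y_ne (i : ι) : S.Y i ≠ 0 := by
  intro h0
  have h := S.Y_sq i
  rw [h0, zero_pow two_ne_zero] at h
  exact S.td_ne i ((map_eq_zero_iff _ poly_inj).1 h.symm)

theorem Y_mem (i : ι) : S.Y i ∈ S.B :=
  S.B.sub_mem (S.B.pow_mem (S.w_mem i) _) (S.B.pow_mem (S.wi_mem i) _)

theorem om_pow (a : ℕ) : algebraMap k L (S.ω ^ a) ^ S.p = 1 := by
  rw [← map_pow, ← pow_mul, mul_comm, pow_mul, S.hω.pow_eq_one, one_pow, map_one]

theorem act2 (g : Gal k L) (i : ι) :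
    ((∃ a, g (S.w i) = algebraMap k L (S.ω ^ a) * S.w i) ∧ g (S.Y i) = S.Y i) ∨
    ((∃ a, g (S.w i) = algebraMap k L (S.ω ^ a) * (S.w i)⁻¹) ∧ g (S.Y i) = - S.Y i) := by
  obtain ⟨a, -, h | h⟩ := S.act g i
  · left
    refine ⟨⟨a, h⟩, ?_⟩
    rw [Y, map_sub, map_pow, map_pow, map_inv₀, h, mul_inv, mul_pow, mul_pow, inv_pow, S.om_pow]
    simp
  · right
    refine ⟨⟨a, h⟩, ?_⟩
    rw [Y, map_sub, map_pow, map_pow, map_inv₀, h, mul_inv, mul_pow, mul_pow,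
      inv_pow (algebraMap k L (S.ω ^ a)), S.om_pow]
    simp

theorem L2 (h2 : (2 : k) ≠ 0) : (2 : L) ≠ 0 := by
  rw [← map_ofNat (algebraMap k L) 2]
  exact (_root_.map_ne_zero _).2 h2

theorem fixed_prod [DecidableEq ι] (h2 : (2 : k) ≠ 0) (I : Finset ι) :
    ∀ a : L, (∀ g : Gal k L, g a = a ∨ g a = -a) →
    (∀ g : Gal k L, (∀ i ∈ I, g (S.Y i) = S.Y i) → g a = a) →
    ∃ R ⊆ I, ∀ g : Gal k L, g (a * ∏ i ∈ R, S.Y i) = a * ∏ i ∈ R, S.Y i := by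
  induction I using Finset.induction_on with
  | empty =>
    intro a ha h
    exact ⟨∅, subset_rfl, fun g => by simpa using h g (by simp)⟩
  | insert j I hj ih =>
    intro a ha h
    by_cases hall : ∀ g : Gal k L, (∀ i ∈ I, g (S.Y i) = S.Y i) → g a = a
    · obtain ⟨R, hR, hR2⟩ := ih a ha hall
      exact ⟨R, hR.trans (Finset.subset_insert _ _), hR2⟩
    · push Not at hall
      obtain ⟨h0, h0I, h0a⟩ := hall
      have h0a' : h0 a = -a := (ha h0).resolve_left h0a
      have h0j : h0 (S.Y j) = - S.Y j := by
        rcases S.act2 h0 j with ⟨-, e⟩ | ⟨-, e⟩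
        · exfalso
          apply h0a
          apply h
          intro i hi
          rcases Finset.mem_insert.1 hi with rfl | hi
          · exact e
          · exact h0I i hi
        · exact e
      obtain ⟨R, hR, hR2⟩ := ih (a * S.Y j) (by
          intro g
          rw [map_mul]
          rcases ha g with e | e <;> rcases S.act2 g j with ⟨-, e'⟩ | ⟨-, e'⟩ <;> rw [e, e'] <;> simp)
        (by
          intro g hg
          rw [map_mul]
          rcases S.act2 g j with ⟨-, e⟩ | ⟨-, e⟩
          · rw [e, h g]
            intro i hi
            rcases Finset.mem_insert.1 hi with rfl | hi
            · exact e
            · exact hg i hi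
          · have := h (g * h0) (by
              intro i hi
              rw [AlgEquiv.mul_apply]
              rcases Finset.mem_insert.1 hi with rfl | hi
              · rw [h0j, map_neg, e, neg_neg]
              · rw [h0I i hi, hg i hi])
            rw [AlgEquiv.mul_apply, h0a', map_neg] at this
            rw [e]
            linear_combination (S.Y j) * this)
      refine ⟨insert j R, Finset.insert_subset_insert j hR, fun g => ?_⟩
      rw [Finset.prod_insert (fun hj' => hj (hR hj')), ← mul_assoc]
      exact hR2 g

theorem exists_tau (h2 : (2 : k) ≠ 0) (i0 : ι) (x0 : k) (J0 : ι → Prop)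
    (hodd : Odd ((S.td i0).rootMultiplicity x0))
    (heven : ∀ i, ¬ J0 i → Even ((S.td i).rootMultiplicity x0)) :
    ∃ τ : Gal k L, τ (S.Y i0) = - S.Y i0 ∧ ∀ i, ¬ J0 i → τ (S.Y i) = S.Y i := by
  classical
  by_contra hcon
  push Not at hcon
  obtain ⟨R, hR, hR2⟩ := S.fixed_prod h2 (Finset.univ.filter fun i => ¬ J0 i) (S.Y i0)
    (fun g => by rcases S.act2 g i0 with ⟨-, e⟩ | ⟨-, e⟩ <;> simp [e])
    (by
      intro g hg
      rcases S.act2 g i0 with ⟨-, e⟩ | ⟨-, e⟩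
      · exact e
      · obtain ⟨i, hi, hi2⟩ := hcon g e
        exact absurd (hg i (by simp [hi])) hi2)
  obtain ⟨Q, hQ⟩ := S.fixed (S.B.mul_mem (S.Y_mem i0) (S.B.prod_mem fun i _ => S.Y_mem i)) hR2
  have hsq : Q ^ 2 = S.td i0 * ∏ i ∈ R, S.td i := by
    apply poly_inj (L := L)
    rw [map_pow, ← hQ, mul_pow, ← Finset.prod_pow, map_mul, map_prod, S.Y_sq]
    congr 1
    exact Finset.prod_congr rfl fun i _ => S.Y_sq i
  have hne : ∏ i ∈ R, S.td i ≠ 0 := Finset.prod_ne_zero_iff.2 fun i _ => S.td_ne i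
  have hprod : Even ((∏ i ∈ R, S.td i).rootMultiplicity x0) := by
    have : ∀ R' ⊆ R, Even ((∏ i ∈ R', S.td i).rootMultiplicity x0) := by
      intro R'
      induction R' using Finset.induction_on with
      | empty => intro _; rw [Finset.prod_empty, ← C_1, rootMultiplicity_C]; exact Even.zero
      | insert j R' hj ih =>
        intro hsub
        rw [Finset.prod_insert hj, rootMultiplicity_mul (mul_ne_zero (S.td_ne j)
          (Finset.prod_ne_zero_iff.2 fun i _ => S.td_ne i))]
        refine Even.add (heven j ?_) (ih ((Finset.subset_insert _ _).trans hsub))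
        have := hR (hsub (Finset.mem_insert_self _ _))
        simpa using this
    exact this R subset_rfl
  have hQ0 : Q ≠ 0 := by
    intro h; rw [h, zero_pow two_ne_zero] at hsq
    exact mul_ne_zero (S.td_ne i0) hne hsq.symm
  have e1 := congrArg (fun P => P.rootMultiplicity x0) hsq
  rw [rootMultiplicity_mul (mul_ne_zero (S.td_ne i0) hne), pow_two,
    rootMultiplicity_mul (mul_ne_zero hQ0 hQ0)] at e1
  have h3 := hodd.add_even hprod
  rw [← e1] at h3
  exact (Nat.not_even_iff_odd.2 h3) ⟨_, rfl⟩

theorem pow_rot (σ : Gal k L) (u : L) (c : k) (h : σ u = algebraMap k L c * u) (n : ℕ) :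
    (σ ^ n) u = algebraMap k L (c ^ n) * u := by
  induction n with
  | zero => simp
  | succ n ih => rw [pow_succ, AlgEquiv.mul_apply, h, map_mul, g_k, ih, ← mul_assoc, ← map_mul,
      pow_succ']

theorem exists_rot (hpp : S.p.Prime) (h2 : (2 : k) ≠ 0) (i0 : ι) (x0 : k) (J0 : ι → Prop)
    (hodd : Odd ((S.td i0).rootMultiplicity x0))
    (heven : ∀ i, ¬ J0 i → Even ((S.td i).rootMultiplicity x0))
    (σ0 : Gal k L) (hσ0 : ∀ i, σ0 (S.w i) = algebraMap k L (S.ω ^ (S.p - 2)) * S.w i) :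
    ∃ J' : ι → Prop, J' i0 ∧ (∀ i, J' i → J0 i) ∧ ∀ m1 m2 : ℕ, ∃ σ : Gal k L,
      ∀ i, (J' i → σ (S.w i) = algebraMap k L (S.ω ^ m2) * S.w i) ∧
        (¬ J' i → σ (S.w i) = algebraMap k L (S.ω ^ m1) * S.w i) := by
  obtain ⟨τ, hτ0, hτ⟩ := S.exists_tau h2 i0 x0 J0 hodd heven
  have hp2 := S.hp
  have hp0 : S.p ≠ 0 := by omega
  have hω0 : S.ω ≠ 0 := S.hω.ne_zero hp0
  have hYneg : ∀ i, - S.Y i ≠ S.Y i := by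
    intro i h
    have : (2 : L) * S.Y i = 0 := by linear_combination -h
    exact mul_ne_zero (L2 h2) (S.Y_ne i) this
  refine ⟨fun i => τ (S.Y i) = - S.Y i, hτ0, ?_, ?_⟩
  · intro i hi
    by_contra hJ
    exact hYneg i (hi.symm.trans (hτ i hJ))
  · intro m1 m2
    have : Fact S.p.Prime := ⟨hpp⟩
    set σ1 : Gal k L := τ⁻¹ * σ0 * τ with hσ1
    have hinv : ∀ i, σ0 (S.w i)⁻¹ = algebraMap k L (S.ω ^ (S.p - 2))⁻¹ * (S.w i)⁻¹ := by
      intro i; rw [map_inv₀, hσ0, mul_inv, map_inv₀]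
    have hA : ∀ i, ¬ τ (S.Y i) = - S.Y i →
        σ1 (S.w i) = algebraMap k L (S.ω ^ (S.p - 2)) * S.w i := by
      intro i hi
      rcases S.act2 τ i with ⟨⟨a, ha⟩, -⟩ | ⟨-, e⟩
      · rw [hσ1, AlgEquiv.mul_apply, AlgEquiv.mul_apply, ha, map_mul, g_k, hσ0]
        rw [show algebraMap k L (S.ω ^ a) * (algebraMap k L (S.ω ^ (S.p - 2)) * S.w i) =
          algebraMap k L (S.ω ^ (S.p - 2)) * (algebraMap k L (S.ω ^ a) * S.w i) by ring, ← ha,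
          map_mul, g_k, ← AlgEquiv.mul_apply, inv_mul_cancel, AlgEquiv.one_apply]
      · exact absurd e hi
    have hB : ∀ i, τ (S.Y i) = - S.Y i →
        σ1 (S.w i) = algebraMap k L (S.ω ^ (S.p - 2))⁻¹ * S.w i := by
      intro i hi
      rcases S.act2 τ i with ⟨-, e⟩ | ⟨⟨a, ha⟩, -⟩
      · exact absurd (hi.symm.trans e) (hYneg i)
      · rw [hσ1, AlgEquiv.mul_apply, AlgEquiv.mul_apply, ha, map_mul, g_k, hinv]
        rw [show algebraMap k L (S.ω ^ a) * (algebraMap k L (S.ω ^ (S.p - 2))⁻¹ * (S.w i)⁻¹) =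
          algebraMap k L (S.ω ^ (S.p - 2))⁻¹ * (algebraMap k L (S.ω ^ a) * (S.w i)⁻¹) by ring, ← ha,
          map_mul, g_k, ← AlgEquiv.mul_apply, inv_mul_cancel, AlgEquiv.one_apply]
    have h2p : (2 : ZMod S.p) ≠ 0 := by
      have : ((2 : ℕ) : ZMod S.p) ≠ 0 := by
        rw [Ne, ZMod.natCast_eq_zero_iff]
        exact fun h => by have := Nat.le_of_dvd (by norm_num) h; omega
      exact_mod_cast this
    have hom : ∀ a b : ℕ, (a : ZMod S.p) = b → S.ω ^ a = S.ω ^ b := by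
      intro a b h
      rw [ZMod.natCast_eq_natCast_iff] at h
      rw [← Nat.mod_add_div a S.p, ← Nat.mod_add_div b S.p, pow_add, pow_add, pow_mul, pow_mul,
        S.hω.pow_eq_one, one_pow, one_pow, h]
    have hpm : ((S.p - 2 : ℕ) : ZMod S.p) = -2 := by
      rw [Nat.cast_sub (by omega)]; simp
    set u : ℕ := (-((m1 : ZMod S.p) + m2) / 4).val with hu
    set v : ℕ := (-((m1 : ZMod S.p) - m2) / 4).val with hv
    have h4p : (4 : ZMod S.p) ≠ 0 := by
      have : (4 : ZMod S.p) = 2 * 2 := by norm_num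
      rw [this]; exact mul_ne_zero h2p h2p
    have huZ : ((u : ℕ) : ZMod S.p) = -((m1 : ZMod S.p) + m2) / 4 := by
      rw [hu, ZMod.natCast_val, ZMod.cast_id]
    have hvZ : ((v : ℕ) : ZMod S.p) = -((m1 : ZMod S.p) - m2) / 4 := by
      rw [hv, ZMod.natCast_val, ZMod.cast_id]
    refine ⟨σ0 ^ u * σ1 ^ v, fun i => ⟨fun hi => ?_, fun hi => ?_⟩⟩
    · rw [AlgEquiv.mul_apply, pow_rot _ _ _ (hB i hi), map_mul, g_k, pow_rot _ _ _ (hσ0 i),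
        ← mul_assoc, ← map_mul]
      congr 2
      rw [inv_pow, ← pow_mul, ← pow_mul, inv_mul_eq_iff_eq_mul₀ (pow_ne_zero _ hω0), ← pow_add]
      apply hom
      push_cast
      rw [hpm, huZ, hvZ]
      field_simp
      ring
    · rw [AlgEquiv.mul_apply, pow_rot _ _ _ (hA i hi), map_mul, g_k, pow_rot _ _ _ (hσ0 i),
        ← mul_assoc, ← map_mul]
      congr 2
      rw [← pow_mul, ← pow_mul, ← pow_add]
      apply hom
      push_cast
      rw [hpm, huZ, hvZ]
      field_simp
      ring

theorem exists_cinv {c : k} (hc : c ^ S.p = 1) : ∃ m : ℕ, ∀ a : k, S.ω ^ m * a = 1 → a = c := by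
  have : NeZero S.p := ⟨by have := S.hp; omega⟩
  obtain ⟨j, hj, rfl⟩ := S.hω.eq_pow_of_pow_eq_one hc
  refine ⟨S.p - j, fun a ha => ?_⟩
  have h1 : S.ω ^ (S.p - j) * S.ω ^ j = 1 := by
    rw [← pow_add, Nat.sub_add_cancel hj.le, S.hω.pow_eq_one]
  exact mul_left_cancel₀ (left_ne_zero_of_mul_eq_one h1) (ha.trans h1.symm)

/-- the two combinatorial hypotheses -/
def Hyp {k ι : Type} [Field k] (p : ℕ) (T : ι → k[X]) (q : ℕ) : Prop :=
  (∃ c : k, c ^ p = 1 ∧ ∀ i, (T i).leadingCoeff ^ ((q - 1) / p) ≠ c) ∨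
  ((2 : k) ≠ 0 ∧ ∃ (i0 : ι) (x0 : k) (J0 : ι → Prop) (c1 c2 : k), c1 ^ p = 1 ∧ c2 ^ p = 1 ∧
    Odd ((T i0 * (T i0 - 4)).rootMultiplicity x0) ∧
    (∀ i, ¬ J0 i → Even ((T i * (T i - 4)).rootMultiplicity x0)) ∧
    (∀ i, i ≠ i0 → (T i).leadingCoeff ^ ((q - 1) / p) ≠ c1) ∧
    (∀ i, J0 i → (T i).leadingCoeff ^ ((q - 1) / p) ≠ c2))

theorem frob_hyp [IsAlgClosed k] (ℓ : ℕ) [hℓ : Fact ℓ.Prime] [CharP k ℓ] (s q : ℕ)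
    (hqs : q = ℓ ^ s) (θ : L →+* L)
    (hθ : ∀ f n, (S.φ (θ f)).coeff n = (S.φ f).coeff n ^ q)
    (hTq : ∀ i n, (S.T i).coeff n ^ q = (S.T i).coeff n) (hpq : S.p ∣ q - 1)
    (Fr : Finset k) (hFr : Fr.card = q) (hFrq : ∀ r ∈ Fr, r ^ q = r)
    (hq : thr S.p (Fintype.card ι) < q) (hωq : S.ω ^ q = S.ω) (hpp : S.p.Prime)
    (σ0 : Gal k L) (hσ0 : ∀ i, σ0 (S.w i) = algebraMap k L (S.ω ^ (S.p - 2)) * S.w i)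
    (hyp : Hyp S.p S.T q) :
    ∃ r ∈ Fr, ∀ i, ∃ lam : k, lam ≠ 0 ∧ lam ^ q = lam ∧ lam + lam⁻¹ + 2 = (S.T i).eval r ∧
      lam ^ ((q - 1) / S.p) ≠ 1 := by
  classical
  have main : ∀ (σ : Gal k L) (m : ι → ℕ)
      (hσ : ∀ i, σ (S.w i) = algebraMap k L (S.ω ^ m i) * S.w i)
      (hm : ∀ i, S.ω ^ m i * (S.T i).leadingCoeff ^ ((q - 1) / S.p) ≠ 1),
      ∃ r ∈ Fr, ∀ i, ∃ lam : k, lam ≠ 0 ∧ lam ^ q = lam ∧ lam + lam⁻¹ + 2 = (S.T i).eval r ∧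
      lam ^ ((q - 1) / S.p) ≠ 1 := by
    intro σ m hσ hm
    obtain ⟨r, hr, h⟩ := S.frob_pt ℓ s q hqs θ hθ hTq hpq Fr hFr hFrq hq hωq σ m hσ
    refine ⟨r, hr, fun i => ?_⟩
    obtain ⟨lam, h1, h2, h3, h4⟩ := h i
    exact ⟨lam, h1, h2, h3, h4 ▸ hm i⟩
  rcases hyp with ⟨c, hc, hcT⟩ | ⟨h2, i0, x0, J0, c1, c2, hc1, hc2, ho, he, hT1, hT2⟩
  · obtain ⟨m, hm⟩ := S.exists_cinv hc
    -- find u with (p-2) u ≡ m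
    have hcop : Nat.Coprime (S.p - 2) S.p := by
      rw [Nat.coprime_comm]
      apply (Nat.Prime.coprime_iff_not_dvd hpp).2
      intro h
      have := Nat.le_of_dvd (by have := S.hp; omega) h
      have := S.hp
      omega
    have hω' : IsPrimitiveRoot (S.ω ^ (S.p - 2)) S.p := S.hω.pow_of_coprime _ hcop
    have : NeZero S.p := ⟨by have := S.hp; omega⟩
    obtain ⟨u, -, hu⟩ := hω'.eq_pow_of_pow_eq_one (ξ := S.ω ^ m) (by
      rw [← pow_mul, mul_comm, pow_mul, S.hω.pow_eq_one, one_pow])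
    refine main (σ0 ^ u) (fun _ => m) (fun i => ?_) (fun i h => hcT i (hm _ h))
    rw [pow_rot _ _ _ (hσ0 i), hu]
  · obtain ⟨J', hJ0, hJ, hrot⟩ := S.exists_rot hpp h2 i0 x0 J0 ho he σ0 hσ0
    obtain ⟨m1, hm1⟩ := S.exists_cinv hc1
    obtain ⟨m2, hm2⟩ := S.exists_cinv hc2
    obtain ⟨σ, hσ⟩ := hrot m1 m2
    refine main σ (fun i => if J' i then m2 else m1) (fun i => ?_) (fun i h => ?_)
    · by_cases hi : J' i
      · simp only [hi, if_true]; exact (hσ i).1 hi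
      · simp only [hi, if_false]; exact (hσ i).2 hi
    · by_cases hi : J' i
      · simp only [hi, if_true] at h
        exact hT2 i (hJ i hi) (hm2 _ h)
      · simp only [hi, if_false] at h
        exact hT1 i (fun h' => hi (h' ▸ hJ0)) (hm1 _ h)

end GD


namespace HS
variable {k : Type} [Field k]

theorem ofPS_neg (W : PowerSeries k) {n : ℤ} (hn : n < 0) :
    (HahnSeries.ofPowerSeries ℤ k W).coeff n = 0 := by
  rw [HahnSeries.ofPowerSeries_apply]
  apply HahnSeries.embDomain_of_notMem_range
  rintro ⟨m, hm⟩
  have : (m : ℤ) = n := hm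
  omega

theorem order_eq {f : HahnSeries ℤ k} {m : ℤ} (h1 : f.coeff m ≠ 0) (h2 : ∀ n < m, f.coeff n = 0) :
    f.order = m := by
  apply le_antisymm (HahnSeries.order_le_of_coeff_ne_zero h1)
  by_contra hlt
  push Not at hlt
  have h3 := h2 _ hlt
  rw [HahnSeries.coeff_order_eq_zero] at h3
  rw [h3] at h1
  exact h1 rfl

theorem hensel (p : ℕ) (hp : 2 < p) (hpk : (p : k) ≠ 0) (γ t2 : k) (hγ : γ ^ p = t2) (ht : t2 ≠ 0)
    (U : PowerSeries k) (hU : PowerSeries.constantCoeff U = t2) :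
    ∃ W : PowerSeries k, PowerSeries.constantCoeff W = γ ∧
      W ^ (2 * p) - U * W ^ p + PowerSeries.X ^ (4 * p) = 0 := by
  have hγ0 : γ ≠ 0 := by
    rintro rfl
    rw [zero_pow (by omega)] at hγ
    exact ht hγ.symm
  let f : (PowerSeries k)[X] := X ^ (2 * p) - (C U * X ^ p - C (PowerSeries.X ^ (4 * p)))
  have hf : f.Monic := by
    apply monic_X_pow_sub
    refine (degree_sub_le _ _).trans_lt (max_lt ?_ ?_)
    · refine (degree_C_mul_X_pow_le _ _).trans_lt ?_
      exact_mod_cast (by omega : p < 2 * p)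
    · refine degree_C_le.trans_lt ?_
      exact_mod_cast (by omega : 0 < 2 * p)
  obtain ⟨W, hW, hWγ⟩ := HenselianRing.is_henselian (I := Ideal.span {(PowerSeries.X : PowerSeries k)})
    f hf (PowerSeries.C γ) (by
      rw [Ideal.mem_span_singleton, PowerSeries.X_dvd_iff]
      simp only [f, eval_sub, eval_pow, eval_mul, eval_C, eval_X, map_sub, map_pow, map_mul,
        PowerSeries.constantCoeff_C, PowerSeries.constantCoeff_X, hU]
      rw [mul_comm 2 p, pow_mul, hγ, zero_pow (by omega)]
      ring) (by
      apply IsUnit.map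
      rw [PowerSeries.isUnit_iff_constantCoeff, isUnit_iff_ne_zero]
      simp only [f, derivative_sub, derivative_X_pow, derivative_C_mul_X_pow, derivative_C, sub_zero]
      simp only [eval_sub, eval_pow, eval_mul, eval_C, eval_X, map_sub, map_pow, map_mul,
        PowerSeries.constantCoeff_C, hU, map_natCast, eval_natCast]
      have e : γ ^ (2 * p - 1) = t2 * γ ^ (p - 1) := by
        rw [← hγ, ← pow_add]; congr 1; omega
      rw [e]
      have : ((2 * p : ℕ) : k) * (t2 * γ ^ (p - 1)) - t2 * p * γ ^ (p - 1) =
        p * t2 * γ ^ (p - 1) := by push_cast; ring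
      rw [this]
      exact mul_ne_zero (mul_ne_zero hpk ht) (pow_ne_zero _ hγ0))
  refine ⟨W, ?_, ?_⟩
  · rw [Ideal.mem_span_singleton, PowerSeries.X_dvd_iff, map_sub, PowerSeries.constantCoeff_C,
      sub_eq_zero] at hWγ
    exact hWγ
  · have : eval W f = 0 := hW
    simp only [f, eval_sub, eval_pow, eval_mul, eval_C, eval_X] at this
    linear_combination this

theorem exists_w [IsAlgClosed k] (p : ℕ) (hp : 2 < p) (hpk : (p : k) ≠ 0) (T : k[X])
    (hT : T.natDegree = 2) :
    ∃ w : HahnSeries ℤ k, w.order = -2 ∧ w.coeff (-2) ^ p = T.leadingCoeff ∧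
      w ^ p + w⁻¹ ^ p + 2 = eval₂ HahnSeries.C (HahnSeries.single (-(p : ℤ)) 1) T := by
  have hlc : T.leadingCoeff ≠ 0 := by
    rw [Ne, leadingCoeff_eq_zero]; rintro rfl; simp at hT
  obtain ⟨γ, hγ⟩ := IsAlgClosed.exists_pow_nat_eq T.leadingCoeff (by omega : 0 < p)
  have hγ0 : γ ≠ 0 := by
    rintro rfl
    rw [zero_pow (by omega)] at hγ
    exact hlc hγ.symm
  let U : PowerSeries k := PowerSeries.C T.leadingCoeff + PowerSeries.C (T.coeff 1) * PowerSeries.X ^ p +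
    PowerSeries.C (T.coeff 0 - 2) * PowerSeries.X ^ (2 * p)
  obtain ⟨W, hW, hWe⟩ := hensel p hp hpk γ T.leadingCoeff hγ hlc U (by
    simp only [U, map_add, map_mul, map_pow, PowerSeries.constantCoeff_C, PowerSeries.constantCoeff_X]
    rw [zero_pow (by omega), zero_pow (by omega)]; ring)
  set V := HahnSeries.ofPowerSeries ℤ k W with hV
  have hV0 : V.coeff 0 = γ := by
    have := HahnSeries.ofPowerSeries_apply_coeff (Γ := ℤ) W 0
    rw [PowerSeries.coeff_zero_eq_constantCoeff_apply, hW] at this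
    exact this
  set z : HahnSeries ℤ k := HahnSeries.single 1 1 with hz
  have hz0 : z ≠ 0 := by rw [hz]; simp
  have hzi : ∀ n : ℕ, HahnSeries.single (-(n : ℤ)) (1 : k) = (z ^ n)⁻¹ := by
    intro n
    apply eq_inv_of_mul_eq_one_left
    rw [hz, HahnSeries.single_pow, HahnSeries.single_mul_single]
    simp
  have hw2 : ∀ n : ℤ, (HahnSeries.single (-((2 : ℕ) : ℤ)) (1 : k) * V).coeff n = V.coeff (n + 2) := by
    intro n
    rw [HahnSeries.coeff_single_mul, one_mul]
    congr 1
  set w := HahnSeries.single (-((2 : ℕ) : ℤ)) (1 : k) * V with hw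
  have hc2 : w.coeff (-2) = γ := by rw [hw2]; exact hV0
  have hw0 : w ≠ 0 := by
    intro h; rw [h] at hc2; exact hγ0 hc2.symm
  refine ⟨w, ?_, ?_, ?_⟩
  · apply order_eq
    · rw [hc2]; exact hγ0
    · intro n hn
      rw [hw2, hV, ofPS_neg _ (by omega)]
  · rw [hc2, hγ]
  · have hWe' := congrArg (HahnSeries.ofPowerSeries ℤ k) hWe
    simp only [U, map_add, map_sub, map_mul, map_pow, HahnSeries.ofPowerSeries_X,
      HahnSeries.ofPowerSeries_C, map_zero, ← hV, ← hz] at hWe'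
    have hTe : eval₂ HahnSeries.C (HahnSeries.single (-(p : ℤ)) 1) T =
        HahnSeries.C T.leadingCoeff * ((z ^ p)⁻¹) ^ 2 + HahnSeries.C (T.coeff 1) * (z ^ p)⁻¹ +
          HahnSeries.C (T.coeff 0) := by
      rw [hzi, eval₂_eq_sum_range, hT, Finset.sum_range_succ, Finset.sum_range_succ,
        Finset.sum_range_succ, leadingCoeff, hT]
      simp
      ring
    rw [hTe]
    have hwz : w = V * (z ^ 2)⁻¹ := by rw [hw, hzi, mul_comm]
    have hVz : V = w * z ^ 2 := by
      rw [hwz, mul_assoc, inv_mul_cancel₀ (pow_ne_zero _ hz0), mul_one]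
    rw [hVz] at hWe'
    have e2 : (HahnSeries.C (2 : k) : HahnSeries ℤ k) = 2 := map_ofNat _ 2
    rw [e2] at hWe'
    have hwp : w ^ p ≠ 0 := pow_ne_zero _ hw0
    have hzp : z ^ p ≠ 0 := pow_ne_zero _ hz0
    rw [inv_pow]
    have r1 : (w * z ^ 2) ^ (2 * p) = (w ^ p) ^ 2 * (z ^ p) ^ 4 := by ring
    have r2 : (w * z ^ 2) ^ p = w ^ p * (z ^ p) ^ 2 := by ring
    have r3 : z ^ (4 * p) = (z ^ p) ^ 4 := by ring
    have r4 : z ^ (2 * p) = (z ^ p) ^ 2 := by ring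
    rw [r1, r2, r3, r4] at hWe'
    generalize w ^ p = a at *
    generalize z ^ p = b at *
    field_simp
    have hb2 : b ^ 2 ≠ 0 := pow_ne_zero _ hzp
    apply mul_left_cancel₀ hb2
    linear_combination hWe'

end HS


/-- Laurent series in `z`, seen as an extension of `k(x)` with `x = z ^ (-p)`. -/
def LS (k : Type) (p : ℕ) [Field k] : Type := HahnSeries ℤ k

namespace LS
variable {k : Type} {p : ℕ} [Field k]

noncomputable instance : Field (LS k p) := inferInstanceAs (Field (HahnSeries ℤ k))

/-- The identity map. -/
noncomputable def toH : LS k p ≃+* HahnSeries ℤ k := RingEquiv.refl (HahnSeries ℤ k)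

/-- The structure map from polynomials. -/
noncomputable def px : k[X] →+* LS k p :=
  (toH (k := k) (p := p)).symm.toRingHom.comp
    (eval₂RingHom (HahnSeries.C : k →+* HahnSeries ℤ k) (HahnSeries.single (-(p : ℤ)) 1))

theorem toH_px (P : k[X]) : toH (px P : LS k p) =
    eval₂ HahnSeries.C (HahnSeries.single (-(p : ℤ)) 1) P := rfl

theorem toH_px_monomial (n : ℕ) (c : k) : toH (px (monomial n c) : LS k p) =
    HahnSeries.single (-(p : ℤ) * n) c := by
  rw [toH_px, eval₂_monomial, HahnSeries.single_pow, HahnSeries.C_apply,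
    HahnSeries.single_mul_single]
  simp [mul_comm]

theorem px_coeff [NeZero p] (P : k[X]) (n : ℕ) :
    (toH (px P : LS k p)).coeff (-(p : ℤ) * n) = P.coeff n := by
  induction P using Polynomial.induction_on' with
  | add a b ha hb => rw [map_add, map_add, HahnSeries.coeff_add, ha, hb, coeff_add]
  | monomial m c =>
    rw [toH_px_monomial, HahnSeries.coeff_single, coeff_monomial]
    have : (-(p : ℤ) * n = -(p : ℤ) * m) ↔ m = n := by
      rw [mul_right_inj' (by simpa using NeZero.ne p)]
      constructor
      · intro h; exact_mod_cast h.symm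
      · rintro rfl; rfl
    simp only [this]

theorem px_inj [NeZero p] : Function.Injective (px : k[X] →+* LS k p) := by
  rw [injective_iff_map_eq_zero]
  intro P hP
  ext n
  rw [← px_coeff (p := p), hP, map_zero]
  simp

noncomputable instance : Algebra k[X] (LS k p) := px.toAlgebra
noncomputable instance : Algebra k (LS k p) := (px.comp C).toAlgebra
noncomputable instance [NeZero p] : Algebra (FractionRing k[X]) (LS k p) :=
  (IsFractionRing.lift (px_inj (k := k) (p := p))).toAlgebra

theorem alg_px (P : k[X]) : algebraMap k[X] (LS k p) P = px P := rfl

instance : IsScalarTower k k[X] (LS k p) := IsScalarTower.of_algebraMap_eq fun _ => rfl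
instance [NeZero p] : IsScalarTower k[X] (FractionRing k[X]) (LS k p) :=
  IsScalarTower.of_algebraMap_eq fun x =>
    (IsFractionRing.lift_algebraMap (px_inj (k := k) (p := p)) x).symm
instance [NeZero p] : IsScalarTower k (FractionRing k[X]) (LS k p) :=
  IsScalarTower.of_algebraMap_eq fun c => by
    rw [IsScalarTower.algebraMap_apply k k[X] (FractionRing k[X]),
      ← IsScalarTower.algebraMap_apply k[X] (FractionRing k[X]) (LS k p)]
    rfl

theorem toH_C (c : k) : toH (algebraMap k (LS k p) c) = HahnSeries.C c := by
  change toH (px (C c)) = _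
  rw [toH_px, eval₂_C]

theorem toH_x : toH (algebraMap k[X] (LS k p) X) = HahnSeries.single (-(p : ℤ)) 1 := by
  rw [alg_px, toH_px, eval₂_X]

/-- Twists. -/
noncomputable def tw (ψ : k →+* k) (ω : k) (hω : ω ≠ 0) : LS k p →+* LS k p :=
  (toH (k := k) (p := p)).symm.toRingHom.comp ((HS.twist ψ ω hω).comp (toH (k := k) (p := p)).toRingHom)

theorem tw_coeff (ψ : k →+* k) (ω : k) (hω : ω ≠ 0) (f : LS k p) (n : ℤ) :
    (toH (tw ψ ω hω f)).coeff n = ω ^ n * ψ ((toH f).coeff n) := HS.twist_coeff ψ ω hω _ n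

theorem tw_px (ψ : k →+* k) (ω : k) (hω : ω ≠ 0) (hp : ω ^ p = 1) (P : k[X]) :
    tw ψ ω hω (px P : LS k p) = px (P.map ψ) := by
  induction P using Polynomial.induction_on' with
  | add a b ha hb => rw [map_add, map_add, ha, hb, Polynomial.map_add, map_add]
  | monomial m c =>
    apply toH.injective
    rw [map_monomial, toH_px_monomial]
    change HS.twist ψ ω hω (toH (px (monomial m c) : LS k p)) = _
    rw [toH_px_monomial, HS.twist_single, neg_mul, _root_.zpow_neg, _root_.zpow_mul, zpow_natCast, zpow_natCast, hp]
    simp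

section roots
variable [NeZero p]

/-- `u` is a root of the equation attached to `T`. -/
def IsR (T : k[X]) (u : LS k p) : Prop := u ≠ 0 ∧ u ^ p + u⁻¹ ^ p + 2 = algebraMap k[X] (LS k p) T

theorem IsR.cases {T : k[X]} {u v : LS k p} {ω : k} (hω : IsPrimitiveRoot ω p) (hu : IsR T u) (hv : IsR T v) :
    ∃ a < p, u = algebraMap k _ (ω ^ a) * v ∨ u = algebraMap k _ (ω ^ a) * v⁻¹ := by
  obtain ⟨hu, hu'⟩ := hu
  obtain ⟨hv, hv'⟩ := hv
  have h : u ^ p + u⁻¹ ^ p = v ^ p + v⁻¹ ^ p := add_right_cancel (hu'.trans hv'.symm)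
  have hωL : IsPrimitiveRoot (algebraMap k (LS k p) ω) p :=
    hω.map_of_injective (algebraMap k (LS k p)).injective
  have key : (u ^ p - v ^ p) * (u ^ p - v⁻¹ ^ p) = 0 := by
    have h1 : u ^ p * u⁻¹ ^ p = 1 := by rw [← mul_pow, mul_inv_cancel₀ hu, one_pow]
    have h2 : v ^ p * v⁻¹ ^ p = 1 := by rw [← mul_pow, mul_inv_cancel₀ hv, one_pow]
    linear_combination (u ^ p) * h - h1 + h2
  have fin : ∀ z : LS k p, z ≠ 0 → u ^ p = z ^ p → ∃ a < p, u = algebraMap k _ (ω ^ a) * z := by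
    intro z hz hzu
    obtain ⟨a, ha, haz⟩ := hωL.eq_pow_of_pow_eq_one (ξ := u / z) (by
      rw [div_pow, hzu, div_self (pow_ne_zero _ hz)])
    refine ⟨a, ha, ?_⟩
    rw [map_pow, haz, div_mul_cancel₀ _ hz]
  rcases mul_eq_zero.1 key with h | h
  · obtain ⟨a, ha, h⟩ := fin v hv (sub_eq_zero.1 h)
    exact ⟨a, ha, Or.inl h⟩
  · obtain ⟨a, ha, h⟩ := fin v⁻¹ (inv_ne_zero hv) (sub_eq_zero.1 h)
    exact ⟨a, ha, Or.inr h⟩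

/-- The defining polynomial. -/
noncomputable def Q (p : ℕ) (T : k[X]) : (FractionRing k[X])[X] :=
  X ^ (2 * p) - C (algebraMap k[X] (FractionRing k[X]) (T - 2)) * X ^ p + 1

theorem Q_aeval (T : k[X]) (u : LS k p) : aeval u (Q p T) =
    u ^ (2 * p) - (algebraMap k[X] (LS k p) T - 2) * u ^ p + 1 := by
  simp only [Q, map_add, map_sub, map_mul, map_pow, aeval_X, aeval_C, map_one]
  rw [← IsScalarTower.algebraMap_apply, ← IsScalarTower.algebraMap_apply, map_ofNat]

theorem Q_root (T : k[X]) (u : LS k p) : aeval u (Q p T) = 0 ↔ IsR T u := by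
  rw [Q_aeval]
  have hp0 : p ≠ 0 := NeZero.ne p
  by_cases hu : u = 0
  · subst hu
    simp [IsR, hp0]
  have h1 : u ^ p * u⁻¹ ^ p = 1 := by rw [← mul_pow, mul_inv_cancel₀ hu, one_pow]
  have hup : u ^ p ≠ 0 := pow_ne_zero _ hu
  constructor
  · intro h
    refine ⟨hu, ?_⟩
    apply mul_left_cancel₀ hup
    linear_combination h + h1
  · rintro ⟨-, h⟩
    linear_combination u ^ p * h - h1

theorem Q_ne (T : k[X]) : Q p T ≠ 0 := by
  intro h
  have := (Q_root (p := p) T 0).1 (by rw [h]; simp)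
  exact this.1 rfl

theorem Q_splits (T : k[X]) {ω : k} (hω : IsPrimitiveRoot ω p) {w : LS k p} (hw : IsR T w) :
    ((Q p T).map (algebraMap (FractionRing k[X]) (LS k p))).Splits := by
  have hωL : IsPrimitiveRoot (algebraMap k (LS k p) ω) p :=
    hω.map_of_injective (algebraMap k (LS k p)).injective
  have e : (Q p T).map (algebraMap (FractionRing k[X]) (LS k p)) =
      (X ^ p - C (w ^ p)) * (X ^ p - C (w⁻¹ ^ p)) := by
    have h1 : w ^ p * w⁻¹ ^ p = 1 := by rw [← mul_pow, mul_inv_cancel₀ hw.1, one_pow]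
    have h2 : (C (w ^ p) * C (w⁻¹ ^ p) : (LS k p)[X]) = 1 := by rw [← C_mul, h1, C_1]
    have h3 : (C (w ^ p) + C (w⁻¹ ^ p) + C 2 : (LS k p)[X]) = C (algebraMap k[X] (LS k p) T) := by
      rw [← hw.2, C_add, C_add]
    simp only [Q, Polynomial.map_add, Polynomial.map_sub, Polynomial.map_mul, Polynomial.map_pow, map_X,
      map_C, Polynomial.map_one, ← IsScalarTower.algebraMap_apply]
    rw [map_sub, C_sub, ← h3, map_ofNat (algebraMap k[X] (LS k p)) 2]
    linear_combination (-1 : (LS k p)[X]) * h2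
  rw [e]
  exact (X_pow_sub_C_splits_of_isPrimitiveRoot hωL rfl).mul (X_pow_sub_C_splits_of_isPrimitiveRoot hωL rfl)

theorem Q_sep (T : k[X]) (hpk : (p : k) ≠ 0) {u : LS k p} (hu : IsR T u)
    (hd : u ^ p ≠ u⁻¹ ^ p) : aeval u (derivative (Q p T)) ≠ 0 := by
  have hp0 : 0 < p := Nat.pos_of_ne_zero (NeZero.ne p)
  have hpL : (p : LS k p) ≠ 0 := by
    rw [← map_natCast (algebraMap k (LS k p)), _root_.map_ne_zero]; exact hpk
  intro h
  simp only [Q, derivative_add, derivative_sub, derivative_X_pow, derivative_C_mul_X_pow, derivative_one,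
    add_zero] at h
  simp only [map_sub, map_mul, map_pow, aeval_X, aeval_C, map_natCast, map_ofNat,
    ← IsScalarTower.algebraMap_apply] at h
  rw [← hu.2] at h
  have h1 : u ^ p * u⁻¹ ^ p = 1 := by rw [← mul_pow, mul_inv_cancel₀ hu.1, one_pow]
  have e1 : u ^ (2 * p - 1) * u = (u ^ p) ^ 2 := by
    rw [← pow_succ, ← pow_mul]; congr 1; omega
  have e2 : u ^ (p - 1) * u = u ^ p := by
    rw [← pow_succ]; congr 1; omega
  have h3 : (p : LS k p) * u ^ p * (u ^ p - u⁻¹ ^ p) = 0 := by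
    have := congrArg (· * u) h
    simp only [zero_mul] at this
    push_cast at this
    linear_combination this - 2 * (p : LS k p) * e1 + (u ^ p + u⁻¹ ^ p) * p * e2
  rcases mul_eq_zero.1 h3 with h4 | h4
  · exact mul_ne_zero hpL (pow_ne_zero _ hu.1) h4
  · exact hd (sub_eq_zero.1 h4)

end roots
end LS


namespace LS
variable {k : Type} {p : ℕ} [Field k] [NeZero p] {ι : Type}

theorem IsR.order_ne {T : k[X]} {ω : k} (hω : IsPrimitiveRoot ω p) {u w : LS k p}
    (hu : IsR T u) (hw : IsR T w) (ho : (toH w).order = -2) : u ^ p ≠ u⁻¹ ^ p := by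
  have hp0 : p ≠ 0 := NeZero.ne p
  have key : w ^ p * w ^ p ≠ 1 := by
    intro h
    have h1 := congrArg (fun z => (toH z).order) h
    simp only [map_mul, map_pow, map_one, HahnSeries.order_one] at h1
    have hw0 : toH w ≠ 0 := (_root_.map_ne_zero _).2 hw.1
    rw [HahnSeries.order_mul (pow_ne_zero _ hw0) (pow_ne_zero _ hw0), HahnSeries.order_pow, ho] at h1
    simp at h1
    omega
  have hωp : ∀ a, algebraMap k (LS k p) (ω ^ a) ^ p = 1 := by
    intro a
    rw [← map_pow, ← pow_mul, mul_comm, pow_mul, hω.pow_eq_one, one_pow, map_one]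
  intro h
  apply key
  have h1 : u ^ p * u ^ p = 1 := by
    nth_rewrite 2 [h]
    rw [← mul_pow, mul_inv_cancel₀ hu.1, one_pow]
  obtain ⟨a, -, ha | ha⟩ := hu.cases hω hw
  · rw [ha, mul_pow, hωp, one_mul] at h1
    exact h1
  · rw [ha, mul_pow, hωp, one_mul, inv_pow, ← mul_inv, inv_eq_one] at h1
    exact h1

theorem IsR.eq_mul {T : k[X]} {ω : k} (hω : IsPrimitiveRoot ω p) {u w : LS k p}
    (hu : IsR T u) (hw : IsR T w) (ho : (toH w).order = -2) {c : k} (hc : c ≠ 0)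
    (h : (toH u).coeff (-2) = c * (toH w).coeff (-2)) : u = algebraMap k _ c * w := by
  have hw0 : toH w ≠ 0 := (_root_.map_ne_zero _).2 hw.1
  have hγ : (toH w).coeff (-2) ≠ 0 := by
    rw [← ho, Ne, HahnSeries.coeff_order_eq_zero]; exact hw0
  obtain ⟨a, -, ha | ha⟩ := hu.cases hω hw
  · have e : (toH u).coeff (-2) = ω ^ a * (toH w).coeff (-2) := by
      rw [ha, map_mul, toH_C, HahnSeries.C_mul_eq_smul, HahnSeries.coeff_smul, smul_eq_mul]
    rw [h] at e
    rw [ha, mul_right_cancel₀ hγ e]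
  · exfalso
    have e : (toH u).coeff (-2) = 0 := by
      rw [ha, map_mul, toH_C, HahnSeries.C_mul_eq_smul, HahnSeries.coeff_smul, smul_eq_mul]
      rw [HahnSeries.coeff_eq_zero_of_lt_order, mul_zero]
      rw [map_inv₀]
      have h2 : (toH w * (toH w)⁻¹).order = 0 := by
        rw [mul_inv_cancel₀ hw0, HahnSeries.order_one]
      rw [HahnSeries.order_mul hw0 (inv_ne_zero hw0), ho] at h2
      omega
    rw [h] at e
    exact mul_ne_zero hc hγ e

/-- The splitting field. -/
noncomputable def LL (p : ℕ) [NeZero p] (T : ι → k[X]) : IntermediateField (FractionRing k[X]) (LS k p) :=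
  IntermediateField.adjoin (FractionRing k[X]) {u : LS k p | ∃ i, IsR (T i) u}

theorem mem_LL {T : ι → k[X]} {i : ι} {u : LS k p} (h : IsR (T i) u) : u ∈ LL p T :=
  IntermediateField.subset_adjoin _ _ ⟨i, h⟩

instance (T : ι → k[X]) : IsScalarTower k k[X] (LL p T) :=
  IsScalarTower.of_algebraMap_eq fun _ => Subtype.ext rfl

instance (T : ι → k[X]) : IsScalarTower k[X] (FractionRing k[X]) (LL p T) :=
  IsScalarTower.of_algebraMap_eq fun x => Subtype.ext
    (IsScalarTower.algebraMap_apply k[X] (FractionRing k[X]) (LS k p) x)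

theorem coe_k (T : ι → k[X]) (c : k) : ((algebraMap k (LL p T) c : LL p T) : LS k p) = algebraMap k _ c := rfl
theorem coe_kx (T : ι → k[X]) (c : k[X]) :
    ((algebraMap k[X] (LL p T) c : LL p T) : LS k p) = algebraMap k[X] _ c := rfl

theorem splitting [Fintype ι] (T : ι → k[X]) {ω : k} (hω : IsPrimitiveRoot ω p) (w : ι → LS k p)
    (hw : ∀ i, IsR (T i) (w i)) :
    (∏ i, Q p (T i)).IsSplittingField (FractionRing k[X]) (LL p T) := by
  have e : {u : LS k p | ∃ i, IsR (T i) u} = (∏ i, Q p (T i)).rootSet (LS k p) := by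
    ext u
    have hne : ∏ i, Q p (T i) ≠ 0 := Finset.prod_ne_zero_iff.2 fun i _ => Q_ne (T i)
    rw [mem_rootSet_of_ne hne, map_prod, Finset.prod_eq_zero_iff]
    simp [Q_root]
  unfold LL
  rw [e]
  apply IntermediateField.adjoin_rootSet_isSplittingField
  rw [Polynomial.map_prod]
  exact Splits.prod fun i _ => Q_splits _ hω (hw i)

theorem galois [Fintype ι] (T : ι → k[X]) (hpk : (p : k) ≠ 0) {ω : k} (hω : IsPrimitiveRoot ω p) (w : ι → LS k p)
    (hw : ∀ i, IsR (T i) (w i)) (ho : ∀ i, (toH (w i)).order = -2) :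
    FiniteDimensional (FractionRing k[X]) (LL p T) ∧ IsGalois (FractionRing k[X]) (LL p T) := by
  have hs := splitting T hω w hw
  have hfd : FiniteDimensional (FractionRing k[X]) (LL p T) :=
    Polynomial.IsSplittingField.finiteDimensional _ (∏ i, Q p (T i))
  have hn : Normal (FractionRing k[X]) (LL p T) := Normal.of_isSplittingField (∏ i, Q p (T i))
  have hsep : Algebra.IsSeparable (FractionRing k[X]) (LL p T) := by
    unfold LL
    rw [IntermediateField.isSeparable_adjoin_iff_isSeparable]
    rintro u ⟨i, hu⟩
    have hIntegral : IsIntegral (FractionRing k[X]) u := by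
      have h1 : IsAlgebraic (FractionRing k[X]) u := ⟨Q p (T i), Q_ne _, (Q_root _ _).2 hu⟩
      exact h1.isIntegral
    have hirr := minpoly.irreducible hIntegral
    rw [IsSeparable, separable_iff_derivative_ne_zero hirr]
    intro hd
    obtain ⟨R, hR⟩ := minpoly.dvd (FractionRing k[X]) u ((Q_root (T i) u).2 hu)
    apply Q_sep (T i) hpk hu (hu.order_ne hω (hw i) (ho i))
    rw [hR, derivative_mul, hd, zero_mul, zero_add, map_mul, minpoly.aeval, zero_mul]
  exact ⟨hfd, ⟨⟩⟩

theorem tw_IsR (ψ : k →+* k) (ω : k) (hω : ω ≠ 0) (hp : ω ^ p = 1) {T : k[X]} (hT : T.map ψ = T) {u : LS k p}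
    (hu : IsR T u) : IsR T (tw ψ ω hω u) := by
  refine ⟨(_root_.map_ne_zero _).2 hu.1, ?_⟩
  have := congrArg (tw ψ ω hω) hu.2
  rw [alg_px, tw_px _ _ _ hp, hT] at this
  rw [alg_px, ← this]
  simp only [map_add, map_pow, map_inv₀]
  rw [map_ofNat]

theorem tw_mem (ψ : k →+* k) (ω : k) (hω : ω ≠ 0) (hp : ω ^ p = 1) {T : ι → k[X]} (hT : ∀ i, (T i).map ψ = T i)
    {u : LS k p} (hu : u ∈ LL p T) : tw ψ ω hω u ∈ LL p T := by
  have hpx : ∀ a : k[X], (px a : LS k p) ∈ LL p T := fun a => by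
    rw [← alg_px, IsScalarTower.algebraMap_apply k[X] (FractionRing k[X])]
    exact (LL p T).algebraMap_mem _
  refine IntermediateField.adjoin_induction (p := fun u _ => tw ψ ω hω u ∈ LL p T) _ ?_ ?_ ?_ ?_ ?_ hu
  · rintro x ⟨i, hx⟩
    exact mem_LL (tw_IsR ψ ω hω hp (hT i) hx)
  · intro r
    obtain ⟨a, b, hb, rfl⟩ := IsFractionRing.div_surjective (A := k[X]) r
    rw [map_div₀, ← IsScalarTower.algebraMap_apply, ← IsScalarTower.algebraMap_apply, map_div₀, alg_px, alg_px,
      tw_px _ _ _ hp, tw_px _ _ _ hp]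
    exact (LL p T).div_mem (hpx _) (hpx _)
  · intro x y _ _ hx hy; rw [map_add]; exact (LL p T).add_mem hx hy
  · intro x _ hx; rw [map_inv₀]; exact (LL p T).inv_mem hx
  · intro x y _ _ hx hy; rw [map_mul]; exact (LL p T).mul_mem hx hy

/-- Rotation as an algebra homomorphism. -/
noncomputable def rot (ω : k) (hω : ω ≠ 0) (hp : ω ^ p = 1) : LS k p →ₐ[FractionRing k[X]] LS k p :=
  { tw (RingHom.id k) ω hω with
    commutes' := by
      intro r
      change tw (RingHom.id k) ω hω (algebraMap _ _ r) = algebraMap _ _ r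
      obtain ⟨a, b, hb, rfl⟩ := IsFractionRing.div_surjective (A := k[X]) r
      rw [map_div₀, ← IsScalarTower.algebraMap_apply, ← IsScalarTower.algebraMap_apply, map_div₀, alg_px, alg_px,
        tw_px _ _ _ hp, tw_px _ _ _ hp, Polynomial.map_id, Polynomial.map_id] }

theorem rot_apply (ω : k) (hω : ω ≠ 0) (hp : ω ^ p = 1) (u : LS k p) :
    rot ω hω hp u = tw (RingHom.id k) ω hω u := rfl

theorem exists_point [IsAlgClosed k] [Fintype ι] (ℓ : ℕ) [Fact ℓ.Prime] [CharP k ℓ] (s q : ℕ) (hqs : q = ℓ ^ s)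
    (hpp : p.Prime) (hp : 2 < p) (ω : k) (hω : IsPrimitiveRoot ω p) (hωq : ω ^ q = ω) (T : ι → k[X])
    (hT : ∀ i, (T i).natDegree = 2) (hTq : ∀ i n, (T i).coeff n ^ q = (T i).coeff n) (hpq : p ∣ q - 1)
    (Fr : Finset k) (hFr : Fr.card = q) (hFrq : ∀ r ∈ Fr, r ^ q = r)
    (hq : GD.thr p (Fintype.card ι) < q) (hyp : GD.Hyp p T q) :
    ∃ r ∈ Fr, ∀ i, ∃ lam : k, lam ≠ 0 ∧ lam ^ q = lam ∧ lam + lam⁻¹ + 2 = (T i).eval r ∧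
      lam ^ ((q - 1) / p) ≠ 1 := by
  have hpk : (p : k) ≠ 0 := hω.neZero'.ne
  have hω0 : ω ≠ 0 := hω.ne_zero (by omega)
  have hwex : ∀ i, ∃ w : LS k p, IsR (T i) w ∧ (toH w).order = -2 ∧
      (toH w).coeff (-2) ^ p = (T i).leadingCoeff := by
    intro i
    obtain ⟨w, h1, h2, h3⟩ := HS.exists_w p hp hpk (T i) (hT i)
    refine ⟨toH.symm w, ⟨?_, ?_⟩, ?_, ?_⟩
    · rw [_root_.map_ne_zero]
      rintro rfl
      simp at h1
    · apply toH.injective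
      rw [alg_px, toH_px, ← h3]
      simp only [map_add, map_pow, map_inv₀, RingEquiv.apply_symm_apply]
      rw [map_ofNat]
    · simpa using h1
    · simpa using h2
  choose w hw ho hl using hwex
  obtain ⟨hfd, hgal⟩ := galois T hpk hω w hw ho
  let S : GD k (LL p T) ι :=
    { p := p
      hp := hp
      ω := ω
      hω := hω
      φ := (toH (k := k) (p := p)).toRingHom.comp (algebraMap (LL p T) (LS k p))
      φ_C := fun c => toH_C c
      φ_x := toH_x
      w := fun i => ⟨w i, mem_LL (hw i)⟩
      T := T
      rel := fun i => Subtype.ext (hw i).2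
      ordw := ho
      hT := hT
      lead := hl
      gen := by
        intro g hg
        have : (g : LL p T →ₐ[FractionRing k[X]] LL p T) = AlgHom.id _ _ := by
          apply IntermediateField.adjoin_algHom_ext
          rintro u ⟨i, hu⟩
          have hgk : ∀ c : k, g (algebraMap k _ c) = algebraMap k _ c := fun c => by
            rw [IsScalarTower.algebraMap_apply k k[X] (LL p T),
              IsScalarTower.algebraMap_apply k[X] (FractionRing k[X]) (LL p T), AlgEquiv.commutes]
          change g ⟨u, mem_LL hu⟩ = ⟨u, mem_LL hu⟩
          obtain ⟨a, -, ha | ha⟩ := hu.cases hω (hw i)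
          · have : (⟨u, mem_LL hu⟩ : LL p T) = algebraMap k _ (ω ^ a) * ⟨w i, mem_LL (hw i)⟩ :=
              Subtype.ext ha
            rw [this, map_mul, hgk, hg]
          · have : (⟨u, mem_LL hu⟩ : LL p T) = algebraMap k _ (ω ^ a) * ⟨w i, mem_LL (hw i)⟩⁻¹ :=
              Subtype.ext ha
            rw [this, map_mul, hgk, map_inv₀, hg]
        ext1 x
        exact DFunLike.congr_fun this x }
  have hadd : ∀ a b : k, (a + b) ^ q = a ^ q + b ^ q := by
    intro a b; rw [hqs]; exact add_pow_char_pow ..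
  have hq0 : q ≠ 0 := by rw [hqs]; exact pow_ne_zero _ (Fact.out : ℓ.Prime).ne_zero
  have hTm : ∀ i, (T i).map (GD.frq q hq0 hadd) = T i := by
    intro i
    ext n
    rw [coeff_map]
    exact hTq i n
  let θ : LL p T →+* LL p T :=
    ((tw (p := p) (GD.frq q hq0 hadd) 1 one_ne_zero).comp (algebraMap (LL p T) (LS k p))).codRestrict
      (LL p T).toSubfield fun x => tw_mem _ _ one_ne_zero (one_pow _) hTm x.2
  have hθ : ∀ f n, (S.φ (θ f)).coeff n = (S.φ f).coeff n ^ q := by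
    intro f n
    have := tw_coeff (p := p) (GD.frq q hq0 hadd) 1 one_ne_zero (f : LS k p) n
    rw [_root_.one_zpow, one_mul] at this
    exact this
  refine S.frob_hyp ℓ s q hqs θ hθ hTq hpq Fr hFr hFrq hq hωq hpp
    (AlgHom.restrictNormal' (rot ω hω0 hω.pow_eq_one) (LL p T)) ?_ hyp
  intro i
  apply Subtype.ext
  have h1 := AlgHom.restrictNormal_commutes (rot ω hω0 hω.pow_eq_one) (LL p T) (S.w i)
  change algebraMap (LL p T) (LS k p) ((rot ω hω0 hω.pow_eq_one).restrictNormal (LL p T) (S.w i)) =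
    algebraMap k (LS k p) (ω ^ (p - 2)) * w i
  rw [h1]
  apply IsR.eq_mul hω (tw_IsR (RingHom.id k) ω hω0 hω.pow_eq_one (T := T i) Polynomial.map_id (hw i)) (hw i) (ho i)
    (pow_ne_zero _ hω0)
  rw [tw_coeff, RingHom.id_apply]
  congr 1
  rw [_root_.zpow_neg, inv_eq_iff_eq_inv, eq_comm]
  apply inv_eq_of_mul_eq_one_left
  change ω ^ ((2 : ℕ) : ℤ) * ω ^ (p - 2) = 1
  rw [zpow_natCast, ← pow_add, Nat.add_sub_cancel' (by omega), hω.pow_eq_one]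

end LS


namespace FF
variable {F : Type} [Field F] [Fintype F] {p : ℕ}

/-- The uniform threshold. -/
def bigN (p : ℕ) : ℕ := ∑ c ∈ Finset.range (2 * p + 1), GD.thr p c

theorem thr_le {c : ℕ} (hc : c ≤ 2 * p) : GD.thr p c ≤ bigN p :=
  Finset.single_le_sum (f := fun c => GD.thr p c) (fun _ _ => Nat.zero_le _)
    (Finset.mem_range.2 (by omega))

theorem mem_of_pow {K : Type} [Field K] [Algebra F K] {l : K} (h : l ^ Fintype.card F = l) :
    ∃ m : F, algebraMap F K m = l := by
  classical
  by_contra hn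
  push Not at hn
  have hq : 1 < Fintype.card F := Fintype.one_lt_card
  let P : K[X] := X ^ Fintype.card F - X
  have hP : P ≠ 0 := FiniteField.X_pow_card_sub_X_ne_zero K hq
  have hd : P.natDegree = Fintype.card F := FiniteField.X_pow_card_sub_X_natDegree_eq K hq
  have hsub : (insert l (Finset.univ.image (algebraMap F K))) ⊆ P.roots.toFinset := by
    intro z hz
    rw [Multiset.mem_toFinset, mem_roots hP]
    simp only [P, IsRoot.def, eval_sub, eval_pow, eval_X]
    rcases Finset.mem_insert.1 hz with rfl | hz
    · rw [h, sub_self]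
    · obtain ⟨m, -, rfl⟩ := Finset.mem_image.1 hz
      rw [← map_pow, FiniteField.pow_card, sub_self]
  have h1 := Finset.card_le_card hsub
  rw [Finset.card_insert_of_notMem (by simpa using hn), Finset.card_image_of_injective _ (algebraMap F K).injective,
    Finset.card_univ] at h1
  have h2 := P.roots.toFinset_card_le
  have h3 := P.card_roots'
  omega

/-- The quadratic polynomials. -/
noncomputable def quad {K : Type} [Field K] (β a : K) : K[X] := C β * (X - C a) ^ 2

theorem quad_natDegree {K : Type} [Field K] {β : K} (hβ : β ≠ 0) (a : K) : (quad β a).natDegree = 2 := by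
  rw [quad, natDegree_C_mul hβ, natDegree_pow, natDegree_X_sub_C]

theorem quad_lead {K : Type} [Field K] (β : K) (a : K) : (quad β a).leadingCoeff = β := by
  rw [quad, leadingCoeff_mul, leadingCoeff_C, leadingCoeff_pow, leadingCoeff_X_sub_C, one_pow, mul_one]

theorem quad_map {K : Type} [Field K] [Algebra F K] (β a : F) :
    (quad β a).map (algebraMap F K) = quad (algebraMap F K β) (algebraMap F K a) := by
  simp [quad]

theorem quad_eval {K : Type} [Field K] (β a x : K) : (quad β a).eval x = β * (x - a) ^ 2 := by
  simp [quad]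

theorem quad_even {K : Type} [Field K] {β : K} (hβ : β ≠ 0) (a x : K)
    (h : (quad β a - 4).eval x ≠ 0) : Even ((quad β a * (quad β a - 4)).rootMultiplicity x) := by
  have h4 : quad β a - 4 ≠ 0 := by rintro h'; rw [h'] at h; simp at h
  have h0 : quad β a ≠ 0 := by
    intro h'
    have := quad_natDegree hβ a
    rw [h'] at this; simp at this
  rw [rootMultiplicity_mul (mul_ne_zero h0 h4), rootMultiplicity_eq_zero (p := quad β a - 4) h, add_zero, quad,
    rootMultiplicity_mul (by exact h0), rootMultiplicity_C, zero_add, pow_two,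
    rootMultiplicity_mul (mul_ne_zero (X_sub_C_ne_zero a) (X_sub_C_ne_zero a))]
  exact ⟨_, rfl⟩

theorem point_F {ι : Type} [Fintype ι] (hpp : p.Prime) (hp : 2 < p) (hpq : p ∣ Fintype.card F - 1)
    (ω : F) (hω : IsPrimitiveRoot ω p) (β a : ι → F) (hβ : ∀ i, β i ≠ 0)
    (hc : Fintype.card ι ≤ 2 * p) (hq : bigN p < Fintype.card F)
    (hyp : GD.Hyp p (fun i => quad (algebraMap F (AlgebraicClosure F) (β i))
      (algebraMap F (AlgebraicClosure F) (a i))) (Fintype.card F)) :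
    ∃ r : F, ∀ i, ∃ lam : F, lam ≠ 0 ∧ lam + lam⁻¹ + 2 = β i * (r - a i) ^ 2 ∧
      lam ^ ((Fintype.card F - 1) / p) ≠ 1 := by
  classical
  have : NeZero p := ⟨by omega⟩
  obtain ⟨ℓ, hℓ⟩ := CharP.exists F
  obtain ⟨n, hℓp, hcard⟩ := FiniteField.card F ℓ
  have : Fact ℓ.Prime := ⟨hℓp⟩
  have : CharP (AlgebraicClosure F) ℓ :=
    charP_of_injective_algebraMap (algebraMap F (AlgebraicClosure F)).injective ℓ
  have hinj := (algebraMap F (AlgebraicClosure F)).injective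
  have hfix : ∀ c : F, algebraMap F (AlgebraicClosure F) c ^ Fintype.card F = algebraMap F _ c := fun c => by
    rw [← map_pow, FiniteField.pow_card]
  obtain ⟨r, hr, h⟩ := LS.exists_point (k := AlgebraicClosure F) ℓ n (Fintype.card F) hcard hpp hp
    (algebraMap F _ ω) (hω.map_of_injective hinj) (hfix ω) (fun i => quad (algebraMap F (AlgebraicClosure F) (β i))
      (algebraMap F (AlgebraicClosure F) (a i)))
    (fun i => quad_natDegree ((_root_.map_ne_zero _).2 (hβ i)) _)
    (fun i n => by rw [← quad_map, coeff_map, hfix]) hpq (Finset.univ.image (algebraMap F (AlgebraicClosure F)))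
    (by rw [Finset.card_image_of_injective _ hinj, Finset.card_univ])
    (by
      intro r hr
      obtain ⟨m, -, rfl⟩ := Finset.mem_image.1 hr
      exact hfix m) ((thr_le hc).trans_lt hq) hyp
  obtain ⟨r, -, rfl⟩ := Finset.mem_image.1 hr
  refine ⟨r, fun i => ?_⟩
  obtain ⟨l, hl0, hlq, hl, hle⟩ := h i
  obtain ⟨lam, rfl⟩ := mem_of_pow hlq
  refine ⟨lam, fun h0 => hl0 (by rw [h0, map_zero]), ?_, fun h1 => hle (by rw [← map_pow, h1, map_one])⟩
  rw [quad_eval] at hl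
  apply hinj
  simp only [map_add, map_inv₀, map_mul, map_pow, map_sub]
  rw [map_ofNat]
  exact hl

/-- The conclusion about matrices. -/
def Good (p : ℕ) (M : Matrix (Fin 2) (Fin 2) F) : Prop := ∃ lam : F, lam ≠ 0 ∧
  lam ^ ((Fintype.card F - 1) / p) ≠ 1 ∧ M.trace ^ 2 = (lam + lam⁻¹ + 2) * M.det

theorem pow_e_inj {K : Type} [Field K] {ω : K} (hω : IsPrimitiveRoot ω p) (hpp : p.Prime) {e : ℕ} (he : ¬ p ∣ e) {i j : ℕ}
    (hi : i < p) (hj : j < p) (h : (ω ^ i) ^ e = (ω ^ j) ^ e) : i = j := by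
  have h2 : IsPrimitiveRoot (ω ^ e) p :=
    hω.pow_of_coprime e ((Nat.Prime.coprime_iff_not_dvd hpp).2 he).symm
  apply h2.pow_inj hi hj
  rw [← pow_mul, ← pow_mul, mul_comm e, mul_comm e, pow_mul, pow_mul, h]

theorem e_ndvd (hpq : p ∣ Fintype.card F - 1) (hpq2 : ¬ p ^ 2 ∣ Fintype.card F - 1) :
    ¬ p ∣ (Fintype.card F - 1) / p := by
  rintro ⟨m, hm⟩
  apply hpq2
  refine ⟨m, ?_⟩
  rw [pow_two, mul_assoc, ← hm, Nat.mul_div_cancel' hpq]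

theorem cancel_aux {u d y : F} (hu : u ≠ 0) (hd : d ≠ 0) :
    ((1 + u) * y) ^ 2 = (1 + u) ^ 2 / (u * d) * y ^ 2 * (u * d) := by
  field_simp

theorem char_two (h2 : (2 : F) = 0) (hpp : p.Prime) (hp : 2 < p) (hpq : p ∣ Fintype.card F - 1)
    (hpq2 : ¬ p ^ 2 ∣ Fintype.card F - 1)
    (ω : F) (hω : IsPrimitiveRoot ω p) (hq : bigN p < Fintype.card F) :
    ∃ G : Matrix (Fin 2) (Fin 2) F, G.det ≠ 0 ∧ ∀ i < p, Good p (G * !![ω ^ i, 0; 0, 1]) ∧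
      Good p (G * !![ω ^ i, 0; 0, 1] * !![0, -1; 1, 0]) := by
  classical
  have : NeZero p := ⟨by omega⟩
  have he := e_ndvd hpq hpq2
  set e := (Fintype.card F - 1) / p with hedef
  have hω0 : ω ≠ 0 := hω.ne_zero (by omega)
  have hneg : ∀ a : F, -a = a := fun a => by linear_combination (-a) * h2
  have hu1 : ∀ i, i < p → i ≠ 0 → 1 + ω ^ i ≠ 0 := by
    intro i hi hi0 h
    apply hω.pow_ne_one_of_pos_of_lt hi0 hi
    linear_combination h - h2
  have h1ω : 1 + ω ≠ 0 := by have := hu1 1 (by omega) one_ne_zero; rwa [pow_one] at this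
  set c := ω / (1 + ω) with hcdef
  have hcc : c ^ 2 + c = ω / (1 + ω) ^ 2 := by
    rw [hcdef]; field_simp; linear_combination (ω) * h2
  have hcc0 : c ^ 2 + c ≠ 0 := by rw [hcc]; exact div_ne_zero hω0 (pow_ne_zero _ h1ω)
  let ι : Type := {x : Fin p × Bool // x.1 ≠ 0}
  let β : ι → F := fun i => (1 + ω ^ (i.1.1 : ℕ)) ^ 2 / (ω ^ (i.1.1 : ℕ) * (c ^ 2 + c))
  let a : ι → F := fun i => (1 + ω ^ (i.1.1 : ℕ))⁻¹ + if i.1.2 then c else 0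
  have hi0 : ∀ i : ι, ((i.1.1 : Fin p) : ℕ) ≠ 0 := fun i h => i.2 (Fin.ext h)
  obtain ⟨x, hx⟩ := point_F hpp hp hpq ω hω β a (fun i =>
      div_ne_zero (pow_ne_zero _ (hu1 _ i.1.1.2 (hi0 i))) (mul_ne_zero (pow_ne_zero _ hω0) hcc0))
    (by
      refine (Fintype.card_subtype_le _).trans ?_
      simp [mul_comm]) hq (by
      left
      let γ : ℕ → F := fun i => ((1 + ω ^ i) ^ 2 / (ω ^ i * (c ^ 2 + c))) ^ e
      obtain ⟨v, hv, hv'⟩ := Finset.exists_mem_notMem_of_card_lt_card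
        (s := (Finset.Ioo 0 p).image γ) (t := (Finset.range p).image fun i => ω ^ i) (by
          refine Finset.card_image_le.trans_lt ?_
          rw [Finset.card_image_of_injOn (fun i hi j hj h => hω.pow_inj (by simpa using hi) (by simpa using hj) h)]
          simp; omega)
      obtain ⟨j, -, rfl⟩ := Finset.mem_image.1 hv
      refine ⟨algebraMap F _ (ω ^ j), ?_, ?_⟩
      · rw [← map_pow, ← pow_mul, mul_comm, pow_mul, hω.pow_eq_one, one_pow, map_one]
      · intro i h
        rw [quad_lead, ← map_pow] at h
        apply hv'
        rw [← (algebraMap F (AlgebraicClosure F)).injective h]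
        exact Finset.mem_image.2 ⟨i.1.1, Finset.mem_Ioo.2 ⟨Nat.pos_of_ne_zero (hi0 i), i.1.1.2⟩, rfl⟩)
  refine ⟨!![x, x + c + 1; x + c, x + 1], ?_, ?_⟩
  · rw [Matrix.det_fin_two_of]
    have : x * (x + 1) - (x + c + 1) * (x + c) = c ^ 2 + c := by
      linear_combination (-x * c - c ^ 2 - c) * h2
    rw [this]; exact hcc0
  intro i hi
  set u := ω ^ i with hu
  have hu0 : u ≠ 0 := pow_ne_zero _ hω0
  have e1 : (!![x, x + c + 1; x + c, x + 1] * !![u, 0; 0, 1]) = !![x * u, x + c + 1; (x + c) * u, x + 1] := by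
    simp [Matrix.mul_fin_two]
  have e2 : (!![x, x + c + 1; x + c, x + 1] * !![u, 0; 0, 1] * !![0, -1; 1, 0]) =
      !![x + c + 1, -(x * u); x + 1, -((x + c) * u)] := by
    rw [e1]; simp [Matrix.mul_fin_two]
  rw [e2, e1]
  have d1 : x * u * (x + 1) - (x + c + 1) * ((x + c) * u) = u * (c ^ 2 + c) := by
    linear_combination (-x * c - c ^ 2 - c) * u * h2
  have d2 : (x + c + 1) * -((x + c) * u) - -(x * u) * (x + 1) = u * (c ^ 2 + c) := by
    linear_combination (-x * c - c ^ 2 - c) * u * h2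
  have t2 : x + c + 1 + -((x + c) * u) = (x + c) * (1 + u) + 1 := by
    linear_combination (-(x + c) * u) * h2
  have t1 : x * u + (x + 1) = x * (1 + u) + 1 := by ring
  rcases Nat.eq_zero_or_pos i with rfl | hipos
  · have hu' : u = 1 := by rw [hu, pow_zero]
    have hT : (1 : F) = (ω + ω⁻¹ + 2) * (u * (c ^ 2 + c)) := by
      rw [hu', hcc]; field_simp; ring
    have hωe : ω ^ e ≠ 1 := by
      intro h
      have := pow_e_inj hω hpp he (i := 1) (j := 0) (by omega) (by omega) (by simpa using h)
      omega
    refine ⟨⟨ω, hω0, hωe, ?_⟩, ⟨ω, hω0, hωe, ?_⟩⟩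
    · rw [Matrix.det_fin_two_of, Matrix.trace_fin_two_of, d1, ← hT, t1, hu']
      linear_combination (2 * x ^ 2 + 2 * x) * h2
    · rw [Matrix.det_fin_two_of, Matrix.trace_fin_two_of, d2, ← hT, t2, hu']
      linear_combination (2 * (x + c) ^ 2 + 2 * (x + c)) * h2
  · have hne : 1 + u ≠ 0 := hu1 i hi (by omega)
    have hfi : (⟨i, hi⟩ : Fin p) ≠ 0 := by
      intro h
      have := congrArg Fin.val h
      simp at this
      omega
    constructor
    · obtain ⟨lam, l0, l1, l2⟩ := hx ⟨(⟨i, hi⟩, false), hfi⟩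
      refine ⟨lam, l0, l2, ?_⟩
      rw [Matrix.det_fin_two_of, Matrix.trace_fin_two_of, d1, l1, t1]
      simp only [β, a, ← hu]
      simp only [Bool.false_eq_true, if_false, add_zero]
      have e3 : x * (1 + u) + 1 = (1 + u) * (x - (1 + u)⁻¹) := by
        rw [mul_sub, mul_inv_cancel₀ hne]
        linear_combination h2
      rw [e3]
      exact cancel_aux hu0 hcc0
    · obtain ⟨lam, l0, l1, l2⟩ := hx ⟨(⟨i, hi⟩, true), hfi⟩
      refine ⟨lam, l0, l2, ?_⟩
      rw [Matrix.det_fin_two_of, Matrix.trace_fin_two_of, d2, l1, t2]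
      simp only [β, a, ← hu]
      simp only [if_true]
      have e3 : (x + c) * (1 + u) + 1 = (1 + u) * (x - ((1 + u)⁻¹ + c)) := by
        rw [mul_sub, mul_add (1 + u), mul_inv_cancel₀ hne]
        linear_combination (c * (1 + u) + 1) * h2
      rw [e3]
      exact cancel_aux hu0 hcc0

end FF


namespace FF
variable {F : Type} [Field F] [Fintype F] {p : ℕ}

theorem exists_missed {K : Type} [Field K] {ω κ : K} (hω : IsPrimitiveRoot ω p) (hpp : p.Prime) (hp : 2 < p)
    (hκ : κ ^ 2 = -8) : ∃ j < p, ω ^ j ≠ 1 ∧ ω ^ j ≠ -7 - 2 * κ ∧ ω ^ j ≠ -7 + 2 * κ := by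
  by_contra hn
  push Not at hn
  have key : ∀ j, 0 < j → j < p → ω ^ j = -7 - 2 * κ ∨ ω ^ j = -7 + 2 * κ := by
    intro j h0 hj
    by_cases h : ω ^ j = -7 - 2 * κ
    · exact Or.inl h
    · exact Or.inr (hn j hj (hω.pow_ne_one_of_pos_of_lt (by omega) hj) h)
  have h12 : ω ^ 1 ≠ ω ^ 2 := fun h => by
    have := hω.pow_inj (by omega) (by omega) h
    omega
  have hsum : ω + ω ^ 2 = -14 ∧ ω ^ 3 = 81 := by
    rw [pow_one] at h12
    rcases key 1 (by omega) (by omega) with h1 | h1 <;> rcases key 2 (by omega) (by omega) with h2 | h2 <;>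
      rw [pow_one] at h1
    · exact absurd (h1.trans h2.symm) h12
    · constructor
      · rw [h2, h1]; ring
      · rw [pow_succ, h2, h1]; linear_combination (-4) * hκ
    · constructor
      · rw [h2, h1]; ring
      · rw [pow_succ, h2, h1]; linear_combination (-4) * hκ
    · exact absurd (h1.trans h2.symm) h12
  rcases eq_or_lt_of_le (show 3 ≤ p from hp) with h3 | h3
  · have hω3 : ω ^ 3 = 1 := by rw [h3]; exact hω.pow_eq_one
    have hω1 : ω ≠ 1 := hω.ne_one (by omega)
    have h4 : ω + ω ^ 2 = -1 := by
      have : (ω - 1) * (ω ^ 2 + ω + 1) = 0 := by linear_combination hω3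
      rcases mul_eq_zero.1 this with h | h
      · exact absurd (sub_eq_zero.1 h) hω1
      · linear_combination h
    have h13 : (13 : K) = 0 := by linear_combination hsum.1 - h4
    have h80 : (80 : K) = 0 := by linear_combination hω3 - hsum.2
    have : (1 : K) = 0 := by linear_combination 37 * h13 - 6 * h80
    exact one_ne_zero this
  · have h13 : ω ^ 1 ≠ ω ^ 3 := fun h => by
      have := hω.pow_inj (by omega) (by omega) h
      omega
    have h23 : ω ^ 2 ≠ ω ^ 3 := fun h => by
      have := hω.pow_inj (by omega) (by omega) h
      omega
    rcases key 1 (by omega) (by omega) with h1 | h1 <;> rcases key 2 (by omega) (by omega) with h2 | h2 <;>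
      rcases key 3 (by omega) (by omega) with h3 | h3 <;>
      first
        | exact h12 (h1.trans h2.symm)
        | exact h13 (h1.trans h3.symm)
        | exact h23 (h2.trans h3.symm)

theorem odd_mult {K : Type} [Field K] {κ : K} (hκ : κ ^ 2 = -8) (h2 : (2 : K) ≠ 0) :
    Odd ((quad (-(2 : K)⁻¹) 1 * (quad (-(2 : K)⁻¹) 1 - 4)).rootMultiplicity (1 + κ)) := by
  have hκ0 : κ ≠ 0 := by
    rintro rfl
    have : (2 : K) ^ 3 = 0 := by linear_combination hκ
    exact h2 (pow_eq_zero_iff (by norm_num) |>.1 this)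
  let R : K[X] := C (4 : K)⁻¹ * (X - C 1) ^ 2 * (X - C (1 - κ))
  have h4 : (4 : K) ≠ 0 := by
    have : (4 : K) = 2 * 2 := by norm_num
    rw [this]; exact mul_ne_zero h2 h2
  have e : quad (-(2 : K)⁻¹) 1 * (quad (-(2 : K)⁻¹) 1 - 4) = (X - C (1 + κ)) * R := by
    have hC : (C (-(2 : K)⁻¹) : K[X]) * C (-(2 : K)⁻¹) = C (4 : K)⁻¹ := by
      rw [← C_mul]; congr 1; rw [show (4 : K) = 2 * 2 by norm_num, mul_inv]; ring
    have hC2 : (C (-(2 : K)⁻¹) : K[X]) * 4 = - (C (4 : K)⁻¹ * 8) := by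
      have h44 : (4 : K[X]) = C 4 := (map_ofNat C 4).symm
      have h88 : (8 : K[X]) = C 8 := (map_ofNat C 8).symm
      rw [h44, h88, ← C_mul, ← C_mul, ← C_neg]; congr 1
      rw [show (4 : K) = 2 * 2 by norm_num, show (8 : K) = 2 * 2 * 2 by norm_num]
      field_simp
    have hC3 : (C κ : K[X]) ^ 2 = -8 := by
      rw [← C_pow, hκ, C_neg]; congr 1
    simp only [quad, R, C_add, C_sub, C_1]
    linear_combination (X - 1) ^ 4 * hC - (X - 1) ^ 2 * hC2 + C (4 : K)⁻¹ * (X - 1) ^ 2 * hC3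
  have hR : R.eval (1 + κ) ≠ 0 := by
    simp only [R, eval_mul, eval_C, eval_pow, eval_sub, eval_X]
    refine mul_ne_zero (mul_ne_zero (inv_ne_zero h4) (pow_ne_zero _ ?_)) ?_
    · rw [add_sub_cancel_left]; exact hκ0
    · have : 1 + κ - (1 - κ) = 2 * κ := by ring
      rw [this]; exact mul_ne_zero h2 hκ0
  have hR0 : R ≠ 0 := by rintro h; rw [h] at hR; simp at hR
  rw [e, rootMultiplicity_mul (mul_ne_zero (X_sub_C_ne_zero _) hR0), rootMultiplicity_X_sub_C_self,
    rootMultiplicity_eq_zero (p := R) hR]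
  exact odd_one

theorem char_odd (h2 : (2 : F) ≠ 0) (hpp : p.Prime) (hp : 2 < p) (hpq : p ∣ Fintype.card F - 1)
    (hpq2 : ¬ p ^ 2 ∣ Fintype.card F - 1)
    (ω : F) (hω : IsPrimitiveRoot ω p) (hq : bigN p < Fintype.card F) :
    ∃ G : Matrix (Fin 2) (Fin 2) F, G.det ≠ 0 ∧ ∀ i < p, Good p (G * !![ω ^ i, 0; 0, 1]) ∧
      Good p (G * !![ω ^ i, 0; 0, 1] * !![0, -1; 1, 0]) := by
  classical
  have : NeZero p := ⟨by omega⟩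
  have he := e_ndvd hpq hpq2
  have hee : (Fintype.card F - 1) / p * p = Fintype.card F - 1 := Nat.div_mul_cancel hpq
  set e := (Fintype.card F - 1) / p with hedef
  have hω0 : ω ≠ 0 := hω.ne_zero (by omega)
  let ι : Type := {x : Fin p × Bool // x ≠ (0, true)}
  let β : ι → F := fun i => -(2 * ω ^ (i.1.1 : ℕ))⁻¹
  let a : ι → F := fun i => if i.1.2 then ω ^ (i.1.1 : ℕ) else 2 - ω ^ (i.1.1 : ℕ)
  have hb0 : ∀ i : ℕ, -(2 * ω ^ i)⁻¹ ≠ 0 := fun i =>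
    neg_ne_zero.2 (inv_ne_zero (mul_ne_zero h2 (pow_ne_zero _ hω0)))
  have hcls : ∀ i j : ℕ, i < p → j < p → (-(2 * ω ^ i)⁻¹) ^ e = (-(2 * ω ^ j)⁻¹) ^ e → i = j := by
    intro i j hi hj h
    apply pow_e_inj hω hpp he hi hj
    have h3 : ∀ i : ℕ, (-(2 * ω ^ i)⁻¹) ^ e = (-2⁻¹) ^ e * ((ω ^ i) ^ e)⁻¹ := by
      intro i
      rw [← inv_pow, ← mul_pow, mul_inv, neg_mul]
    rw [h3, h3] at h
    have h4 : (-(2 : F)⁻¹) ^ e ≠ 0 := pow_ne_zero _ (neg_ne_zero.2 (inv_ne_zero h2))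
    exact inv_injective (mul_left_cancel₀ h4 h)
  have hcp : ∀ i : ℕ, algebraMap F (AlgebraicClosure F) ((-(2 * ω ^ i)⁻¹) ^ e) ^ p = 1 := by
    intro i
    rw [← map_pow, ← pow_mul, hee, FiniteField.pow_card_sub_one_eq_one _ (hb0 i), map_one]
  have hinj := (algebraMap F (AlgebraicClosure F)).injective
  have h2K : (2 : AlgebraicClosure F) ≠ 0 := by
    rw [← map_ofNat (algebraMap F (AlgebraicClosure F)) 2, _root_.map_ne_zero]; exact h2
  let i0 : ι := ⟨(0, false), by simp⟩
  obtain ⟨x, hx⟩ := point_F hpp hp hpq ω hω β a (fun i => hb0 _)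
    (by
      refine (Fintype.card_subtype_le _).trans ?_
      simp [mul_comm]) hq (by
      right
      refine ⟨h2K, ?_⟩
      obtain ⟨κ, hκ⟩ := IsAlgClosed.exists_pow_nat_eq (-8 : AlgebraicClosure F) (by norm_num : 0 < 2)
      obtain ⟨j, hj, hj1, hj2, hj3⟩ := exists_missed (hω.map_of_injective hinj) hpp hp hκ
      refine ⟨i0, 1 + κ, fun i => (quad (algebraMap F (AlgebraicClosure F) (β i))
        (algebraMap F (AlgebraicClosure F) (a i)) - 4).eval (1 + κ) = 0,
        algebraMap F _ ((-(2 * ω ^ 0)⁻¹) ^ e), algebraMap F _ ((-(2 * ω ^ j)⁻¹) ^ e), hcp 0, hcp j, ?_, ?_, ?_, ?_⟩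
      · have hb : algebraMap F (AlgebraicClosure F) (β i0) = -2⁻¹ := by
          simp [β, i0]
          exact map_ofNat _ 2
        have ha : algebraMap F (AlgebraicClosure F) (a i0) = 1 := by
          simp only [a, i0]
          norm_num
        simp only [hb, ha]
        exact odd_mult hκ h2K
      · intro i hi
        exact quad_even ((_root_.map_ne_zero _).2 (hb0 _)) _ _ hi
      · intro i hi h
        rw [quad_lead, ← map_pow] at h
        have h5 := hcls _ _ i.1.1.2 (by omega) (hinj h)
        obtain ⟨⟨i, b⟩, hib⟩ := i
        have h6 : i = 0 := Fin.ext h5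
        subst h6
        cases b
        · exact hi rfl
        · exact hib rfl
      · intro i hi h
        rw [quad_lead, ← map_pow] at h
        have h5 := hcls _ _ i.1.1.2 hj (hinj h)
        rw [eval_sub, quad_eval] at hi
        obtain ⟨⟨i, b⟩, hib⟩ := i
        simp only at h5
        have hu0 : algebraMap F (AlgebraicClosure F) ω ^ j ≠ 0 := pow_ne_zero _ ((_root_.map_ne_zero _).2 hω0)
        have e4 : eval (1 + κ) (4 : (AlgebraicClosure F)[X]) = 4 := by
          rw [← map_ofNat C 4, eval_C]
        have hK2 : algebraMap F (AlgebraicClosure F) 2 = 2 := map_ofNat _ 2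
        cases b
        · simp only [β, a, h5, Bool.false_eq_true, if_false, map_neg, map_inv₀, map_mul, map_pow, map_sub, e4, hK2] at hi
          generalize algebraMap F (AlgebraicClosure F) ω ^ j = u at *
          have h7 : (u - 1) * (u - (-7 - 2 * κ)) = 0 := by
            have h8 : (1 + κ - (2 - u)) ^ 2 + 8 * u = 0 := by
              field_simp at hi
              linear_combination -hi
            linear_combination h8 - hκ
          rcases mul_eq_zero.1 h7 with h8 | h8
          · exact hj1 (sub_eq_zero.1 h8)
          · exact hj2 (sub_eq_zero.1 h8)
        · simp only [β, a, h5, if_true, map_neg, map_inv₀, map_mul, map_pow, map_sub, e4, hK2] at hi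
          generalize algebraMap F (AlgebraicClosure F) ω ^ j = u at *
          have h7 : (u - 1) * (u - (-7 + 2 * κ)) = 0 := by
            have h8 : (1 + κ - u) ^ 2 + 8 * u = 0 := by
              field_simp at hi
              linear_combination -hi
            linear_combination h8 - hκ
          rcases mul_eq_zero.1 h7 with h8 | h8
          · exact hj1 (sub_eq_zero.1 h8)
          · exact hj3 (sub_eq_zero.1 h8))
  refine ⟨!![1, x; 1, x - 2], ?_, ?_⟩
  · rw [Matrix.det_fin_two_of]
    have : 1 * (x - 2) - x * 1 = -2 := by ring
    rw [this]; exact neg_ne_zero.2 h2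
  intro i hi
  have hu0 : ω ^ i ≠ 0 := pow_ne_zero _ hω0
  have e1 : ∀ u : F, (!![1, x; 1, x - 2] * !![u, 0; 0, 1]) = !![u, x; u, x - 2] := by
    intro u
    simp
  have e2 : ∀ u : F, (!![1, x; 1, x - 2] * !![u, 0; 0, 1] * !![0, -1; 1, 0]) =
      !![x, -u; x - 2, -u] := by
    intro u
    rw [e1]; simp
  rw [e2, e1]
  constructor
  · obtain ⟨lam, l0, l1, l2⟩ := hx ⟨(⟨i, hi⟩, false), by simp⟩
    refine ⟨lam, l0, l2, ?_⟩
    rw [Matrix.det_fin_two_of, Matrix.trace_fin_two_of, l1]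
    simp only [β, a, Bool.false_eq_true, if_false]
    generalize ω ^ i = u at *
    field_simp
    ring
  · by_cases hi0 : i = 0
    · subst hi0
      obtain ⟨lam, l0, l1, l2⟩ := hx i0
      refine ⟨lam, l0, l2, ?_⟩
      rw [Matrix.det_fin_two_of, Matrix.trace_fin_two_of, l1]
      simp only [β, a, i0, Bool.false_eq_true, if_false, Fin.val_zero, pow_zero]
      field_simp
      ring
    · obtain ⟨lam, l0, l1, l2⟩ := hx ⟨(⟨i, hi⟩, true), by
        intro h
        have h3 := congrArg (fun z => ((z : Fin p × Bool).1 : ℕ)) h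
        simp at h3
        exact hi0 h3⟩
      refine ⟨lam, l0, l2, ?_⟩
      rw [Matrix.det_fin_two_of, Matrix.trace_fin_two_of, l1]
      simp only [β, a, if_true]
      generalize ω ^ i = u at *
      field_simp
      ring

theorem exists_G (hpp : p.Prime) (hp : 2 < p) (hpq : p ∣ Fintype.card F - 1)
    (hpq2 : ¬ p ^ 2 ∣ Fintype.card F - 1)
    (ω : F) (hω : IsPrimitiveRoot ω p) (hq : bigN p < Fintype.card F) :
    ∃ G : Matrix (Fin 2) (Fin 2) F, G.det ≠ 0 ∧ ∀ i < p, Good p (G * !![ω ^ i, 0; 0, 1]) ∧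
      Good p (G * !![ω ^ i, 0; 0, 1] * !![0, -1; 1, 0]) := by
  by_cases h2 : (2 : F) = 0
  · exact char_two h2 hpp hp hpq hpq2 ω hω hq
  · exact char_odd h2 hpp hp hpq hpq2 ω hω hq

end FF


end Prelim

namespace FF
variable {F : Type} [Field F] [Fintype F] {p : ℕ}

lemma eig_pow (M : Matrix (Fin 2) (Fin 2) F) (x c : F) (n : ℕ)
    (hx : (M - Matrix.scalar (Fin 2) x).det = 0) (hM : M ^ n = Matrix.scalar (Fin 2) c) :
    x ^ n = c := by
  obtain ⟨v, hv, h⟩ := Matrix.exists_mulVec_eq_zero_iff.mpr hx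
  have h1 : M *ᵥ v = x • v := by
    rw [Matrix.sub_mulVec, sub_eq_zero] at h
    rw [h]
    ext i
    simp [Matrix.scalar_apply, Matrix.mulVec_diagonal]
  have h2 : ∀ k : ℕ, M ^ k *ᵥ v = x ^ k • v := by
    intro k
    induction k with
    | zero => simp
    | succ k ih => rw [pow_succ, ← Matrix.mulVec_mulVec, h1, Matrix.mulVec_smul, ih, smul_smul,
        pow_succ, mul_comm]
  have h3 := h2 n
  rw [hM] at h3
  obtain ⟨i, hi⟩ := Function.ne_iff.mp hv
  have h4 := congrFun h3 i
  simp only [Matrix.scalar_apply, Matrix.mulVec_diagonal, Pi.smul_apply, smul_eq_mul] at h4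
  exact (mul_right_cancel₀ hi h4).symm

lemma good_order (hpp : p.Prime) (hp : 2 < p) (hpq : p ∣ Fintype.card F - 1)
    (m : GL (Fin 2) F) (hm : Good p (m : Matrix (Fin 2) (Fin 2) F)) :
    p ∣ orderOf (QuotientGroup.mk' (Subgroup.center (GL (Fin 2) F)) m) := by
  classical
  obtain ⟨lam, l0, l1, l2⟩ := hm
  set M : Matrix (Fin 2) (Fin 2) F := (m : Matrix (Fin 2) (Fin 2) F) with hMdef
  have hdet : M.det ≠ 0 := by
    have := m.det.ne_zero
    simpa using this
  obtain ⟨e, he⟩ := hpq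
  have hq2 : 1 < Fintype.card F := Fintype.one_lt_card
  have hee : (Fintype.card F - 1) / p = e := by
    rw [he]; exact Nat.mul_div_cancel_left _ hpp.pos
  rw [hee] at l1
  have hlq : lam ^ (p * e) = 1 := by rw [← he]; exact FiniteField.pow_card_sub_one_eq_one lam l0
  have hneg : lam + 1 ≠ 0 := by
    intro h
    have h1 : lam = -1 := by linear_combination h
    rw [h1] at l1 hlq
    apply l1
    have hpo : Odd p := hpp.odd_of_ne_two (by omega)
    rw [pow_mul, hpo.neg_one_pow] at hlq
    exact hlq
  set mu : F := M.trace / (lam + 1) with hmu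
  have htr : M.trace = mu * (lam + 1) := by rw [hmu]; field_simp
  have hd : M.det = lam * mu ^ 2 := by
    have h3 : lam * M.trace ^ 2 = (lam + 1) ^ 2 * M.det := by
      rw [l2]; field_simp; ring
    rw [htr] at h3
    have : (lam + 1) ^ 2 * (M.det - lam * mu ^ 2) = 0 := by linear_combination -h3
    rcases mul_eq_zero.mp this with h | h
    · exact absurd (pow_eq_zero_iff (by norm_num) |>.mp h) hneg
    · linear_combination h
  have hmu0 : mu ≠ 0 := by
    intro h; rw [h] at hd; apply hdet; rw [hd]; ring
  have hchar : ∀ x : F, (M - Matrix.scalar (Fin 2) x).det = x ^ 2 - M.trace * x + M.det := by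
    intro x
    simp [Matrix.det_fin_two, Matrix.trace_fin_two, Matrix.scalar_apply]
    ring
  set n := orderOf (QuotientGroup.mk' (Subgroup.center (GL (Fin 2) F)) m) with hn
  have hpow : QuotientGroup.mk' (Subgroup.center (GL (Fin 2) F)) (m ^ n) = 1 := by
    rw [map_pow, hn, pow_orderOf_eq_one]
  have hc : m ^ n ∈ Subgroup.center (GL (Fin 2) F) := by
    rwa [← QuotientGroup.eq_one_iff]
  obtain ⟨c, hc⟩ := Matrix.GeneralLinearGroup.mem_center_iff_val_mem_range_scalar.mp hc
  have hMn : M ^ n = Matrix.scalar (Fin 2) c := by rw [hc]; simp [hMdef]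
  have e1 : mu ^ n = c := eig_pow M mu c n (by rw [hchar, htr, hd]; ring) hMn
  have e2 : (lam * mu) ^ n = c := eig_pow M (lam * mu) c n (by rw [hchar, htr, hd]; ring) hMn
  have hln : lam ^ n = 1 := by
    rw [mul_pow, e1] at e2
    have hc0 : c ≠ 0 := by rw [← e1]; exact pow_ne_zero _ hmu0
    exact mul_right_cancel₀ hc0 (by rw [e2, one_mul])
  by_contra hnd
  apply l1
  have hcop : Nat.Coprime (orderOf lam) p :=
    Nat.Coprime.coprime_dvd_left (orderOf_dvd_of_pow_eq_one hln)
      ((Nat.Prime.coprime_iff_not_dvd hpp).mpr hnd).symm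
  exact orderOf_dvd_iff_pow_eq_one.mp (hcop.dvd_of_dvd_mul_left (orderOf_dvd_of_pow_eq_one hlq))

/-- The matrix core of the structure of a dihedral subgroup. -/
lemma dihedral_core (hpp : p.Prime) (hp : 2 < p) (hpq : p ∣ Fintype.card F - 1)
    (A B : Matrix (Fin 2) (Fin 2) F) (hA : A.det = 1) (hB : B.det = 1)
    (hAp : A ^ p = 1) (hA1 : A ≠ 1) (hABA : A * B * A = B)
    (d : F) (hB2 : B * B = Matrix.scalar (Fin 2) d) :
    ∃ (H : Matrix (Fin 2) (Fin 2) F) (η : F), H.det ≠ 0 ∧ η ^ p = 1 ∧ η ≠ 1 ∧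
      A * H = H * !![η, 0; 0, η⁻¹] ∧ B * H = H * !![0, -1; 1, 0] := by
  classical
  have hq2 : 1 < Fintype.card F := Fintype.one_lt_card
  -- a primitive root
  obtain ⟨ζ, hζ⟩ : ∃ ζ : F, IsPrimitiveRoot ζ p := by
    obtain ⟨e, he⟩ := hpq
    obtain ⟨g, hg⟩ := IsCyclic.exists_ofOrder_eq_natCard (α := Fˣ)
    have h1 : orderOf g = p * e := by
      rw [hg, Nat.card_eq_fintype_card, Fintype.card_units, he]
    have h2 : IsPrimitiveRoot g (p * e) := h1 ▸ IsPrimitiveRoot.orderOf g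
    have h3 := IsPrimitiveRoot.pow (by have := Nat.sub_pos_of_lt hq2; omega) h2 (mul_comm p e)
    exact ⟨_, IsPrimitiveRoot.coe_units_iff.mpr h3⟩
  have hp0 : (p : F) ≠ 0 := by
    have : NeZero p := ⟨hpp.ne_zero⟩
    exact hζ.neZero'.out
  obtain ⟨η, hηp, hη⟩ : ∃ η : F, η ^ p = 1 ∧ (A - Matrix.scalar (Fin 2) η).det = 0 := by
    have h1 := Polynomial.X_pow_sub_one_eq_prod hpp.pos hζ
    let φ : Polynomial F →* F :=
      (Matrix.detMonoidHom : Matrix (Fin 2) (Fin 2) F →* F).comp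
        ((Polynomial.aeval A : Polynomial F →ₐ[F] Matrix (Fin 2) (Fin 2) F) :
          Polynomial F →* Matrix (Fin 2) (Fin 2) F)
    have hφ : ∀ f : Polynomial F, φ f = (Polynomial.aeval A f).det := fun f => rfl
    have h2 := congrArg φ h1
    rw [map_prod, hφ] at h2
    have h3 : Polynomial.aeval A (Polynomial.X ^ p - 1 : Polynomial F) = 0 := by
      simp [hAp]
    rw [h3, Matrix.det_zero] at h2
    obtain ⟨η, hη, h4⟩ := Finset.prod_eq_zero_iff.mp h2.symm
    refine ⟨η, ?_, ?_⟩
    · exact (Polynomial.mem_nthRootsFinset hpp.pos _).mp hη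
    · rw [hφ] at h4
      rw [← h4]
      congr 1
      simp [Matrix.algebraMap_eq_diagonal, Matrix.scalar_apply]
  have hη0 : η ≠ 0 := by
    rintro rfl
    rw [zero_pow hpp.ne_zero] at hηp
    exact zero_ne_one hηp
  have htr : A.trace * η = η ^ 2 + 1 := by
    have : (A - Matrix.scalar (Fin 2) η).det = η ^ 2 - A.trace * η + A.det := by
      simp [Matrix.det_fin_two, Matrix.trace_fin_two, Matrix.scalar_apply]
      ring
    rw [hη, hA] at this
    linear_combination this
  have hη1 : η ≠ 1 := by
    rintro rfl
    have hN : (A - 1) * (A - 1) = 0 := by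
      rw [Matrix.trace_fin_two] at htr
      rw [Matrix.det_fin_two] at hA
      ext i j
      fin_cases i <;> fin_cases j <;> simp [Matrix.mul_apply, Fin.sum_univ_two, Matrix.sub_apply]
      · linear_combination (A 0 0) * htr - hA
      · linear_combination (A 0 1) * htr
      · linear_combination (A 1 0) * htr
      · linear_combination (A 1 1) * htr - hA
    have hk : ∀ k : ℕ, A ^ k = 1 + (k : F) • (A - 1) := by
      intro k
      induction k with
      | zero => simp
      | succ k ih =>
        rw [pow_succ, ih]
        have : A = 1 + (A - 1) := by abel
        nth_rewrite 2 [this]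
        rw [mul_add, mul_one, add_mul (1 : Matrix (Fin 2) (Fin 2) F), smul_mul_assoc, hN]
        push_cast
        rw [add_smul]
        simp
        abel
    have := hk p
    rw [hAp] at this
    have h0 : (p : F) • (A - 1) = 0 := by simpa using this
    rcases smul_eq_zero.mp h0 with h | h
    · exact hp0 h
    · exact hA1 (sub_eq_zero.mp h)
  have hη2 : η * η ≠ 1 := by
    intro h
    apply hη1
    have h1 : orderOf η ∣ 2 := orderOf_dvd_of_pow_eq_one (by rw [pow_two, h])
    have h2 : orderOf η ∣ p := orderOf_dvd_of_pow_eq_one hηp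
    have h3 : orderOf η ∣ 1 := by
      have : Nat.gcd 2 p = 1 := (Nat.coprime_primes Nat.prime_two hpp).mpr (by omega)
      rw [← this]; exact Nat.dvd_gcd h1 h2
    exact orderOf_eq_one_iff.mp (Nat.dvd_one.mp h3)
  obtain ⟨v, hv, h⟩ := Matrix.exists_mulVec_eq_zero_iff.mpr hη
  have hAv : A *ᵥ v = η • v := by
    rw [Matrix.sub_mulVec, sub_eq_zero] at h
    rw [h]
    ext i
    simp [Matrix.scalar_apply, Matrix.mulVec_diagonal]
  set w := B *ᵥ v with hw
  have hAw : A *ᵥ w = η⁻¹ • w := by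
    have h1 : (A * B * A) *ᵥ v = w := by rw [hABA]
    rw [← Matrix.mulVec_mulVec, hAv, Matrix.mulVec_smul, ← Matrix.mulVec_mulVec, ← hw] at h1
    rw [eq_inv_smul_iff₀ hη0, h1]
  have hBw : B *ᵥ w = d • v := by
    rw [hw, Matrix.mulVec_mulVec, hB2]
    ext i
    simp [Matrix.scalar_apply, Matrix.mulVec_diagonal]
  have hw0 : w ≠ 0 := by
    intro h0
    exact hv (Matrix.eq_zero_of_mulVec_eq_zero (by rw [hB]; exact one_ne_zero) h0)
  set H : Matrix (Fin 2) (Fin 2) F := !![v 0, w 0; v 1, w 1] with hH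
  have hAH : A * H = H * !![η, 0; 0, η⁻¹] := by
    have a0 := congrFun hAv 0
    have a1 := congrFun hAv 1
    have b0 := congrFun hAw 0
    have b1 := congrFun hAw 1
    simp [Matrix.mulVec, dotProduct, Fin.sum_univ_two] at a0 a1 b0 b1
    ext i j
    fin_cases i <;> fin_cases j <;> simp [hH, Matrix.mul_apply, Fin.sum_univ_two]
    · linear_combination a0
    · linear_combination b0
    · linear_combination a1
    · linear_combination b1
  have hBH : B * H = H * !![0, d; 1, 0] := by
    have a0 := congrFun hw 0
    have a1 := congrFun hw 1
    have b0 := congrFun hBw 0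
    have b1 := congrFun hBw 1
    simp only [Matrix.mulVec, dotProduct, Fin.sum_univ_two, Pi.smul_apply, smul_eq_mul] at a0 a1 b0 b1
    ext i j
    fin_cases i <;> fin_cases j <;> simp [hH, Matrix.mul_apply, Fin.sum_univ_two]
    · linear_combination -a0
    · linear_combination b0
    · linear_combination -a1
    · linear_combination b1
  have hHd : H.det ≠ 0 := by
    intro h0
    obtain ⟨x, hx, hx0⟩ := Matrix.exists_mulVec_eq_zero_iff.mpr h0
    have c1 : x 0 • v + x 1 • w = 0 := by
      ext i
      have c0 := congrFun hx0 0
      have c1 := congrFun hx0 1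
      simp [hH, Matrix.mulVec, dotProduct, Fin.sum_univ_two] at c0 c1
      fin_cases i
      · simp; linear_combination c0
      · simp; linear_combination c1
    have c2 : (x 0 * η) • v + (x 1 * η⁻¹) • w = 0 := by
      have := congrArg (fun z => A *ᵥ z) c1
      simpa [Matrix.mulVec_add, Matrix.mulVec_smul, hAv, hAw, smul_smul] using this
    have hne : η - η⁻¹ ≠ 0 := by
      intro h
      apply hη2
      field_simp at h
      linear_combination h
    have c3 : (x 0 * (η - η⁻¹)) • v = 0 := by
      have : (x 0 * (η - η⁻¹)) • v = ((x 0 * η) • v + (x 1 * η⁻¹) • w)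
          - η⁻¹ • (x 0 • v + x 1 • w) := by
        ext i; simp; ring
      rw [this, c1, c2]; simp
    have c4 : x 0 = 0 := by
      rcases smul_eq_zero.mp c3 with h | h
      · exact (mul_eq_zero.mp h).resolve_right hne
      · exact absurd h hv
    have c5 : x 1 = 0 := by
      rw [c4, zero_smul, zero_add] at c1
      exact (smul_eq_zero.mp c1).resolve_right hw0
    apply hx
    ext i
    fin_cases i
    · exact c4
    · exact c5
  have hd1 : d = -1 := by
    have := congrArg Matrix.det hBH
    rw [Matrix.det_mul, Matrix.det_mul, hB, one_mul, Matrix.det_fin_two_of 0 d 1 0] at this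
    have h2 : H.det * (1 + d) = 0 := by linear_combination this
    have := (mul_eq_zero.mp h2).resolve_left hHd
    linear_combination this
  rw [hd1] at hBH
  exact ⟨H, η, hHd, hηp, hη1, hAH, hBH⟩


lemma mk_eq_exists (a b : GL (Fin 2) F)
    (h : QuotientGroup.mk' (Subgroup.center (GL (Fin 2) F)) a =
      QuotientGroup.mk' (Subgroup.center (GL (Fin 2) F)) b) :
    ∃ c : F, (b : Matrix (Fin 2) (Fin 2) F) = c • (a : Matrix (Fin 2) (Fin 2) F) := by
  have h1 : a⁻¹ * b ∈ Subgroup.center (GL (Fin 2) F) := QuotientGroup.eq.mp h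
  obtain ⟨c, hc⟩ := Matrix.GeneralLinearGroup.mem_center_iff_val_mem_range_scalar.mp h1
  refine ⟨c, ?_⟩
  have h2 : b = a * (a⁻¹ * b) := by group
  rw [h2, Units.val_mul, ← hc]
  ext i j
  simp [Matrix.scalar_apply, mul_comm]

lemma mk_eq_of (a b : GL (Fin 2) F) (c : F)
    (h : (b : Matrix (Fin 2) (Fin 2) F) = c • (a : Matrix (Fin 2) (Fin 2) F)) :
    QuotientGroup.mk' (Subgroup.center (GL (Fin 2) F)) a =
      QuotientGroup.mk' (Subgroup.center (GL (Fin 2) F)) b := by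
  apply QuotientGroup.eq.mpr
  apply Matrix.GeneralLinearGroup.mem_center_iff_val_mem_range_scalar.mpr
  refine ⟨c, ?_⟩
  rw [Units.val_mul, h, mul_smul_comm, Units.inv_mul]
  ext i j
  simp [Matrix.scalar_apply, Matrix.diagonal, Matrix.one_apply]

/-- Dihedral subgroups of order `2p` are conjugate to the standard one. -/
lemma dihedral_conj (hpp : p.Prime) (hp : 2 < p) (hpq : p ∣ Fintype.card F - 1)
    (r s : PGL2 F) (hr : r ∈ (SLtoPGL2 F).range) (hs : s ∈ (SLtoPGL2 F).range)
    (hrp : r ^ p = 1) (hr1 : r ≠ 1) (hs2 : s * s = 1) (hrs : r * s * r = s) :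
    ∃ (H W J : GL (Fin 2) F) (ω : F), IsPrimitiveRoot ω p ∧
      (W : Matrix (Fin 2) (Fin 2) F) = !![ω, 0; 0, 1] ∧
      (J : Matrix (Fin 2) (Fin 2) F) = !![0, -1; 1, 0] ∧
      r = QuotientGroup.mk' (Subgroup.center (GL (Fin 2) F)) (H * W * H⁻¹) ∧
      s = QuotientGroup.mk' (Subgroup.center (GL (Fin 2) F)) (H * J * H⁻¹) := by
  classical
  set mk := QuotientGroup.mk' (Subgroup.center (GL (Fin 2) F)) with hmk
  obtain ⟨A0, hA0⟩ := hr
  obtain ⟨B, hB⟩ := hs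
  have hpo : Odd p := hpp.odd_of_ne_two (by omega)
  have hsq : ∀ X : SpecialLinearGroup (Fin 2) F, SLtoPGL2 F X = 1 →
      ∃ c : F, (X : Matrix (Fin 2) (Fin 2) F) = c • 1 ∧ c ^ 2 = 1 := by
    intro X hX
    obtain ⟨c, hc⟩ := mk_eq_exists 1 (Matrix.SpecialLinearGroup.toGL X) (by rw [map_one]; exact hX.symm)
    have hc' : (X : Matrix (Fin 2) (Fin 2) F) = c • 1 := by simpa using hc
    refine ⟨c, hc', ?_⟩
    have h1 := X.det_coe
    rw [hc', Matrix.det_smul, Matrix.det_one] at h1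
    simpa using h1
  -- normalise the lift
  set A : SpecialLinearGroup (Fin 2) F := A0 ^ (p + 1) with hAdef
  have hA : SLtoPGL2 F A = r := by
    rw [hAdef, map_pow, hA0, pow_succ, hrp, one_mul]
  have hAp : (A : Matrix (Fin 2) (Fin 2) F) ^ p = 1 := by
    obtain ⟨c, hc, hc2⟩ := hsq (A0 ^ p) (by rw [map_pow, hA0, hrp])
    rw [Matrix.SpecialLinearGroup.coe_pow] at hc
    rw [hAdef, Matrix.SpecialLinearGroup.coe_pow, ← pow_mul, mul_comm, pow_mul, hc, smul_pow,
      one_pow]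
    obtain ⟨k, hk⟩ := hpo
    rw [show p + 1 = 2 * (k + 1) by omega, pow_mul, hc2, one_pow, one_smul]
  have hA1 : (A : Matrix (Fin 2) (Fin 2) F) ≠ 1 := by
    intro h
    apply hr1
    have : A = 1 := by ext1 i j; rw [h]; rfl
    rw [← hA, this, map_one]
  obtain ⟨d, hd, -⟩ := hsq (B * B) (by rw [map_mul, hB, hs2])
  have hABA : (A : Matrix (Fin 2) (Fin 2) F) * B * A = B := by
    have h0 : SLtoPGL2 F (A * B * A * B⁻¹) = 1 := by
      rw [map_mul, map_mul, map_mul, map_inv, hA, hB, hrs, mul_inv_cancel]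
    obtain ⟨c, hc, hc2⟩ := hsq _ h0
    have h1 : (A : Matrix (Fin 2) (Fin 2) F) * B * A = c • (B : Matrix (Fin 2) (Fin 2) F) := by
      have : A * B * A = (A * B * A * B⁻¹) * B := by group
      have h2 := congrArg (fun X : SpecialLinearGroup (Fin 2) F =>
        (X : Matrix (Fin 2) (Fin 2) F)) this
      simp only [Matrix.SpecialLinearGroup.coe_mul] at h2
      rw [h2]
      simp only [Matrix.SpecialLinearGroup.coe_mul] at hc
      rw [hc, smul_mul_assoc, one_mul]
    have h2 : ∀ k : ℕ, (A : Matrix (Fin 2) (Fin 2) F) ^ k * B * A ^ k = c ^ k • B := by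
      intro k
      induction k with
      | zero => simp
      | succ k ih =>
        have : (A : Matrix (Fin 2) (Fin 2) F) ^ (k + 1) * B * A ^ (k + 1) =
          A ^ k * (A * B * A) * A ^ k := by
          rw [pow_succ]
          nth_rewrite 2 [← pow_succ]
          rw [pow_succ']
          simp only [mul_assoc]
        rw [this, h1, mul_smul_comm, smul_mul_assoc, ih, smul_smul, pow_succ']
    have h3 := h2 p
    rw [hAp, one_mul, mul_one] at h3
    have hB1 : (B : Matrix (Fin 2) (Fin 2) F) ≠ 0 := by
      intro h
      have := B.det_coe
      rw [h, Matrix.det_zero] at this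
      exact zero_ne_one this
    have h4 : c ^ p = 1 := by
      have : (c ^ p - 1) • (B : Matrix (Fin 2) (Fin 2) F) = 0 := by
        rw [sub_smul, ← h3, one_smul, sub_self]
      rcases smul_eq_zero.mp this with h | h
      · exact sub_eq_zero.mp h
      · exact absurd h hB1
    have h5 : c = 1 := by
      obtain ⟨k, hk⟩ := hpo
      rw [hk, pow_succ, pow_mul, hc2, one_pow, one_mul] at h4
      exact h4
    rw [h1, h5, one_smul]
  obtain ⟨H, η, hHd, hηp, hη1, hAH, hBH⟩ := dihedral_core hpp hp hpq
    (A : Matrix (Fin 2) (Fin 2) F) B A.det_coe B.det_coe hAp hA1 hABA d (by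
      rw [← Matrix.SpecialLinearGroup.coe_mul, hd]
      ext i j
      simp [Matrix.scalar_apply, Matrix.diagonal, Matrix.one_apply])
  have hη0 : η ≠ 0 := by
    rintro rfl
    rw [zero_pow hpp.ne_zero] at hηp
    exact zero_ne_one hηp
  have hω : IsPrimitiveRoot (η ^ 2) p := by
    have h1 : IsPrimitiveRoot η p := by
      have := IsPrimitiveRoot.orderOf η
      rwa [orderOf_eq_prime hηp hη1 (hp := ⟨hpp⟩)] at this
    exact h1.pow_of_coprime 2 ((Nat.coprime_primes Nat.prime_two hpp).mpr (by omega))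
  let HG : GL (Fin 2) F := Matrix.GeneralLinearGroup.mkOfDetNeZero H hHd
  let WG : GL (Fin 2) F := Matrix.GeneralLinearGroup.mkOfDetNeZero !![η ^ 2, 0; 0, 1]
    (by simp [Matrix.det_fin_two_of, hη0])
  let JG : GL (Fin 2) F := Matrix.GeneralLinearGroup.mkOfDetNeZero !![0, -1; 1, 0]
    (by simp [Matrix.det_fin_two_of])
  have hHv : (HG : Matrix (Fin 2) (Fin 2) F) = H := rfl
  have hWv : (WG : Matrix (Fin 2) (Fin 2) F) = !![η ^ 2, 0; 0, 1] := rfl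
  have hJv : (JG : Matrix (Fin 2) (Fin 2) F) = !![0, -1; 1, 0] := rfl
  refine ⟨HG, WG, JG, η ^ 2, hω, hWv, hJv, ?_, ?_⟩
  · have h1 : mk (HG * WG * HG⁻¹) = mk (Matrix.SpecialLinearGroup.toGL A) := by
      refine mk_eq_of _ _ η⁻¹ ?_
      have h2 : (A : Matrix (Fin 2) (Fin 2) F) * HG = η⁻¹ • ((HG : Matrix (Fin 2) (Fin 2) F) * WG) := by
        rw [hHv, hWv, hAH, ← mul_smul_comm]
        congr 1
        ext i j
        fin_cases i <;> fin_cases j <;> simp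
        field_simp
      have h3 : (A : Matrix (Fin 2) (Fin 2) F) = (A * HG) * ((HG⁻¹ : GL (Fin 2) F) : Matrix (Fin 2) (Fin 2) F) := by
        rw [mul_assoc, Units.mul_inv, mul_one]
      change (A : Matrix (Fin 2) (Fin 2) F) = _
      rw [h3, h2, smul_mul_assoc]
      rfl
    rw [h1, ← hA]
    rfl
  · have h1 : Matrix.SpecialLinearGroup.toGL B = HG * JG * HG⁻¹ := by
      rw [eq_mul_inv_iff_mul_eq]
      apply Units.ext
      exact hBH
    rw [← h1, ← hB]
    rfl

lemma dihedral_final (hpp : p.Prime) (hp : 2 < p) (hpq : p ∣ Fintype.card F - 1)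
    (hpq2 : ¬ p ^ 2 ∣ Fintype.card F - 1) (hq : bigN p < Fintype.card F)
    (D : Subgroup (PGL2 F)) (hD : D ≤ (SLtoPGL2 F).range) (e : D ≃* DihedralGroup p) :
    ∃ g : PGL2 F, ∀ h ∈ g • (D : Set (PGL2 F)), p ∣ orderOf h := by
  classical
  have : NeZero p := ⟨hpp.ne_zero⟩
  have : Fact (1 < p) := ⟨by omega⟩
  set r : D := e.symm (DihedralGroup.r 1) with hr
  set s : D := e.symm (DihedralGroup.sr 0) with hs
  have hrp : r ^ p = 1 := by
    rw [hr, ← map_pow, DihedralGroup.r_one_pow_n, map_one]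
  have hr1 : r ≠ 1 := by
    intro h
    rw [hr, EmbeddingLike.map_eq_one_iff] at h
    have h1 : (1 : ZMod p) = 0 := by
      rw [DihedralGroup.one_def] at h
      exact DihedralGroup.r.inj h
    exact one_ne_zero h1
  have hs2 : s * s = 1 := by
    rw [hs, ← map_mul, DihedralGroup.sr_mul_self, map_one]
  have hrs : r * s * r = s := by
    rw [hs, hr, ← map_mul, ← map_mul]
    simp
  have hall : ∀ x : D, ∃ k < p, x = r ^ k ∨ x = r ^ k * s := by
    intro x
    obtain ⟨y, rfl⟩ := e.symm.surjective x
    rcases y with i | i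
    · refine ⟨i.val, ZMod.val_lt i, Or.inl ?_⟩
      rw [hr, ← map_pow, DihedralGroup.r_one_pow]
      simp
    · refine ⟨(-i).val, ZMod.val_lt _, Or.inr ?_⟩
      rw [hr, hs, ← map_pow, DihedralGroup.r_one_pow, ← map_mul, DihedralGroup.r_mul_sr]
      simp
  obtain ⟨H, W, J, ω, hω, hW, hJ, hrH, hsH⟩ := dihedral_conj hpp hp hpq (r : PGL2 F) (s : PGL2 F)
    (hD r.2) (hD s.2) (by exact_mod_cast hrp) (by exact_mod_cast hr1) (by exact_mod_cast hs2)
    (by exact_mod_cast hrs)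
  obtain ⟨G, hG, hgood⟩ := exists_G hpp hp hpq hpq2 ω hω hq
  let GG : GL (Fin 2) F := Matrix.GeneralLinearGroup.mkOfDetNeZero G hG
  have hGv : (GG : Matrix (Fin 2) (Fin 2) F) = G := rfl
  set mk := QuotientGroup.mk' (Subgroup.center (GL (Fin 2) F)) with hmk
  have hWk : ∀ k : ℕ, ((W ^ k : GL (Fin 2) F) : Matrix (Fin 2) (Fin 2) F) = !![ω ^ k, 0; 0, 1] := by
    intro k
    induction k with
    | zero => simp [Matrix.one_fin_two]
    | succ k ih =>
      rw [pow_succ, Units.val_mul, ih, hW]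
      simp [pow_succ]
  have hconj : ∀ m : GL (Fin 2) F, orderOf (mk (H * m * H⁻¹)) = orderOf (mk m) := by
    intro m
    rw [map_mul, map_mul, map_inv]
    exact orderOf_injective (MulAut.conj (mk H)).toMonoidHom (MulAut.conj (mk H)).injective (mk m)
  refine ⟨mk (H * GG * H⁻¹), ?_⟩
  intro h hh
  obtain ⟨x, hx, rfl⟩ := hh
  obtain ⟨k, hk, hx' | hx'⟩ := hall ⟨x, hx⟩
  · have h1 : x = mk (H * W * H⁻¹) ^ k := by
      rw [← hrH]; exact congrArg Subtype.val hx'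
    have h2 : mk (H * GG * H⁻¹) • x = mk (H * (GG * W ^ k) * H⁻¹) := by
      rw [h1, smul_eq_mul, ← map_pow, ← map_mul, conj_pow]
      congr 1
      group
    show p ∣ orderOf (mk (H * GG * H⁻¹) • x)
    rw [h2, hconj]
    apply good_order hpp hp hpq
    rw [Units.val_mul, hWk, hGv]
    exact (hgood k hk).1
  · have h1 : x = mk (H * W * H⁻¹) ^ k * mk (H * J * H⁻¹) := by
      rw [← hrH, ← hsH]; exact congrArg Subtype.val hx'
    have h2 : mk (H * GG * H⁻¹) • x = mk (H * (GG * W ^ k * J) * H⁻¹) := by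
      rw [h1, smul_eq_mul, ← map_pow, ← map_mul, ← map_mul, conj_pow]
      congr 1
      group
    show p ∣ orderOf (mk (H * GG * H⁻¹) • x)
    rw [h2, hconj]
    apply good_order hpp hp hpq
    rw [Units.val_mul, Units.val_mul, hWk, hGv, hJ]
    exact (hgood k hk).2

end FF

/-- Main theorem (Theorem 1.2 / 3.1): let `p` be an odd prime.  For all sufficiently
large prime powers `q` with `q ≡ 1 (mod p)` and `p² ∤ q - 1`, if `D` is a dihedral
subgroup of order `2p` of `PSL₂(q)` (viewed inside `PGL₂(q)`), then some coset `gD` with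
`g ∈ PGL₂(q)` consists entirely of elements of order divisible by `p`. -/
theorem coset_of_dihedral_order_divisible
    (p : ℕ) (hp : p.Prime) (hodd : Odd p) :
    ∃ N : ℕ, ∀ (F : Type) (_ : Field F) (_ : Fintype F),
      N < Fintype.card F →
      p ∣ Fintype.card F - 1 → ¬ p ^ 2 ∣ Fintype.card F - 1 →
      ∀ D : Subgroup (PGL2 F),
        D ≤ (SLtoPGL2 F).range →
        Nat.card D = 2 * p →
        Nonempty (D ≃* DihedralGroup p) →
        ∃ g : PGL2 F, ∀ h ∈ g • (D : Set (PGL2 F)), p ∣ orderOf h := by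
  have h2 : 2 < p := by
    have h1 := hp.two_le
    rcases hodd with ⟨k, hk⟩
    omega
  refine ⟨FF.bigN p, ?_⟩
  intro F _ _ hq hpq hpq2 D hD _ he
  obtain ⟨e⟩ := he
  exact FF.dihedral_final hp h2 hpq hpq2 hq D hD e
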